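/- There exists a universal constant C > 0 such that for every weighted graph G = (V,E,w) on n vertices and every parameter 0 < ρ < 1, there exists a finitely supported probability distribution 𝒟 over spanning trees of G such that: (1) every tree T in the support of 𝒟 has lightness Ψ(T) ≤ 1 + ρ, and (2) for every ε ∈ (0,1), at least (1−ε)·(n choose 2) of the unordered pairs {u,v} of distinct vertices satisfy E_{T∼𝒟}[d_T(u,v)] ≤ (C/ρ)·(1 + log(2/ε))⁴ · d_G(u,v). -/

import Mathlib

open Finset

attribute [local instance] Classical.propDecidable

section Defs

variable {V : Type*} [Fintype V]

/-- Total weight of a (sub)graph: the sum of its edge weights. -/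
noncomputable def wWeight (H : SimpleGraph V) (w : Sym2 V → ℝ) : ℝ :=
  ∑ e ∈ H.edgeSet.toFinite.toFinset, w e

/-- Shortest-path distance in a weighted graph: infimum of walk weights. -/
noncomputable def wdist (G : SimpleGraph V) (w : Sym2 V → ℝ) (u v : V) : ℝ :=
  sInf {x : ℝ | ∃ p : G.Walk u v, x = (p.edges.map w).sum}

/-- `T` is a spanning tree of `G`. -/
def IsSpanningTree (G T : SimpleGraph V) : Prop :=
  T ≤ G ∧ T.IsTree

/-- Weight of a minimum spanning tree of `G`. -/
noncomputable def mstWeight (G : SimpleGraph V) (w : Sym2 V → ℝ) : ℝ :=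
  sInf {x : ℝ | ∃ T : SimpleGraph V, IsSpanningTree G T ∧ x = wWeight T w}

/-- `T` is a minimum spanning tree of `G`. -/
def IsMST (G : SimpleGraph V) (w : Sym2 V → ℝ) (T : SimpleGraph V) : Prop :=
  IsSpanningTree G T ∧ ∀ T' : SimpleGraph V, IsSpanningTree G T' → wWeight T w ≤ wWeight T' w

/-- A spanner of `G`: a connected spanning subgraph. -/
def IsSpanner (G H : SimpleGraph V) : Prop := H ≤ G ∧ H.Connected

/-- `G` together with `w` is a weighted graph: connected, positive pairwise-distinct
edge weights. -/
def IsWeightedGraph (G : SimpleGraph V) (w : Sym2 V → ℝ) : Prop :=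
  G.Connected ∧ (∀ e ∈ G.edgeSet, 0 < w e) ∧
    (∀ e ∈ G.edgeSet, ∀ e' ∈ G.edgeSet, e ≠ e' → w e ≠ w e')

/-- The ordered pairs of distinct vertices whose distortion in `H` is at most `t`. -/
noncomputable def goodPairs (G H : SimpleGraph V) (w : Sym2 V → ℝ) (t : ℝ) : Finset (V × V) :=
  Finset.univ.offDiag.filter (fun p => wdist H w p.1 p.2 ≤ t * wdist G w p.1 p.2)

/-- Scaling distortion `γ`: for every `ε ∈ (0,1)`, at least a `(1-ε)` fraction of the
pairs of distinct vertices have distortion at most `γ ε`.  (Counted over ordered pairs: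
`n·(n-1) = 2·(n choose 2)`.) -/
def HasScalingDistortion (G H : SimpleGraph V) (w : Sym2 V → ℝ) (γ : ℝ → ℝ) : Prop :=
  ∀ ε : ℝ, 0 < ε → ε < 1 →
    (1 - ε) * ((Fintype.card V : ℝ) * ((Fintype.card V : ℝ) - 1)) ≤
      ((goodPairs G H w (γ ε)).card : ℝ)

/-- The `ℓ_q`-distortion of the spanner `H` of `G`. -/
noncomputable def distq (G H : SimpleGraph V) (w : Sym2 V → ℝ) (q : ℝ) : ℝ :=
  ((∑ p ∈ (Finset.univ : Finset V).offDiag, (wdist H w p.1 p.2 / wdist G w p.1 p.2) ^ q) /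
    ((Fintype.card V : ℝ) * ((Fintype.card V : ℝ) - 1))) ^ (1 / q)

/-- `R(v,ε)`: the minimal radius `r` such that the ball `B(v,r)` contains at least `εn`
vertices. -/
noncomputable def Rgraph (G : SimpleGraph V) (w : Sym2 V → ℝ) (v : V) (ε : ℝ) : ℝ :=
  sInf {r : ℝ | 0 ≤ r ∧
    ε * (Fintype.card V : ℝ) ≤ ((Finset.univ.filter (fun u => wdist G w u v ≤ r)).card : ℝ)}

/-- Coarse scaling distortion `γ`: every pair of distinct vertices that are mutually
`ε/2`-far has distortion at most `γ ε`. -/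
def HasCoarseScalingDistortion (G H : SimpleGraph V) (w : Sym2 V → ℝ) (γ : ℝ → ℝ) : Prop :=
  ∀ ε : ℝ, 0 < ε → ε < 1 → ∀ u v : V, u ≠ v →
    Rgraph G w v (ε / 2) ≤ wdist G w u v → Rgraph G w u (ε / 2) ≤ wdist G w u v →
    wdist H w u v ≤ γ ε * wdist G w u v

end Defs

set_option linter.unusedSectionVars false

namespace LightTree

section Basics

variable {V : Type*} {G H : SimpleGraph V} {w : Sym2 V → ℝ}

/-- The weight of a walk. -/
noncomputable def wlen (w : Sym2 V → ℝ) {u v : V} (p : G.Walk u v) : ℝ := (p.edges.map w).sum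

@[simp] lemma wlen_nil {u : V} : wlen w (SimpleGraph.Walk.nil : G.Walk u u) = 0 := by simp [wlen]

@[simp] lemma wlen_cons {u v x : V} (h : G.Adj u v) (p : G.Walk v x) :
    wlen w (SimpleGraph.Walk.cons h p) = w s(u, v) + wlen w p := by simp [wlen]

@[simp] lemma wlen_append {u v x : V} (p : G.Walk u v) (q : G.Walk v x) :
    wlen w (p.append q) = wlen w p + wlen w q := by simp [wlen]

@[simp] lemma wlen_reverse {u v : V} (p : G.Walk u v) : wlen w p.reverse = wlen w p := by
  simp [wlen]

@[simp] lemma wlen_mapLe {u v : V} (hle : G ≤ H) (p : G.Walk u v) :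
    wlen w (p.mapLe hle) = wlen w p := by simp [wlen]

lemma wlen_eq_of_edges {u v u' v' : V} {p : G.Walk u v} {q : H.Walk u' v'}
    (h : p.edges = q.edges) : wlen w p = wlen w q := by simp [wlen, h]

lemma wlen_nonneg (hw : ∀ e, 0 ≤ w e) {u v : V} (p : G.Walk u v) : 0 ≤ wlen w p :=
  List.sum_nonneg (by simp only [List.mem_map]; rintro _ ⟨e, -, rfl⟩; exact hw e)

lemma wlen_bypass_le (hw : ∀ e, 0 ≤ w e) {u v : V} (p : G.Walk u v) :
    wlen w p.bypass ≤ wlen w p := by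
  refine List.Sublist.sum_le_sum ((p.edges_bypass_sublist_edges).map w) ?_
  simp only [List.mem_map]; rintro _ ⟨e, -, rfl⟩; exact hw e

lemma wlen_le_mul {w' : Sym2 V → ℝ} {c : ℝ} {u v : V} (p : G.Walk u v)
    (h : ∀ e ∈ p.edges, w' e ≤ c * w e) : wlen w' p ≤ c * wlen w p := by
  induction p with
  | nil => simp
  | cons ha p ih =>
    simp only [SimpleGraph.Walk.edges_cons, List.mem_cons, forall_eq_or_imp] at h
    simp only [wlen_cons]
    have := ih h.2
    linarith [h.1]

lemma bddBelow_wlen (hw : ∀ e, 0 ≤ w e) (G : SimpleGraph V) (u v : V) :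
    BddBelow {x : ℝ | ∃ p : G.Walk u v, x = (p.edges.map w).sum} :=
  ⟨0, by rintro _ ⟨p, rfl⟩; exact wlen_nonneg hw p⟩

lemma wdist_le (hw : ∀ e, 0 ≤ w e) {u v : V} (p : G.Walk u v) : wdist G w u v ≤ wlen w p :=
  csInf_le (bddBelow_wlen hw G u v) ⟨p, rfl⟩

lemma wdist_nonneg (hw : ∀ e, 0 ≤ w e) (u v : V) : 0 ≤ wdist G w u v :=
  Real.sInf_nonneg (by rintro _ ⟨p, rfl⟩; exact wlen_nonneg hw p)

lemma le_wdist {u v : V} (h : G.Reachable u v) {x : ℝ}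
    (hx : ∀ p : G.Walk u v, x ≤ wlen w p) : x ≤ wdist G w u v := by
  obtain ⟨p0⟩ := h
  refine le_csInf ⟨_, p0, rfl⟩ ?_
  rintro _ ⟨q, rfl⟩
  exact hx q

@[simp] lemma wdist_self (hw : ∀ e, 0 ≤ w e) (u : V) : wdist G w u u = 0 :=
  le_antisymm (by simpa using wdist_le hw (SimpleGraph.Walk.nil : G.Walk u u))
    (wdist_nonneg hw u u)

lemma wdist_comm (u v : V) : wdist G w u v = wdist G w v u := by
  unfold wdist
  congr 1
  ext x
  constructor <;> rintro ⟨p, rfl⟩ <;> exact ⟨p.reverse, by simp⟩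

lemma wdist_le_of_adj (hw : ∀ e, 0 ≤ w e) {u v : V} (h : G.Adj u v) :
    wdist G w u v ≤ w s(u, v) := by
  simpa using wdist_le hw h.toWalk

lemma wdist_anti (hw : ∀ e, 0 ≤ w e) (hle : G ≤ H) {u v : V} (h : G.Reachable u v) :
    wdist H w u v ≤ wdist G w u v :=
  le_wdist h fun p => by simpa using wdist_le hw (p.mapLe hle)

lemma wlen_pos (hw : ∀ e, 0 < w e) {u v : V} (h : u ≠ v) (p : G.Walk u v) : 0 < wlen w p := by
  cases p with
  | nil => exact absurd rfl h
  | cons ha p =>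
    rw [wlen_cons]
    have := wlen_nonneg (fun e => (hw e).le) p
    exact add_pos_of_pos_of_nonneg (hw _) this

variable [Fintype V]

lemma exists_path_eq_wdist (hw : ∀ e, 0 ≤ w e) {u v : V} (h : G.Reachable u v) :
    ∃ p : G.Walk u v, p.IsPath ∧ wlen w p = wdist G w u v := by
  have hfin : {x : ℝ | ∃ p : G.Walk u v, p.IsPath ∧ x = wlen w p}.Finite := by
    have : {x : ℝ | ∃ p : G.Walk u v, p.IsPath ∧ x = wlen w p} ⊆
        Set.range (fun p : G.Path u v => wlen w p.1) := by
      rintro _ ⟨p, hp, rfl⟩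
      exact ⟨⟨p, hp⟩, rfl⟩
    exact (Set.finite_range _).subset this
  obtain ⟨p0⟩ := h
  obtain ⟨x, ⟨p, hp, rfl⟩, hx⟩ := hfin.exists_minimal ⟨_, p0.bypass, p0.bypass_isPath, rfl⟩
  refine ⟨p, hp, le_antisymm (le_csInf ⟨_, p0, rfl⟩ ?_) (wdist_le hw p)⟩
  rintro _ ⟨q, rfl⟩
  refine le_trans ?_ (wlen_bypass_le hw q)
  by_contra! hlt
  exact absurd (hx ⟨q.bypass, q.bypass_isPath, rfl⟩ hlt.le) (not_le.2 hlt)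

lemma wdist_triangle (hw : ∀ e, 0 ≤ w e) {u v x : V} (h : G.Reachable u v)
    (h' : G.Reachable v x) : wdist G w u x ≤ wdist G w u v + wdist G w v x := by
  obtain ⟨p, -, hp⟩ := exists_path_eq_wdist hw h
  obtain ⟨q, -, hq⟩ := exists_path_eq_wdist hw h'
  have := wdist_le hw (p.append q)
  rw [wlen_append, hp, hq] at this
  exact this

/-- Every vertex other than the source has a predecessor on a shortest path. -/
lemma exists_pred (hw : ∀ e, 0 ≤ w e) {u v : V} (hr : G.Reachable u v) (h : v ≠ u) :
    ∃ q, G.Adj q v ∧ wdist G w u v = wdist G w u q + w s(q, v) := by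
  obtain ⟨p, -, hp⟩ := exists_path_eq_wdist hw hr.symm
  cases p with
  | nil => exact absurd rfl h
  | @cons _ q _ ha p =>
    refine ⟨q, ha.symm, le_antisymm ?_ ?_⟩
    · have := wdist_triangle hw (p.reachable.symm) ha.symm.reachable
      exact this.trans (by have := wdist_le_of_adj hw ha.symm; linarith)
    · rw [wdist_comm u v, ← hp, wlen_cons, wdist_comm u q, Sym2.eq_swap]
      have := wdist_le hw p
      linarith

end Basics

section Petal

variable {V : Type*} {G : SimpleGraph V} {w : Sym2 V → ℝ}

/-- The graph on `V` whose edges are the edges of `G` inside `Y`. -/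
def restr (G : SimpleGraph V) (Y : Finset V) : SimpleGraph V where
  Adj a b := G.Adj a b ∧ a ∈ Y ∧ b ∈ Y
  symm := ⟨fun _ _ h => ⟨h.1.symm, h.2.2, h.2.1⟩⟩
  loopless := ⟨fun _ h => h.1.ne rfl⟩

lemma restr_mono {Y Z : Finset V} (h : Y ⊆ Z) : restr G Y ≤ restr G Z :=
  fun _ _ hab => ⟨hab.1, h hab.2.1, h hab.2.2⟩

/-- A set of vertices forming a root-to-vertex path that is shortest with respect to `h`. -/
structure Chain (G : SimpleGraph V) (Y : Finset V) (wh : Sym2 V → ℝ) (h : V → ℝ) (root : V)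
    (Q : Finset V) : Prop where
  root_mem : root ∈ Q
  sub : Q ⊆ Y
  inj : ∀ a ∈ Q, ∀ b ∈ Q, h a = h b → a = b
  pred : ∀ p ∈ Q, p ≠ root → ∃ q ∈ Q, (restr G Y).Adj q p ∧ h p = h q + wh s(q, p) ∧
    ∀ p' ∈ Q, h p' < h p → h p' ≤ h q

lemma Chain.nonempty {Y : Finset V} {wh : Sym2 V → ℝ} {h : V → ℝ} {root : V} {Q : Finset V}
    (hQ : Chain G Y wh h root Q) : Q.Nonempty := ⟨_, hQ.root_mem⟩

/-- A cluster of the petal decomposition: a rooted vertex set with reduced edge weights `wh`,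
distances `h` from the root, and a path `P` on which weights may have been reduced. -/
structure PState (G : SimpleGraph V) (w : Sym2 V → ℝ) (Y : Finset V) where
  root : V
  P : Finset V
  wh : Sym2 V → ℝ
  h : V → ℝ
  wh_pos : ∀ e, 0 < wh e
  wh_le : ∀ a ∈ Y, ∀ b ∈ Y, wh s(a, b) ≤ w s(a, b)
  le_wh : ∀ a ∈ Y, ∀ b ∈ Y, w s(a, b) ≤ 2 * wh s(a, b)
  wh_eq : ∀ a ∈ Y, ∀ b ∈ Y, ¬ (a ∈ P ∧ b ∈ P) → wh s(a, b) = w s(a, b)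
  h_root : h root = 0
  lip : ∀ a b, (restr G Y).Adj a b → h b ≤ h a + wh s(a, b)
  pred : ∀ z ∈ Y, z ≠ root → ∃ q, (restr G Y).Adj q z ∧ h z = h q + wh s(q, z)
  chain : Chain G Y wh h root P

/-- A tree in the cluster in which distances to the root are controlled. -/
structure PState.Good {Y : Finset V} (S : PState G w Y) (T : SimpleGraph V) : Prop where
  le : T ≤ restr G Y
  card : T.edgeSet.ncard + 1 ≤ Y.card
  walk : ∀ z ∈ Y, ∃ p : T.Walk S.root z, wlen w p ≤ 4 * S.h z
  walkP : ∀ z ∈ S.P, ∃ p : T.Walk S.root z, wlen w p ≤ 2 * S.h z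

variable {Y : Finset V}

namespace PState

lemma root_mem_Y (S : PState G w Y) : S.root ∈ Y := S.chain.sub S.chain.root_mem

lemma lip_walk (S : PState G w Y) {a b : V} (p : (restr G Y).Walk a b) :
    S.h b ≤ S.h a + wlen S.wh p := by
  induction p with
  | nil => simp
  | cons ha p ih =>
    rw [wlen_cons]
    linarith [S.lip _ _ ha]

variable [Fintype V]

lemma wf_h (h : V → ℝ) : WellFounded (fun a b => h a < h b) :=
  @Finite.wellFounded_of_trans_of_irrefl V _ (fun a b => h a < h b)
    ⟨fun _ _ _ h1 h2 => lt_trans h1 h2⟩ ⟨fun a => lt_irrefl (h a)⟩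

lemma reach (S : PState G w Y) : ∀ z ∈ Y, (restr G Y).Reachable S.root z := by
  intro z
  induction z using (wf_h S.h).induction with
  | _ z ih =>
    intro hz
    by_cases hzr : z = S.root
    · subst hzr; exact SimpleGraph.Reachable.refl _
    · obtain ⟨q, hq, hh⟩ := S.pred z hz hzr
      exact (ih q (by linarith [S.wh_pos s(q, z)]) hq.2.1).trans hq.reachable

lemma reach' (S : PState G w Y) {a b : V} (ha : a ∈ Y) (hb : b ∈ Y) :
    (restr G Y).Reachable a b := (S.reach a ha).symm.trans (S.reach b hb)

lemma h_nonneg (S : PState G w Y) : ∀ z ∈ Y, 0 ≤ S.h z := by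
  intro z
  induction z using (wf_h S.h).induction with
  | _ z ih =>
    intro hz
    by_cases hzr : z = S.root
    · rw [hzr, S.h_root]
    · obtain ⟨q, hq, hh⟩ := S.pred z hz hzr
      have := S.wh_pos s(q, z)
      linarith [ih q (by linarith) hq.2.1]

lemma h_pos (S : PState G w Y) {z : V} (hz : z ∈ Y) (hzr : z ≠ S.root) : 0 < S.h z := by
  obtain ⟨q, hq, hh⟩ := S.pred z hz hzr
  linarith [S.wh_pos s(q, z), S.h_nonneg q hq.2.1]

lemma exists_chain (S : PState G w Y) : ∀ t ∈ Y, ∃ Q, Chain G Y S.wh S.h S.root Q ∧ t ∈ Q ∧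
    ∀ q ∈ Q, S.h q ≤ S.h t := by
  intro t
  induction t using (wf_h S.h).induction with
  | _ t ih =>
    intro ht
    by_cases htr : t = S.root
    · subst htr
      exact ⟨{S.root}, ⟨by simp, by simpa using ht, by simp, by simp⟩, by simp, by simp⟩
    · obtain ⟨q, hq, hh⟩ := S.pred t ht htr
      have hlt : S.h q < S.h t := by linarith [S.wh_pos s(q, t)]
      obtain ⟨Q, hQ, hqQ, hmax⟩ := ih q hlt hq.2.1
      refine ⟨insert t Q, ⟨by simp [hQ.root_mem], ?_, ?_, ?_⟩, by simp, ?_⟩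
      · exact insert_subset ht hQ.sub
      · intro a ha b hb hab
        rw [mem_insert] at ha hb
        rcases ha with rfl | ha <;> rcases hb with rfl | hb
        · rfl
        · linarith [hmax b hb]
        · linarith [hmax a ha]
        · exact hQ.inj a ha b hb hab
      · intro p hp hpr
        rw [mem_insert] at hp
        rcases hp with rfl | hp
        · refine ⟨q, by simp [hqQ], hq, hh, fun p' hp' hlt' => ?_⟩
          rw [mem_insert] at hp'
          rcases hp' with rfl | hp'
          · exact absurd hlt' (lt_irrefl _)
          · exact hmax p' hp'
        · obtain ⟨q', hq', h1, h2, h3⟩ := hQ.pred p hp hpr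
          refine ⟨q', by simp [hq'], h1, h2, fun p' hp' hlt' => ?_⟩
          rw [mem_insert] at hp'
          rcases hp' with rfl | hp'
          · linarith [hmax p hp]
          · exact h3 p' hp' hlt'
      · intro p hp
        rw [mem_insert] at hp
        rcases hp with rfl | hp
        · exact le_rfl
        · linarith [hmax p hp]

/-- The cut function of a petal grown along the chain `Q`. -/
noncomputable def cutFn (S : PState G w Y) (Q : Finset V) (hQ : Q.Nonempty) (z : V) : ℝ :=
  S.h z - Q.inf' hQ (fun p => S.h p / 2 + wdist (restr G Y) S.wh p z)

lemma le_cutFn (S : PState G w Y) {Q : Finset V} {hQ : Q.Nonempty} {p : V} (hp : p ∈ Q) (z : V) :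
    S.h z - S.h p / 2 - wdist (restr G Y) S.wh p z ≤ S.cutFn Q hQ z := by
  have := Finset.inf'_le (fun p => S.h p / 2 + wdist (restr G Y) S.wh p z) hp
  unfold cutFn
  linarith

lemma exists_cutFn_eq (S : PState G w Y) {Q : Finset V} {hQ : Q.Nonempty} (z : V) :
    ∃ p ∈ Q, S.cutFn Q hQ z = S.h z - S.h p / 2 - wdist (restr G Y) S.wh p z := by
  obtain ⟨p, hp, h⟩ := Finset.exists_mem_eq_inf' hQ
    (fun p => S.h p / 2 + wdist (restr G Y) S.wh p z)
  exact ⟨p, hp, by unfold cutFn; rw [h]; ring⟩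

lemma wh_nonneg (S : PState G w Y) (e : Sym2 V) : 0 ≤ S.wh e := (S.wh_pos e).le

lemma cutFn_le (S : PState G w Y) {Q : Finset V} {hQ : Q.Nonempty} (hQY : Q ⊆ Y) {z : V}
    (hz : z ∈ Y) : S.cutFn Q hQ z ≤ S.h z / 2 := by
  obtain ⟨p, hp, h⟩ := S.exists_cutFn_eq (hQ := hQ) z
  obtain ⟨π, -, hπ⟩ := exists_path_eq_wdist S.wh_nonneg (S.reach' (hQY hp) hz)
  have h1 := S.lip_walk π
  have h2 := wlen_nonneg S.wh_nonneg π
  linarith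

lemma cutFn_chain (S : PState G w Y) {Q : Finset V} {hQ : Q.Nonempty} (hQY : Q ⊆ Y) {p : V}
    (hp : p ∈ Q) : S.cutFn Q hQ p = S.h p / 2 := by
  refine le_antisymm (S.cutFn_le hQY (hQY hp)) ?_
  have := S.le_cutFn (hQ := hQ) hp p
  rw [wdist_self S.wh_nonneg] at this
  linarith

lemma wdist_step (S : PState G w Y) {p a b : V} (hp : p ∈ Y) (hab : (restr G Y).Adj a b) :
    wdist (restr G Y) S.wh p b ≤ wdist (restr G Y) S.wh p a + S.wh s(a, b) :=
  (wdist_triangle S.wh_nonneg (S.reach' hp hab.2.1) hab.reachable).trans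
    (add_le_add le_rfl (wdist_le_of_adj S.wh_nonneg hab))

lemma cutFn_lip (S : PState G w Y) {Q : Finset V} {hQ : Q.Nonempty} (hQY : Q ⊆ Y) {a b : V}
    (hab : (restr G Y).Adj a b) :
    S.cutFn Q hQ a ≤ S.cutFn Q hQ b + 2 * w s(a, b) := by
  obtain ⟨p, hp, h⟩ := S.exists_cutFn_eq (hQ := hQ) a
  have h1 := S.le_cutFn (hQ := hQ) hp b
  have h2 := S.wdist_step (hQY hp) hab
  have h3 := S.lip b a hab.symm
  rw [Sym2.eq_swap] at h3
  have h4 := S.wh_le a hab.2.1 b hab.2.2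
  linarith

lemma cutFn_mono (S : PState G w Y) {Q : Finset V} {hQ : Q.Nonempty} (hQY : Q ⊆ Y) {q z : V}
    (hqz : (restr G Y).Adj q z) (hh : S.h z = S.h q + S.wh s(q, z)) :
    S.cutFn Q hQ q ≤ S.cutFn Q hQ z := by
  obtain ⟨p, hp, h⟩ := S.exists_cutFn_eq (hQ := hQ) q
  have h1 := S.le_cutFn (hQ := hQ) hp z
  have h2 := S.wdist_step (hQY hp) hqz
  linarith

end PState

end Petal

section PetalStep

variable {V : Type*} {G : SimpleGraph V} {w : Sym2 V → ℝ} {Y : Finset V} [Fintype V]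

namespace PState

/-- The cluster that keeps the root after cutting off a petal. -/
noncomputable def core (S : PState G w Y) (Q : Finset V) (hQ : Q.Nonempty) (hQY : Q ⊆ Y) (s : ℝ)
    (hs : S.cutFn Q hQ S.root < s) : PState G w (Y.filter fun z => S.cutFn Q hQ z < s) where
  root := S.root
  P := S.P.filter fun z => S.cutFn Q hQ z < s
  wh := S.wh
  h := S.h
  wh_pos := S.wh_pos
  wh_le a ha b hb := S.wh_le a (mem_filter.1 ha).1 b (mem_filter.1 hb).1
  le_wh a ha b hb := S.le_wh a (mem_filter.1 ha).1 b (mem_filter.1 hb).1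
  wh_eq a ha b hb hab := S.wh_eq a (mem_filter.1 ha).1 b (mem_filter.1 hb).1 fun h =>
    hab ⟨mem_filter.2 ⟨h.1, (mem_filter.1 ha).2⟩, mem_filter.2 ⟨h.2, (mem_filter.1 hb).2⟩⟩
  h_root := S.h_root
  lip a b hab := S.lip a b (restr_mono (filter_subset _ _) hab)
  pred z hz hzr := by
    rw [mem_filter] at hz
    obtain ⟨q, hq, hh⟩ := S.pred z hz.1 hzr
    have := S.cutFn_mono (hQ := hQ) hQY hq hh
    exact ⟨q, ⟨hq.1, mem_filter.2 ⟨hq.2.1, this.trans_lt hz.2⟩, mem_filter.2 hz⟩, hh⟩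
  chain :=
    { root_mem := mem_filter.2 ⟨S.chain.root_mem, hs⟩
      sub := fun z hz => mem_filter.2 ⟨S.chain.sub (mem_filter.1 hz).1, (mem_filter.1 hz).2⟩
      inj := fun a ha b hb => S.chain.inj a (mem_filter.1 ha).1 b (mem_filter.1 hb).1
      pred := fun p hp hpr => by
        rw [mem_filter] at hp
        obtain ⟨q, hqP, hq, hh, hmax⟩ := S.chain.pred p hp.1 hpr
        have := (S.cutFn_mono (hQ := hQ) hQY hq hh).trans_lt hp.2
        exact ⟨q, mem_filter.2 ⟨hqP, this⟩, ⟨hq.1, mem_filter.2 ⟨hq.2.1, this⟩,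
          mem_filter.2 ⟨hq.2.2, hp.2⟩⟩, hh, fun p' hp' => hmax p' (mem_filter.1 hp').1⟩ }

/-- The reduced weights in a petal. -/
noncomputable def petalWeight (S : PState G w Y) (P1 : Finset V) (lam : ℝ) (e : Sym2 V) : ℝ :=
  if ∀ x ∈ e, x ∈ P1 then lam * S.wh e else S.wh e

lemma petalWeight_mk (S : PState G w Y) (P1 : Finset V) (lam : ℝ) (a b : V) :
    S.petalWeight P1 lam s(a, b) =
      if a ∈ P1 ∧ b ∈ P1 then lam * S.wh s(a, b) else S.wh s(a, b) := by
  simp [petalWeight]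

lemma le_petalWeight (S : PState G w Y) (P1 : Finset V) {lam : ℝ} (h1 : lam ≤ 1) (e : Sym2 V) :
    lam * S.wh e ≤ S.petalWeight P1 lam e := by
  unfold petalWeight
  split_ifs
  · exact le_rfl
  · nlinarith [S.wh_pos e]

lemma petalWeight_le (S : PState G w Y) (P1 : Finset V) {lam : ℝ} (h1 : lam ≤ 1) (e : Sym2 V) :
    S.petalWeight P1 lam e ≤ S.wh e := by
  unfold petalWeight
  split_ifs
  · nlinarith [S.wh_pos e]
  · exact le_rfl

lemma petalWeight_pos (S : PState G w Y) (P1 : Finset V) {lam : ℝ} (h0 : 0 < lam) (e : Sym2 V) :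
    0 < S.petalWeight P1 lam e := by
  unfold petalWeight
  split_ifs
  · exact mul_pos h0 (S.wh_pos e)
  · exact S.wh_pos e

/-- Walks inside a petal along the chain. -/
lemma petal_chain_walk (S : PState G w Y) {Q : Finset V} (hQ : Chain G Y S.wh S.h S.root Q)
    {s lam : ℝ} (hs : 0 < s) {W P1 : Finset V} {x1 : V}
    (hW : W = Y.filter fun z => s ≤ S.cutFn Q hQ.nonempty z)
    (hP1 : P1 = Q.filter fun z => z ∈ W) (hx1 : x1 ∈ P1) (hmin : ∀ p ∈ P1, S.h x1 ≤ S.h p) :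
    ∀ p ∈ P1, ∃ π : (restr G W).Walk x1 p,
      wlen (S.petalWeight P1 lam) π ≤ lam * (S.h p - S.h x1) := by
  have hmem : ∀ q ∈ Q, (q ∈ W ↔ 2 * s ≤ S.h q) := fun q hq => by
    rw [hW, mem_filter, S.cutFn_chain hQ.sub hq]
    exact ⟨fun h => by linarith [h.2], fun h => ⟨hQ.sub hq, by linarith⟩⟩
  intro p
  induction p using (wf_h S.h).induction with
  | _ p ih =>
    intro hp
    have hpQ : p ∈ Q ∧ p ∈ W := by rw [hP1] at hp; simpa using hp
    have hx1Q : x1 ∈ Q ∧ x1 ∈ W := by rw [hP1] at hx1; simpa using hx1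
    by_cases hpx : p = x1
    · subst hpx
      exact ⟨SimpleGraph.Walk.nil, by simp⟩
    · have hlt : S.h x1 < S.h p := lt_of_le_of_ne (hmin p hp)
        fun h => hpx (hQ.inj p hpQ.1 x1 hx1Q.1 h.symm)
      have hx1h := (hmem x1 hx1Q.1).1 hx1Q.2
      obtain ⟨q, hqQ, hqp, hh, hmax⟩ := hQ.pred p hpQ.1 (by
        rintro rfl; rw [S.h_root] at hlt; linarith)
      have hx1q := hmax x1 hx1Q.1 hlt
      have hqW : q ∈ W := (hmem q hqQ).2 (by linarith)
      have hqP1 : q ∈ P1 := by rw [hP1]; simp [hqQ, hqW]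
      obtain ⟨π, hπ⟩ := ih q (by linarith [S.wh_pos s(q, p)]) hqP1
      have hadj : (restr G W).Adj q p := ⟨hqp.1, hqW, hpQ.2⟩
      refine ⟨π.concat hadj, ?_⟩
      rw [SimpleGraph.Walk.concat_eq_append, wlen_append, wlen_cons, wlen_nil, petalWeight_mk,
        if_pos ⟨hqP1, hp⟩, hh]
      linarith

/-- Walks ending at the chain that stay inside a petal. -/
lemma petal_walk (S : PState G w Y) {Q : Finset V} (hQ : Chain G Y S.wh S.h S.root Q)
    {s lam : ℝ} (hlam : lam ≤ 1) {W P1 : Finset V}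
    (hW : W = Y.filter fun z => s ≤ S.cutFn Q hQ.nonempty z) {z p : V} (hp : p ∈ Q)
    (π : (restr G Y).Walk z p) (hz : s ≤ S.h z - S.h p / 2 - wlen S.wh π) :
    ∃ π' : (restr G W).Walk z p, wlen (S.petalWeight P1 lam) π' ≤ wlen S.wh π := by
  have hmem : ∀ z ∈ Y, ∀ π : (restr G Y).Walk z p, s ≤ S.h z - S.h p / 2 - wlen S.wh π →
      z ∈ W := fun z hz π h => by
    rw [hW, mem_filter]
    refine ⟨hz, le_trans ?_ (S.le_cutFn hp z)⟩
    rw [wdist_comm]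
    linarith [wdist_le S.wh_nonneg π]
  induction π with
  | nil => exact ⟨SimpleGraph.Walk.nil, by simp⟩
  | @cons z q p ha π ih =>
    rw [wlen_cons] at hz
    have h1 := S.lip _ _ ha.symm
    rw [Sym2.eq_swap] at h1
    have h2 : s ≤ S.h q - S.h p / 2 - wlen S.wh π := by linarith
    obtain ⟨π', hπ'⟩ := ih hp h2 hmem
    have hadj : (restr G W).Adj z q :=
      ⟨ha.1, hmem z ha.2.1 (SimpleGraph.Walk.cons ha π) (by rw [wlen_cons]; exact hz),
        hmem q ha.2.2 π h2⟩
    refine ⟨SimpleGraph.Walk.cons hadj π', ?_⟩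
    rw [wlen_cons, wlen_cons]
    linarith [S.petalWeight_le P1 hlam s(z, q)]

lemma petal_lower (S : PState G w Y) {lam : ℝ} (hlam0 : 0 < lam) (hlam : lam ≤ 1)
    {W P1 : Finset V} (hWY : W ⊆ Y) {a b : V} (π : (restr G W).Walk a b) :
    lam * S.h b ≤ lam * S.h a + wlen (S.petalWeight P1 lam) π := by
  induction π with
  | nil => simp
  | @cons a q b ha π ih =>
    rw [wlen_cons]
    have h1 := mul_le_mul_of_nonneg_left (S.lip _ _ (restr_mono hWY ha)) hlam0.le
    have h2 := S.le_petalWeight P1 hlam s(a, q)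
    linarith

lemma exists_petal (S : PState G w Y) {Q : Finset V} (hQ : Chain G Y S.wh S.h S.root Q)
    {s lam : ℝ} (hs : 0 < s) (hlam0 : 0 < lam) (hlam : lam ≤ 1) {W : Finset V}
    (hW : W = Y.filter fun z => s ≤ S.cutFn Q hQ.nonempty z) {t : V} (ht : t ∈ Q)
    (htW : t ∈ W) (hor : lam = 1 ∧ Q = S.P ∨ lam = 1 / 2 ∧ ∀ p ∈ S.P, p ∉ W) :
    ∃ S' : PState G w W, ∃ y1, y1 ∈ Q ∧ y1 ∈ Y ∧ y1 ∉ W ∧ S'.root ∈ Q ∧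
      (restr G Y).Adj y1 S'.root ∧
      S.h S'.root = S.h y1 + S.wh s(y1, S'.root) ∧ 2 * s ≤ S.h S'.root ∧
      S'.P = Q.filter (fun z => z ∈ W) ∧
      (∀ p ∈ S'.P, S'.h p = lam * (S.h p - S.h S'.root)) ∧
      ∀ z ∈ W, ∃ p ∈ Q, ∃ d, s ≤ S.h z - S.h p / 2 - d ∧
        S'.h z ≤ lam * (S.h p - S.h S'.root) + d := by
  set P1 : Finset V := Q.filter (fun z => z ∈ W) with hP1
  have hWY : W ⊆ Y := by rw [hW]; exact filter_subset _ _
  have hmem : ∀ q ∈ Q, (q ∈ W ↔ 2 * s ≤ S.h q) := fun q hq => by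
    rw [hW, mem_filter, S.cutFn_chain hQ.sub hq]
    exact ⟨fun h => by linarith [h.2], fun h => ⟨hQ.sub hq, by linarith⟩⟩
  have htP1 : t ∈ P1 := by rw [hP1]; simp [ht, htW]
  obtain ⟨x1, hx1, hmin⟩ := Finset.exists_min_image P1 S.h ⟨t, htP1⟩
  have hx1Q : x1 ∈ Q ∧ x1 ∈ W := by rw [hP1] at hx1; simpa using hx1
  have hx1h := (hmem x1 hx1Q.1).1 hx1Q.2
  obtain ⟨y1, hy1Q, hy1x1, hh, -⟩ := hQ.pred x1 hx1Q.1 (by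
    rintro rfl; rw [S.h_root] at hx1h; linarith)
  have hy1W : y1 ∉ W := fun h => by
    have := hmin y1 (by rw [hP1]; simp [hy1Q, h])
    linarith [S.wh_pos s(y1, x1)]
  set wh1 := S.petalWeight P1 lam with hwh1
  have hwh1nn : ∀ e, 0 ≤ wh1 e := fun e => (S.petalWeight_pos P1 hlam0 e).le
  have hcw := S.petal_chain_walk hQ hs (lam := lam) hW hP1 hx1 hmin
  have key : ∀ z ∈ W, ∃ p ∈ Q, ∃ d, s ≤ S.h z - S.h p / 2 - d ∧
      ∃ π : (restr G W).Walk x1 z, wlen wh1 π ≤ lam * (S.h p - S.h x1) + d := by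
    intro z hz
    have hz' := hz
    rw [hW, mem_filter] at hz'
    obtain ⟨p, hp, hg⟩ := S.exists_cutFn_eq (hQ := hQ.nonempty) z
    obtain ⟨π, -, hπ⟩ := exists_path_eq_wdist S.wh_nonneg (S.reach' hz'.1 (hQ.sub hp))
    rw [wdist_comm] at hπ
    obtain ⟨π', hπ'⟩ := S.petal_walk (P1 := P1) hQ hlam hW hp π (by
      rw [hπ, ← hg]; exact hz'.2)
    have hp2 : 2 * s ≤ S.h p := by
      have := S.lip_walk π.reverse
      rw [wlen_reverse, hπ] at this
      linarith [hz'.2]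
    obtain ⟨π'', hπ''⟩ := hcw p (by rw [hP1]; simp [hp, (hmem p hp).2 hp2])
    refine ⟨p, hp, _, hg ▸ hz'.2, π''.append π'.reverse, ?_⟩
    rw [wlen_append, wlen_reverse]
    rw [hπ] at hπ'
    linarith
  have hreach : ∀ z ∈ W, (restr G W).Reachable x1 z := fun z hz => by
    obtain ⟨p, -, d, -, π, -⟩ := key z hz
    exact π.reachable
  have hP1h : ∀ p ∈ P1, wdist (restr G W) wh1 x1 p = lam * (S.h p - S.h x1) := fun p hp => by
    have hpQ : p ∈ Q ∧ p ∈ W := by rw [hP1] at hp; simpa using hp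
    obtain ⟨π, hπ⟩ := hcw p hp
    refine le_antisymm ((wdist_le hwh1nn π).trans hπ) (le_wdist (hreach p hpQ.2) fun π' => ?_)
    have := S.petal_lower (P1 := P1) hlam0 hlam hWY π'
    linarith
  refine ⟨
    { root := x1
      P := P1
      wh := wh1
      h := wdist (restr G W) wh1 x1
      wh_pos := S.petalWeight_pos P1 hlam0
      wh_le := fun a ha b hb =>
        (S.petalWeight_le P1 hlam _).trans (S.wh_le a (hWY ha) b (hWY hb))
      le_wh := fun a ha b hb => ?_
      wh_eq := fun a ha b hb hab => ?_
      h_root := wdist_self hwh1nn x1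
      lip := fun a b hab => ?_
      pred := fun z hz hzr => exists_pred hwh1nn (hreach z hz) hzr
      chain := 
        { root_mem := hx1
          sub := fun p hp => by rw [hP1] at hp; exact (mem_filter.1 hp).2
          inj := fun a ha b hb hab => ?_
          pred := fun p hp hpr => ?_ } }, y1, hy1Q, hQ.sub hy1Q, hy1W, hx1Q.1, hy1x1, hh, hx1h,
      rfl, hP1h, fun z hz => ?_⟩
  · rcases hor with ⟨rfl, -⟩ | ⟨rfl, hor⟩
    · have := S.le_petalWeight P1 hlam s(a, b)
      have := S.le_wh a (hWY ha) b (hWY hb)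
      linarith
    · have := S.le_petalWeight P1 hlam s(a, b)
      have := S.wh_eq a (hWY ha) b (hWY hb) fun h => hor a h.1 ha
      linarith
  · rw [hwh1, petalWeight_mk, if_neg hab]
    refine S.wh_eq a (hWY ha) b (hWY hb) fun h => ?_
    rcases hor with ⟨-, rfl⟩ | ⟨-, hor⟩
    · exact hab (by rw [hP1]; simp [h.1, h.2, ha, hb])
    · exact hor a h.1 ha
  · exact (wdist_triangle hwh1nn (hreach a hab.2.1) hab.reachable).trans
      (add_le_add le_rfl (wdist_le_of_adj hwh1nn hab))
  · rw [hP1h a ha, hP1h b hb] at hab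
    have := mul_left_cancel₀ hlam0.ne' hab
    rw [hP1, mem_filter] at ha hb
    exact hQ.inj a ha.1 b hb.1 (by linarith)
  · have hp' : p ∈ Q ∧ p ∈ W := by rw [hP1] at hp; simpa using hp
    have hlt : S.h x1 < S.h p := lt_of_le_of_ne (hmin p hp)
      fun h => hpr (hQ.inj p hp'.1 x1 hx1Q.1 h.symm)
    obtain ⟨q, hqQ, hqp, hh, hmax⟩ := hQ.pred p hp'.1 (by
        rintro rfl; rw [S.h_root] at hlt; linarith)
    have hx1q := hmax x1 hx1Q.1 hlt
    have hqW : q ∈ W := (hmem q hqQ).2 (by linarith)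
    have hqP1 : q ∈ P1 := by rw [hP1]; simp [hqQ, hqW]
    refine ⟨q, hqP1, ⟨hqp.1, hqW, hp'.2⟩, ?_, fun p' hp1 hlt' => ?_⟩
    · rw [hP1h p hp, hP1h q hqP1, hwh1, petalWeight_mk, if_pos ⟨hqP1, hp⟩, hh]
      ring
    · rw [hP1h p' hp1, hP1h p hp] at hlt'
      rw [hP1h p' hp1, hP1h q hqP1]
      have h1 := lt_of_mul_lt_mul_left hlt' hlam0.le
      rw [hP1, mem_filter] at hp1
      have := hmax p' hp1.1 (by linarith)
      exact mul_le_mul_of_nonneg_left (by linarith) hlam0.le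
  · obtain ⟨p, hp, d, hd, π, hπ⟩ := key z hz
    exact ⟨p, hp, d, hd, (wdist_le hwh1nn π).trans hπ⟩

end PState

end PetalStep

section PetalSplit

variable {V : Type*} {G : SimpleGraph V} {w : Sym2 V → ℝ} {Y : Finset V} [Fintype V]

namespace PState

lemma exists_split_chain (S : PState G w Y) (hY : 2 ≤ Y.card) :
    ∃ Q, Chain G Y S.wh S.h S.root Q ∧ ∃ t ∈ Q, 0 < S.h t ∧ (∀ q ∈ Q, S.h q ≤ S.h t) ∧
      (∀ z ∈ Y, S.h z ≤ 2 * S.h t) ∧ (Q = S.P ∨ ∀ p ∈ S.P, S.h p < S.h t / 2) := by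
  obtain ⟨tY, htY, hmaxY⟩ := Finset.exists_max_image Y S.h ⟨_, S.root_mem_Y⟩
  obtain ⟨tP, htP, hmaxP⟩ := Finset.exists_max_image S.P S.h ⟨_, S.chain.root_mem⟩
  have hpos : 0 < S.h tY := by
    obtain ⟨z, hz, hzr⟩ := Finset.exists_mem_ne (by omega : 1 < Y.card) S.root
    exact (S.h_pos hz hzr).trans_le (hmaxY z hz)
  by_cases hc : S.h tY / 2 ≤ S.h tP
  · exact ⟨S.P, S.chain, tP, htP, by linarith, hmaxP,
      fun z hz => by linarith [hmaxY z hz], Or.inl rfl⟩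
  · push Not at hc
    obtain ⟨Q, hQ, htQ, hmax⟩ := S.exists_chain tY htY
    exact ⟨Q, hQ, tY, htQ, hpos, hmax, fun z hz => by linarith [hmaxY z hz],
      Or.inr fun p hp => (hmaxP p hp).trans_lt hc⟩

lemma card_join {R W : Finset V} (hRW : R.card + W.card = Y.card) {TR TW : SimpleGraph V}
    (hR : TR.edgeSet.ncard + 1 ≤ R.card) (hW : TW.edgeSet.ncard + 1 ≤ W.card) (a b : V) :
    (TR ⊔ TW ⊔ SimpleGraph.edge a b).edgeSet.ncard + 1 ≤ Y.card := by
  have h1 : (TR ⊔ TW ⊔ SimpleGraph.edge a b).edgeSet ⊆ TR.edgeSet ∪ TW.edgeSet ∪ {s(a, b)} := by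
    rw [SimpleGraph.edgeSet_sup, SimpleGraph.edgeSet_sup]
    refine Set.union_subset_union_right _ ?_
    rw [SimpleGraph.edge, SimpleGraph.edgeSet_fromEdgeSet]
    exact Set.sdiff_subset
  have h2 := Set.ncard_le_ncard h1 (Set.toFinite _)
  have h3 := Set.ncard_union_le (TR.edgeSet ∪ TW.edgeSet) {s(a, b)}
  have h4 := Set.ncard_union_le TR.edgeSet TW.edgeSet
  rw [Set.ncard_singleton] at h3
  omega

/-- One step of the petal decomposition. -/
theorem exists_split (S : PState G w Y) (hY : 2 ≤ Y.card) :
    ∃ (D : ℝ) (g : V → ℝ), 0 < D ∧ g S.root = 0 ∧ (∃ t ∈ Y, D / 2 ≤ g t) ∧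
      (∀ a b, (restr G Y).Adj a b → g a ≤ g b + 2 * w s(a, b)) ∧ (∀ z ∈ Y, S.h z ≤ 2 * D) ∧
      ∀ s, D / 4 ≤ s → s ≤ D / 2 →
        ∃ (SR : PState G w (Y.filter fun z => g z < s))
          (SW : PState G w (Y.filter fun z => s ≤ g z)),
          ∀ TR TW, SR.Good TR → SW.Good TW → ∃ T, S.Good T ∧ TR ≤ T ∧ TW ≤ T := by
  obtain ⟨Q, hQ, t, htQ, hD, hmax, hh, hor⟩ := S.exists_split_chain hY
  have hroot : S.cutFn Q hQ.nonempty S.root = 0 := by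
    rw [S.cutFn_chain hQ.sub hQ.root_mem, S.h_root]; simp
  have hgt : S.cutFn Q hQ.nonempty t = S.h t / 2 := S.cutFn_chain hQ.sub htQ
  refine ⟨S.h t, S.cutFn Q hQ.nonempty, hD, hroot, ⟨t, hQ.sub htQ, hgt.ge⟩,
    fun a b hab => S.cutFn_lip hQ.sub hab, hh, fun s hs1 hs2 => ?_⟩
  have hs : 0 < s := by linarith
  have hrs : S.cutFn Q hQ.nonempty S.root < s := by rw [hroot]; exact hs
  set W := Y.filter fun z => s ≤ S.cutFn Q hQ.nonempty z with hW
  have htW : t ∈ W := by rw [hW, mem_filter]; exact ⟨hQ.sub htQ, by rw [hgt]; exact hs2⟩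
  obtain ⟨lam, hlam0, hlam1, hlor⟩ : ∃ lam : ℝ, 0 < lam ∧ lam ≤ 1 ∧
      (lam = 1 ∧ Q = S.P ∨ lam = 1 / 2 ∧ ∀ p ∈ S.P, p ∉ W) := by
    rcases hor with h | h
    · exact ⟨1, one_pos, le_rfl, Or.inl ⟨rfl, h⟩⟩
    · refine ⟨1 / 2, by norm_num, by norm_num, Or.inr ⟨rfl, fun p hp hpW => ?_⟩⟩
      rw [hW, mem_filter] at hpW
      have := S.cutFn_le (hQ := hQ.nonempty) hQ.sub hpW.1
      linarith [h p hp]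
  obtain ⟨SW, y1, hy1Q, hy1Y, hy1W, hx1Q, hadj, hx1h, hx1s, hSP, hSPh, hSh⟩ :=
    S.exists_petal hQ hs hlam0 hlam1 hW htQ htW hlor
  refine ⟨S.core Q hQ.nonempty hQ.sub s hrs, SW, fun TR TW hTR hTW => ?_⟩
  set R := Y.filter fun z => S.cutFn Q hQ.nonempty z < s with hR
  have hy1R : y1 ∈ R := by
    rw [hR, mem_filter]
    refine ⟨hy1Y, lt_of_not_ge fun h => hy1W ?_⟩
    rw [hW, mem_filter]; exact ⟨hy1Y, h⟩
  have hy1s : S.h y1 < 2 * s := by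
    rw [hR, mem_filter, S.cutFn_chain hQ.sub hy1Q] at hy1R
    linarith [hy1R.2]
  set T := TR ⊔ TW ⊔ SimpleGraph.edge y1 SW.root with hT
  have hRT : TR ≤ T := le_sup_left.trans le_sup_left
  have hWT : TW ≤ T := le_sup_right.trans le_sup_left
  have heT : T.Adj y1 SW.root := by
    rw [hT, SimpleGraph.sup_adj]
    right
    rw [SimpleGraph.edge_adj]
    exact ⟨Or.inl ⟨rfl, rfl⟩, hadj.ne⟩
  have hcase : ∀ z ∈ Y, z ∉ R → z ∈ W := fun z hz hzR => by
    rw [hW, mem_filter]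
    refine ⟨hz, le_of_not_gt fun h => hzR ?_⟩
    rw [hR, mem_filter]; exact ⟨hz, h⟩
  have hew := S.le_wh y1 hy1Y SW.root hadj.2.2
  have hRw : ∀ z ∈ R, ∃ p : TR.Walk S.root z, wlen w p ≤ 4 * S.h z := hTR.walk
  have hRwP : ∀ z ∈ S.P, z ∈ R → ∃ p : TR.Walk S.root z, wlen w p ≤ 2 * S.h z :=
    fun z hz hzR => hTR.walkP z (mem_filter.2 ⟨hz, (mem_filter.1 hzR).2⟩)
  have hjoin : ∀ {z : V} (p : TR.Walk S.root y1) (q : TW.Walk SW.root z),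
      ∃ p' : T.Walk S.root z, wlen w p' = wlen w p + w s(y1, SW.root) + wlen w q := fun p q =>
    ⟨(p.mapLe hRT).append (SimpleGraph.Walk.cons heT (q.mapLe hWT)), by simp; ring⟩
  refine ⟨T, ⟨?_, ?_, fun z hz => ?_, fun z hz => ?_⟩, hRT, hWT⟩
  · refine sup_le (sup_le (hTR.le.trans (restr_mono (filter_subset _ _)))
      (hTW.le.trans (restr_mono (filter_subset _ _)))) ?_
    rw [SimpleGraph.edge_le_iff]
    exact Or.inr hadj
  · refine card_join ?_ hTR.card hTW.card _ _
    rw [hW]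
    have := Finset.card_filter_add_card_filter_not (s := Y)
      (fun z => S.cutFn Q hQ.nonempty z < s)
    simpa only [not_lt] using this
  · by_cases hzR : z ∈ R
    · obtain ⟨p, hp⟩ := hRw z hzR
      exact ⟨p.mapLe hRT, by simpa using hp⟩
    · have hzW := hcase z hz hzR
      obtain ⟨q, hq⟩ := hTW.walk z hzW
      obtain ⟨p0, hp0, d, hd, hhz⟩ := hSh z hzW
      rcases hlor with ⟨rfl, hQP⟩ | ⟨rfl, hPW⟩
      · obtain ⟨p, hp⟩ := hRwP y1 (hQP ▸ hy1Q) hy1R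
        obtain ⟨p', hp'⟩ := hjoin p q
        refine ⟨p', ?_⟩
        rw [hp']
        linarith [hmax p0 hp0]
      · obtain ⟨p, hp⟩ := hRw y1 hy1R
        obtain ⟨p', hp'⟩ := hjoin p q
        refine ⟨p', ?_⟩
        rw [hp']
        linarith
  · by_cases hzR : z ∈ R
    · obtain ⟨p, hp⟩ := hRwP z hz hzR
      exact ⟨p.mapLe hRT, by simpa using hp⟩
    · have hzW := hcase z (S.chain.sub hz) hzR
      rcases hlor with ⟨rfl, hQP⟩ | ⟨rfl, hPW⟩
      · have hzP : z ∈ SW.P := by rw [hSP, mem_filter]; exact ⟨hQP ▸ hz, hzW⟩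
        obtain ⟨q, hq⟩ := hTW.walkP z hzP
        obtain ⟨p, hp⟩ := hRwP y1 (hQP ▸ hy1Q) hy1R
        obtain ⟨p', hp'⟩ := hjoin p q
        refine ⟨p', ?_⟩
        rw [hp']
        linarith [hSPh z hzP]
      · exact absurd hzW (hPW z hz)

/-- In a good tree any two vertices of the cluster are at distance controlled by the radius. -/
lemma Good.wdist_le {S : PState G w Y} {T : SimpleGraph V} (hw : ∀ e, 0 ≤ w e) (hT : S.Good T)
    {D : ℝ} (hD : ∀ z ∈ Y, S.h z ≤ 2 * D) {a b : V} (ha : a ∈ Y) (hb : b ∈ Y) :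
    T.Reachable a b ∧ wdist T w a b ≤ 16 * D := by
  obtain ⟨p, hp⟩ := hT.walk a ha
  obtain ⟨q, hq⟩ := hT.walk b hb
  refine ⟨p.reachable.symm.trans q.reachable, (LightTree.wdist_le hw (p.reverse.append q)).trans ?_⟩
  rw [wlen_append, wlen_reverse]
  linarith [hD a ha, hD b hb]

/-- The cluster consisting of all vertices. -/
noncomputable def whole (hw : ∀ e, 0 < w e) (hG : G.Connected) (v0 : V) :
    PState G w Finset.univ where
  root := v0
  P := {v0}
  wh := w
  h := wdist (restr G univ) w v0
  wh_pos := hw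
  wh_le _ _ _ _ := le_rfl
  le_wh a _ b _ := by linarith [hw s(a, b)]
  wh_eq _ _ _ _ _ := rfl
  h_root := wdist_self (fun e => (hw e).le) v0
  lip a b hab := by
    have hG' : restr G univ = G := by ext; simp [restr]
    exact (wdist_triangle (fun e => (hw e).le) (by rw [hG']; exact hG.preconnected v0 a)
      hab.reachable).trans (add_le_add le_rfl (wdist_le_of_adj (fun e => (hw e).le) hab))
  pred z _ hzr := by
    have hG' : restr G univ = G := by ext; simp [restr]
    exact exists_pred (fun e => (hw e).le) (by rw [hG']; exact hG.preconnected v0 z) hzr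
  chain := ⟨by simp, by simp, by simp, by simp⟩

lemma Good.isSpanningTree {S : PState G w Finset.univ} {T : SimpleGraph V} (hT : S.Good T) :
    IsSpanningTree G T := by
  have hc : T.Connected := by
    have : Nonempty V := ⟨S.root⟩
    refine ⟨fun a b => ?_⟩
    obtain ⟨p, -⟩ := hT.walk a (mem_univ _)
    obtain ⟨q, -⟩ := hT.walk b (mem_univ _)
    exact p.reachable.symm.trans q.reachable
  refine ⟨hT.le.trans fun a b hab => hab.1, ?_⟩
  rw [SimpleGraph.isTree_iff_connected_and_card]
  refine ⟨hc, le_antisymm ?_ ?_⟩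
  · have := hT.card
    rw [Finset.card_univ] at this
    rwa [Nat.card_eq_fintype_card (α := V), Nat.card_coe_set_eq]
  · exact hc.card_vert_le_card_edgeSet_add_one

end PState

end PetalSplit

section Averaging

variable {E : Type*}

/-- Averaging over a window, avoiding a finite set of radii. -/
lemma exists_radius_sum_le (S : Finset E) (x α β : E → ℝ) (hx : ∀ e ∈ S, 0 ≤ x e)
    (hαβ : ∀ e ∈ S, α e ≤ β e) {A B : ℝ} (hAB : A < B) (N : Set ℝ) (hN : N.Finite) :
    ∃ r, A ≤ r ∧ r ≤ B ∧ r ∉ N ∧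
      (B - A) * ∑ e ∈ S.filter (fun e => α e ≤ r ∧ r < β e), x e ≤
        ∑ e ∈ S, x e * (β e - α e) := by
  set μ := MeasureTheory.volume.restrict (Set.Icc A B) with hμ
  set f : ℝ → ℝ := fun r => ∑ e ∈ S, (Set.Ico (α e) (β e)).indicator (fun _ => x e) r with hf
  have hgint : ∀ e ∈ S, MeasureTheory.Integrable
      (fun r => (Set.Ico (α e) (β e)).indicator (fun _ => x e) r) μ := fun e _ =>
    MeasureTheory.Integrable.indicator (MeasureTheory.integrable_const _) measurableSet_Ico
  have hfint : MeasureTheory.Integrable f μ := MeasureTheory.integrable_finsetSum S hgint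
  have hvol : μ Set.univ = ENNReal.ofReal (B - A) := by
    rw [hμ, MeasureTheory.Measure.restrict_apply_univ, Real.volume_Icc]
  have hμ0 : μ ≠ 0 := by
    intro h
    rw [h] at hvol
    simp only [MeasureTheory.Measure.coe_zero, Pi.zero_apply] at hvol
    have := (ENNReal.ofReal_eq_zero.1 hvol.symm)
    linarith
  have hnull : μ (N ∪ (Set.Icc A B)ᶜ) = 0 := by
    refine MeasureTheory.measure_union_null ?_ ?_
    · exact hN.measure_zero μ
    · rw [hμ, MeasureTheory.Measure.restrict_apply measurableSet_Icc.compl]; simp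
  obtain ⟨r, hr, hle⟩ := MeasureTheory.exists_notMem_null_le_average hμ0 hfint hnull
  simp only [Set.mem_union, Set.mem_compl_iff, not_or, not_not, Set.mem_Icc] at hr
  refine ⟨r, hr.2.1, hr.2.2, hr.1, ?_⟩
  have h1 : f r = ∑ e ∈ S.filter (fun e => α e ≤ r ∧ r < β e), x e := by
    rw [hf, Finset.sum_filter]
    refine Finset.sum_congr rfl fun e _ => ?_
    simp [Set.indicator_apply]
  have h2 : ∫ r, f r ∂μ ≤ ∑ e ∈ S, x e * (β e - α e) := by
    rw [hf, MeasureTheory.integral_finsetSum S hgint]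
    refine Finset.sum_le_sum fun e he => ?_
    rw [MeasureTheory.integral_indicator measurableSet_Ico, MeasureTheory.setIntegral_const,
      smul_eq_mul, mul_comm]
    refine mul_le_mul_of_nonneg_left ?_ (hx e he)
    rw [MeasureTheory.measureReal_def, ← Real.volume_real_Ico_of_le (hαβ e he),
      MeasureTheory.measureReal_def]
    refine ENNReal.toReal_mono (by simp) ?_
    rw [hμ]
    exact MeasureTheory.Measure.restrict_apply_le _ _
  rw [MeasureTheory.average_eq, MeasureTheory.measureReal_def, hvol,
    ENNReal.toReal_ofReal (by linarith), smul_eq_mul] at hle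
  rw [← h1]
  have hBA : 0 < B - A := by linarith
  calc (B - A) * f r ≤ (B - A) * ((B - A)⁻¹ * ∫ r, f r ∂μ) :=
        mul_le_mul_of_nonneg_left hle hBA.le
    _ = ∫ r, f r ∂μ := by field_simp
    _ ≤ _ := h2

lemma sum_div_le_log (α m : E → ℝ) {V0 : ℝ} (hV0 : 0 < V0) (S : Finset E)
    (hm : ∀ e ∈ S, 0 ≤ m e) :
    ∑ e ∈ S, m e / (V0 + ∑ e' ∈ S.filter (fun e' => α e' ≤ α e), m e') ≤
      Real.log ((V0 + ∑ e ∈ S, m e) / V0) := by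
  induction S using Finset.induction_on_max_value α with
  | empty => simp [div_self hV0.ne']
  | insert a S ha hmax ih =>
    have hmS : ∀ e ∈ S, 0 ≤ m e := fun e he => hm e (mem_insert_of_mem he)
    have hma : 0 ≤ m a := hm a (mem_insert_self a S)
    have hS0 : 0 ≤ ∑ e ∈ S, m e := Finset.sum_nonneg hmS
    rw [Finset.sum_insert ha, Finset.sum_insert ha]
    have hfa : (insert a S).filter (fun e' => α e' ≤ α a) = insert a S := by
      refine Finset.filter_true_of_mem fun e he => ?_
      rw [mem_insert] at he
      rcases he with rfl | he
      · exact le_rfl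
      · exact hmax e he
    rw [hfa, Finset.sum_insert ha]
    have h1 : ∑ e ∈ S, m e / (V0 + ∑ e' ∈ (insert a S).filter (fun e' => α e' ≤ α e), m e') ≤
        ∑ e ∈ S, m e / (V0 + ∑ e' ∈ S.filter (fun e' => α e' ≤ α e), m e') := by
      refine Finset.sum_le_sum fun e he => ?_
      have h0 : 0 ≤ ∑ e' ∈ S.filter (fun e' => α e' ≤ α e), m e' :=
        Finset.sum_nonneg fun e' he' => hmS e' (mem_filter.1 he').1
      refine div_le_div_of_nonneg_left (hmS e he) (by linarith) ?_
      refine add_le_add le_rfl (Finset.sum_le_sum_of_subset_of_nonneg ?_ ?_)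
      · exact Finset.filter_subset_filter _ (subset_insert a S)
      · intro e' he' _
        exact hm e' (mem_filter.1 he').1
    set x := V0 + ∑ e ∈ S, m e with hx
    have hx0 : 0 < x := by linarith
    have h2 : m a / (V0 + (m a + ∑ e ∈ S, m e)) ≤
        Real.log ((V0 + (m a + ∑ e ∈ S, m e)) / x) := by
      have hy : V0 + (m a + ∑ e ∈ S, m e) = m a + x := by rw [hx]; ring
      rw [hy]
      have := Real.one_sub_inv_le_log_of_pos (x := (m a + x) / x) (by positivity)
      refine le_trans (le_of_eq ?_) this
      field_simp
      ring
    have h3 : Real.log ((V0 + (m a + ∑ e ∈ S, m e)) / V0) =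
        Real.log ((V0 + (m a + ∑ e ∈ S, m e)) / x) + Real.log (x / V0) := by
      rw [← Real.log_mul (by positivity) (by positivity)]
      congr 1
      field_simp
    rw [h3]
    linarith [ih hmS]

/-- Region growing: some radius in the window cuts few edges compared to the current volume. -/
lemma exists_radius_cut_le (S : Finset E) (c m α β : E → ℝ) {K V0 A B : ℝ} (hK : 0 ≤ K)
    (hc : ∀ e ∈ S, 0 ≤ c e) (hm : ∀ e ∈ S, 0 ≤ m e) (hαβ : ∀ e ∈ S, α e ≤ β e)
    (hcm : ∀ e ∈ S, c e * (β e - α e) ≤ K * m e) (hV0 : 0 < V0) (hAB : A < B)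
    (N : Set ℝ) (hN : N.Finite) :
    ∃ r, A ≤ r ∧ r ≤ B ∧ r ∉ N ∧
      (B - A) * ∑ e ∈ S.filter (fun e => α e ≤ r ∧ r < β e), c e ≤
        K * (V0 + ∑ e ∈ S.filter (fun e => α e ≤ r), m e) *
          (1 + Real.log ((V0 + ∑ e ∈ S, m e) /
            (V0 + ∑ e ∈ S.filter (fun e => α e ≤ A), m e))) := by
  set F : ℝ → ℝ := fun r => V0 + ∑ e ∈ S.filter (fun e => α e ≤ r), m e with hF
  have hmono : ∀ {r r'}, r ≤ r' → F r ≤ F r' := fun {r r'} h => by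
    refine add_le_add le_rfl (Finset.sum_le_sum_of_subset_of_nonneg ?_ fun e he _ =>
      hm e (mem_filter.1 he).1)
    intro e he
    rw [mem_filter] at he ⊢
    exact ⟨he.1, he.2.trans h⟩
  have hpos : ∀ r, 0 < F r := fun r =>
    add_pos_of_pos_of_nonneg hV0 (Finset.sum_nonneg fun e he => hm e (mem_filter.1 he).1)
  obtain ⟨r, hAr, hrB, hrN, hr⟩ := exists_radius_sum_le S
    (fun e => c e / F (max (α e) A)) α β
    (fun e he => div_nonneg (hc e he) (hpos _).le) hαβ hAB N hN
  refine ⟨r, hAr, hrB, hrN, ?_⟩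
  have hsum : ∑ e ∈ S, m e / F (max (α e) A) ≤ 1 + Real.log ((V0 + ∑ e ∈ S, m e) / F A) := by
    rw [← Finset.sum_filter_add_sum_filter_not S (fun e => α e ≤ A)]
    refine add_le_add ?_ ?_
    · have : ∀ e ∈ S.filter (fun e => α e ≤ A), m e / F (max (α e) A) = m e / F A :=
        fun e he => by rw [max_eq_right (mem_filter.1 he).2]
      rw [Finset.sum_congr rfl this, ← Finset.sum_div, div_le_one (hpos A)]
      simp only [hF]
      linarith
    · have hSm : ∀ e ∈ S.filter (fun e => ¬ α e ≤ A), 0 ≤ m e :=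
        fun e he => hm e (mem_filter.1 he).1
      have h := sum_div_le_log α m (hpos A) (S.filter (fun e => ¬ α e ≤ A)) hSm
      have h' : F A + ∑ e ∈ S.filter (fun e => ¬ α e ≤ A), m e = V0 + ∑ e ∈ S, m e := by
        rw [← Finset.sum_filter_add_sum_filter_not S (fun e => α e ≤ A)]
        simp only [hF]; ring
      rw [h'] at h
      refine le_trans (le_of_eq (Finset.sum_congr rfl fun e he => ?_)) h
      rw [mem_filter] at he
      have hAe : A ≤ α e := le_of_lt (not_le.1 he.2)
      rw [max_eq_left hAe]
      congr 1
      simp only [hF]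
      rw [add_assoc, ← Finset.sum_filter_add_sum_filter_not (S.filter fun e' => α e' ≤ α e)
        (fun e => α e ≤ A)]
      congr 2
      · rw [Finset.filter_filter]
        refine Finset.sum_congr (Finset.filter_congr fun e' _ => ?_) fun _ _ => rfl
        exact ⟨fun h => h.2, fun h => ⟨le_trans h hAe, h⟩⟩
      · rw [Finset.filter_filter, Finset.filter_filter]
        refine Finset.sum_congr (Finset.filter_congr fun e' _ => ?_) fun _ _ => rfl
        exact and_comm
  have h1 : (∑ e ∈ S.filter (fun e => α e ≤ r ∧ r < β e), c e) / F r ≤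
      ∑ e ∈ S.filter (fun e => α e ≤ r ∧ r < β e), c e / F (max (α e) A) := by
    rw [Finset.sum_div]
    refine Finset.sum_le_sum fun e he => ?_
    rw [mem_filter] at he
    exact div_le_div_of_nonneg_left (hc e he.1) (hpos _) (hmono (max_le he.2.1 hAr))
  have h2 : ∑ e ∈ S, c e / F (max (α e) A) * (β e - α e) ≤
      K * ∑ e ∈ S, m e / F (max (α e) A) := by
    rw [Finset.mul_sum]
    refine Finset.sum_le_sum fun e he => ?_
    rw [div_mul_eq_mul_div, ← mul_div_assoc]
    exact div_le_div_of_nonneg_right (hcm e he) (hpos _).le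
  have h3 : (B - A) * ((∑ e ∈ S.filter (fun e => α e ≤ r ∧ r < β e), c e) / F r) ≤
      K * (1 + Real.log ((V0 + ∑ e ∈ S, m e) / F A)) :=
    (mul_le_mul_of_nonneg_left h1 (by linarith)).trans
      (hr.trans (h2.trans (mul_le_mul_of_nonneg_left hsum hK)))
  rw [← mul_div_assoc, div_le_iff₀ (hpos r)] at h3
  calc _ ≤ _ := h3
    _ = _ := by simp only [hF]; ring

end Averaging

section GrowRegion

variable {V E : Type*}

/-- If a sequence with `1 ≤ a 0` is bounded then it fails to double at some step; before that
step it grows geometrically. -/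
lemma exists_not_doubling (a : ℕ → ℝ) (h0 : 1 ≤ a 0) {M : ℝ} (hM : ∀ k, a k ≤ M) :
    ∃ k, a (k + 1) ≤ 2 * a k ∧ ∀ k' ≤ k, (2 : ℝ) ^ k' ≤ a k' := by
  have hex : ∃ k, a (k + 1) ≤ 2 * a k := by
    by_contra! h
    have hp : ∀ k, (2 : ℝ) ^ k ≤ a k := fun k => by
      induction k with
      | zero => simpa using h0
      | succ k ih => rw [pow_succ]; linarith [h k]
    obtain ⟨k, hk⟩ := pow_unbounded_of_one_lt M (by norm_num : (1 : ℝ) < 2)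
    linarith [hp k, hM k]
  refine ⟨Nat.find hex, Nat.find_spec hex, fun k' => ?_⟩
  induction k' with
  | zero => intro _; simpa using h0
  | succ k ih =>
    intro hk
    have := Nat.find_min hex (m := k) (by omega)
    rw [pow_succ]
    linarith [ih (by omega)]

set_option maxHeartbeats 1000000 in
lemma exists_growth_radius (Y : Finset V) (S : Finset E) (f μ Gd : V → ℝ) (u : E → V)
    (c m α β : E → ℝ) {K lo hi vol : ℝ} (U : ℝ → ℝ)
    (hU : ∀ r, U r = ∑ z ∈ Y.filter (fun z => f z ≤ r), μ z +
      ∑ e ∈ S.filter (fun e => β e ≤ r), m e)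
    (hvol : vol = ∑ z ∈ Y, μ z + ∑ e ∈ S, m e)
    (hK : 0 ≤ K) (hμ : ∀ z ∈ Y, 0 < μ z) (hu : ∀ e ∈ S, u e ∈ Y) (hc : ∀ e ∈ S, 0 ≤ c e)
    (hm : ∀ e ∈ S, 0 ≤ m e) (hα : ∀ e ∈ S, α e ≤ f (u e)) (hβ : ∀ e ∈ S, f (u e) ≤ β e)
    (hcm : ∀ e ∈ S, c e * (β e - α e) ≤ K * m e) (hlohi : lo < hi)
    (hlo : ∃ z ∈ Y, f z ≤ lo) (hhi : U hi ≤ vol / 2) (hG2 : ∀ z ∈ Y, 2 ≤ Gd z)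
    (hG : ∀ z ∈ Y, ∀ j : ℕ, (2 : ℝ) ^ j ≤ Real.logb 2 (vol / μ z) →
      ((j : ℝ) + 2) * ((j : ℝ) + 3) ≤ Gd z)
    (N : Set ℝ) (hN : N.Finite) :
    ∃ r, lo ≤ r ∧ r ≤ hi ∧ r ∉ N ∧ 0 < U r ∧ U r ≤ vol / 2 ∧
      (hi - lo) * ∑ e ∈ S.filter (fun e => α e ≤ r ∧ r < β e), c e ≤
        6 * K * (∑ z ∈ Y.filter (fun z => f z ≤ r), μ z * Gd z * Real.logb 2 (vol / U r) +
          ∑ e ∈ S.filter (fun e => β e ≤ r), m e * Gd (u e) * Real.logb 2 (vol / U r) +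
          ∑ e ∈ S.filter (fun e => α e ≤ r ∧ r < β e),
            m e * Gd (u e) * (1 + Real.logb 2 (vol / μ (u e)))) := by
  have hUmono : ∀ {r r'}, r ≤ r' → U r ≤ U r' := fun {r r'} h => by
    rw [hU, hU]
    refine add_le_add (Finset.sum_le_sum_of_subset_of_nonneg ?_ fun z hz _ =>
      (hμ z (mem_filter.1 hz).1).le) (Finset.sum_le_sum_of_subset_of_nonneg ?_ fun e he _ =>
      hm e (mem_filter.1 he).1)
    · intro z hz; rw [mem_filter] at hz ⊢; exact ⟨hz.1, hz.2.trans h⟩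
    · intro z hz; rw [mem_filter] at hz ⊢; exact ⟨hz.1, hz.2.trans h⟩
  have hmemU : ∀ z ∈ Y, ∀ r, f z ≤ r → μ z ≤ U r := fun z hz r hr => by
    rw [hU]
    have h1 := Finset.single_le_sum (f := μ) (fun z hz => (hμ z (mem_filter.1 hz).1).le)
      (mem_filter.2 ⟨hz, hr⟩ : z ∈ Y.filter (fun z => f z ≤ r))
    have h2 : 0 ≤ ∑ e ∈ S.filter (fun e => β e ≤ r), m e :=
      Finset.sum_nonneg fun e he => hm e (mem_filter.1 he).1
    linarith
  have hUpos : ∀ r, lo ≤ r → 0 < U r := fun r hr => by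
    obtain ⟨z, hz, hzl⟩ := hlo
    exact (hμ z hz).trans_le (hmemU z hz r (hzl.trans hr))
  have hvolpos : 0 < vol := by linarith [hUpos hi hlohi.le]
  have hlogmono : ∀ {x y : ℝ}, 0 < x → x ≤ y → Real.logb 2 (vol / y) ≤ Real.logb 2 (vol / x) :=
    fun {x y} hx hxy => Real.logb_le_logb_of_le (by norm_num) (div_pos hvolpos (hx.trans_le hxy))
      (div_le_div_of_nonneg_left hvolpos.le hx hxy)
  set b : ℕ → ℝ := fun k => lo + (hi - lo) / (k + 1) with hb
  have hBpos : 0 < hi - lo := by linarith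
  have hblo : ∀ k, lo ≤ b k := fun k => by
    have : 0 ≤ (hi - lo) / ((k : ℝ) + 1) := by positivity
    simp only [hb]; linarith
  have hbanti : ∀ {k k'}, k ≤ k' → b k' ≤ b k := fun {k k'} h => by
    have h' : (k : ℝ) ≤ k' := by exact_mod_cast h
    simp only [hb]
    refine add_le_add le_rfl (div_le_div_of_nonneg_left hBpos.le (by positivity) (by linarith))
  have hbhi : b 0 = hi := by simp [hb]
  have hbstep : ∀ k : ℕ, b k - b (k + 1) = (hi - lo) / ((k + 1) * (k + 2)) := fun k => by
    simp only [hb]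
    push_cast
    field_simp
    ring
  obtain ⟨k, hk, hgeo⟩ := exists_not_doubling (fun k => Real.logb 2 (vol / U (b k)))
    (by
      rw [hbhi, Real.le_logb_iff_rpow_le (by norm_num) (div_pos hvolpos (hUpos _ hlohi.le)),
        Real.rpow_one, le_div_iff₀ (hUpos _ hlohi.le)]
      linarith)
    (M := Real.logb 2 (vol / U lo))
    (fun k => hlogmono (hUpos lo le_rfl) (hUmono (hblo k)))
  set a := Real.logb 2 (vol / U (b k)) with ha
  have ha1 : 1 ≤ a := (one_le_pow₀ (by norm_num)).trans (hgeo k le_rfl)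
  set h := b k - b (k + 1) with hh
  have hhpos : 0 < h := by rw [hh, hbstep]; positivity
  -- light and heavy edges
  set L := S.filter (fun e => μ (u e) ≤ U (b k)) with hL
  have hLS : L ⊆ S := filter_subset _ _
  set V0 := ∑ z ∈ Y.filter (fun z => f z ≤ b (k + 1)), μ z with hV0
  have hV0pos : 0 < V0 := by
    obtain ⟨z, hz, hzl⟩ := hlo
    exact Finset.sum_pos (fun z hz => hμ z (mem_filter.1 hz).1)
      ⟨z, mem_filter.2 ⟨hz, hzl.trans (hblo _)⟩⟩
  obtain ⟨r, hr1, hr2, hrN, hr⟩ := exists_radius_cut_le L c m α β (A := b (k + 1))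
    (B := b k - h / 2) hK (fun e he => hc e (hLS he)) (fun e he => hm e (hLS he))
    (fun e he => (hα e (hLS he)).trans (hβ e (hLS he))) (fun e he => hcm e (hLS he))
    hV0pos (by linarith) N hN
  have hrb : r ≤ b k := by linarith
  have hlor : lo ≤ r := (hblo _).trans hr1
  have hrhi : r ≤ hi := hrb.trans (hbhi ▸ hbanti (Nat.zero_le k))
  have hUr := hUpos r hlor
  have hlight : ∀ z ∈ Y, μ z ≤ U (b k) → a ≤ Real.logb 2 (vol / μ z) ∧
      ((k : ℝ) + 1) * (k + 2) ≤ Gd z := fun z hz hle => by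
    have h1 : a ≤ Real.logb 2 (vol / μ z) := hlogmono (hμ z hz) hle
    refine ⟨h1, le_trans ?_ (hG z hz k ((hgeo k le_rfl).trans h1))⟩
    have : (0 : ℝ) ≤ k := Nat.cast_nonneg k
    nlinarith
  have haL : a ≤ Real.logb 2 (vol / U r) := hlogmono hUr (hUmono hrb)
  have hGnn : ∀ z ∈ Y, 0 ≤ Gd z := fun z hz => by linarith [hG2 z hz]
  have hlognn : ∀ z ∈ Y, 0 ≤ Real.logb 2 (vol / μ z) := fun z hz => by
    refine Real.logb_nonneg (by norm_num) ?_
    rw [le_div_iff₀ (hμ z hz), one_mul, hvol]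
    have h1 := Finset.single_le_sum (f := μ) (fun z hz => (hμ z hz).le) hz
    have h2 : 0 ≤ ∑ e ∈ S, m e := Finset.sum_nonneg hm
    linarith
  refine ⟨r, hlor, hrhi, hrN, hUr, (hUmono hrhi).trans hhi, ?_⟩
  set LC := L.filter (fun e => α e ≤ r ∧ r < β e) with hLC
  -- the light part
  have hlightpart : (hi - lo) * ∑ e ∈ LC, c e ≤
      6 * K * (∑ z ∈ Y.filter (fun z => f z ≤ r), μ z * Gd z * Real.logb 2 (vol / U r) +
          ∑ e ∈ S.filter (fun e => β e ≤ r), m e * Gd (u e) * Real.logb 2 (vol / U r) +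
          ∑ e ∈ LC, m e * Gd (u e) * (1 + Real.logb 2 (vol / μ (u e)))) := by
    set kk := ((k : ℝ) + 1) * (k + 2) with hkk
    have hkkpos : 0 < kk := by positivity
    have hwin : (hi - lo) = 2 * kk * ((b k - h / 2) - b (k + 1)) := by
      have : (b k - h / 2) - b (k + 1) = h / 2 := by rw [hh]; ring
      rw [this, hh, hbstep, hkk]
      field_simp
    have hVA : U (b (k + 1)) ≤ V0 + ∑ e ∈ L.filter (fun e => α e ≤ b (k + 1)), m e := by
      rw [hU]
      refine add_le_add le_rfl (Finset.sum_le_sum_of_subset_of_nonneg ?_ fun e he _ =>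
        hm e (hLS (mem_filter.1 he).1))
      intro e he
      rw [mem_filter] at he
      have hfu := (hβ e he.1).trans he.2
      refine mem_filter.2 ⟨mem_filter.2 ⟨he.1, ?_⟩, (hα e he.1).trans hfu⟩
      exact hmemU _ (hu e he.1) _ (hfu.trans (hbanti (Nat.le_succ k)))
    have hlog : 1 + Real.log ((V0 + ∑ e ∈ L, m e) /
        (V0 + ∑ e ∈ L.filter (fun e => α e ≤ b (k + 1)), m e)) ≤ 3 * a := by
      have hUk := hUpos _ (hblo (k + 1))
      have hLm : 0 ≤ ∑ e ∈ L, m e := Finset.sum_nonneg fun e he => hm e (hLS he)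
      have h1 : Real.log ((V0 + ∑ e ∈ L, m e) /
          (V0 + ∑ e ∈ L.filter (fun e => α e ≤ b (k + 1)), m e)) ≤
          Real.log (vol / U (b (k + 1))) := by
        refine Real.log_le_log (div_pos (by linarith) (by linarith)) ?_
        refine div_le_div₀ hvolpos.le ?_ hUk hVA
        rw [hvol]
        exact add_le_add (Finset.sum_le_sum_of_subset_of_nonneg (filter_subset _ _)
          fun z hz _ => (hμ z hz).le) (Finset.sum_le_sum_of_subset_of_nonneg hLS
          fun e he _ => hm e he)
      have h2 : Real.log (vol / U (b (k + 1))) =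
          Real.log 2 * Real.logb 2 (vol / U (b (k + 1))) := by
        rw [Real.logb, mul_div_cancel₀]
        exact (Real.log_pos (by norm_num)).ne'
      have h3 : Real.log 2 ≤ 1 := by linarith [Real.log_two_lt_d9]
      have h4 : 0 ≤ Real.logb 2 (vol / U (b (k + 1))) := by
        have := hlogmono hUk (hUmono (hbanti (Nat.le_succ k)))
        linarith
      nlinarith
    have hV'nn : 0 ≤ V0 + ∑ e ∈ L.filter (fun e => α e ≤ r), m e :=
      add_nonneg hV0pos.le (Finset.sum_nonneg fun e he => hm e (hLS (mem_filter.1 he).1))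
    have hB : (hi - lo) * ∑ e ∈ LC, c e ≤
        6 * K * (kk * a * (V0 + ∑ e ∈ L.filter (fun e => α e ≤ r), m e)) := by
      rw [hwin, mul_assoc]
      refine (mul_le_mul_of_nonneg_left (hr.trans (mul_le_mul_of_nonneg_left hlog
        (mul_nonneg hK hV'nn))) (by positivity)).trans (le_of_eq (by ring))
    refine hB.trans (mul_le_mul_of_nonneg_left ?_ (by positivity))
    have hsplit : ∑ e ∈ L.filter (fun e => α e ≤ r), m e ≤
        ∑ e ∈ (S.filter (fun e => β e ≤ r)), m e + ∑ e ∈ LC, m e := by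
      rw [← Finset.sum_filter_add_sum_filter_not (L.filter (fun e => α e ≤ r))
        (fun e => β e ≤ r)]
      refine add_le_add (Finset.sum_le_sum_of_subset_of_nonneg ?_ fun e he _ =>
        hm e (mem_filter.1 he).1) (le_of_eq (Finset.sum_congr ?_ fun _ _ => rfl))
      · intro e he
        rw [mem_filter, mem_filter] at he
        exact mem_filter.2 ⟨hLS he.1.1, he.2⟩
      · rw [Finset.filter_filter]
        exact Finset.filter_congr fun e _ => by rw [not_le]
    have hkka : 0 ≤ kk * a := by positivity
    have e1 : kk * a * V0 ≤
        ∑ z ∈ Y.filter (fun z => f z ≤ r), μ z * Gd z * Real.logb 2 (vol / U r) := by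
      rw [hV0, Finset.mul_sum]
      refine (Finset.sum_le_sum_of_subset_of_nonneg (t := Y.filter (fun z => f z ≤ r)) ?_ ?_).trans
        (Finset.sum_le_sum fun z hz => ?_)
      · intro z hz; rw [mem_filter] at hz ⊢; exact ⟨hz.1, hz.2.trans hr1⟩
      · intro z hz _
        exact mul_nonneg hkka (hμ z (mem_filter.1 hz).1).le
      · rw [mem_filter] at hz
        have h1 := (hlight z hz.1 (hmemU z hz.1 _ (hz.2.trans hrb))).2
        calc kk * a * μ z = μ z * (kk * a) := by ring
          _ ≤ μ z * (Gd z * Real.logb 2 (vol / U r)) :=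
            mul_le_mul_of_nonneg_left (mul_le_mul h1 haL (by linarith) (hGnn z hz.1)) (hμ z hz.1).le
          _ = _ := by ring
    have e2 : kk * a * ∑ e ∈ S.filter (fun e => β e ≤ r), m e ≤
        ∑ e ∈ S.filter (fun e => β e ≤ r), m e * Gd (u e) * Real.logb 2 (vol / U r) := by
      rw [Finset.mul_sum]
      refine Finset.sum_le_sum fun e he => ?_
      rw [mem_filter] at he
      have h1 := (hlight _ (hu e he.1) (hmemU _ (hu e he.1) _
        ((hβ e he.1).trans (he.2.trans hrb)))).2
      calc kk * a * m e = m e * (kk * a) := by ring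
        _ ≤ m e * (Gd (u e) * Real.logb 2 (vol / U r)) :=
          mul_le_mul_of_nonneg_left (mul_le_mul h1 haL (by linarith) (hGnn _ (hu e he.1)))
            (hm e he.1)
        _ = _ := by ring
    have e3 : kk * a * ∑ e ∈ LC, m e ≤
        ∑ e ∈ LC, m e * Gd (u e) * (1 + Real.logb 2 (vol / μ (u e))) := by
      rw [Finset.mul_sum]
      refine Finset.sum_le_sum fun e he => ?_
      rw [hLC, hL, mem_filter, mem_filter] at he
      have he1 := he.1.1
      have h1 := hlight _ (hu e he1) he.1.2
      calc kk * a * m e = m e * (kk * a) := by ring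
        _ ≤ m e * (Gd (u e) * (1 + Real.logb 2 (vol / μ (u e)))) :=
          mul_le_mul_of_nonneg_left (mul_le_mul h1.2 (by linarith [h1.1]) (by linarith)
            (hGnn _ (hu e he1))) (hm e he1)
        _ = _ := by ring
    calc kk * a * (V0 + ∑ e ∈ L.filter (fun e => α e ≤ r), m e)
        ≤ kk * a * (V0 + (∑ e ∈ (S.filter (fun e => β e ≤ r)), m e + ∑ e ∈ LC, m e)) :=
          mul_le_mul_of_nonneg_left (by linarith) hkka
      _ ≤ _ := by linarith
  -- the heavy part
  have hheavy : ∀ e ∈ S, ¬ μ (u e) ≤ U (b k) → α e ≤ r → r < β e →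
      (hi - lo) * c e ≤ 6 * K * (m e * Gd (u e) * (1 + Real.logb 2 (vol / μ (u e)))) := by
    intro e he hne hαr hβr
    have hex : ∃ j, U (b j) < μ (u e) := ⟨k, not_le.1 hne⟩
    set j := Nat.find hex with hj
    have hjs : U (b j) < μ (u e) := Nat.find_spec hex
    have hjk : j ≤ k := Nat.find_min' hex (not_le.1 hne)
    have hfb : b j ≤ f (u e) := by
      by_contra! hlt
      exact absurd (hmemU _ (hu e he) _ hlt.le) (not_le.2 hjs)
    have hlen : (b j - b (j + 1)) / 2 ≤ β e - α e := by
      have hβe := hβ e he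
      rcases hjk.lt_or_eq with hlt | heq
      · have h1 : b k ≤ b (j + 1) := hbanti hlt
        have h2 : b (j + 1) ≤ b j := hbanti (Nat.le_succ j)
        linarith
      · rw [heq] at hfb ⊢
        linarith
    have hGj : ((j : ℝ) + 1) * (j + 2) ≤ Gd (u e) := by
      rcases Nat.eq_zero_or_pos j with h0 | hpos
      · rw [h0]; push_cast; linarith [hG2 _ (hu e he)]
      · obtain ⟨i, hi⟩ := Nat.exists_eq_succ_of_ne_zero hpos.ne'
        have h1 : μ (u e) ≤ U (b i) := not_lt.1 (Nat.find_min hex (by omega))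
        have h2 := hG _ (hu e he) i ((hgeo i (by omega)).trans
          (hlogmono (hμ _ (hu e he)) h1))
        rw [hi]; push_cast
        linarith
    have hce := hc e he
    have h1 : c e * ((hi - lo) / ((j + 1) * (j + 2)) / 2) ≤ K * m e := by
      rw [← hbstep]
      exact (mul_le_mul_of_nonneg_left hlen hce).trans (hcm e he)
    have hjj : (0 : ℝ) < (j + 1) * (j + 2) := by positivity
    have h2 : (hi - lo) * c e = 2 * (((j : ℝ) + 1) * (j + 2)) *
        (c e * ((hi - lo) / ((j + 1) * (j + 2)) / 2)) := by field_simp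
    have hmG : 0 ≤ m e * Gd (u e) := mul_nonneg (hm e he) (hGnn _ (hu e he))
    have hKm : 0 ≤ K * m e := mul_nonneg hK (hm e he)
    rw [h2]
    calc _ ≤ 2 * (((j : ℝ) + 1) * (j + 2)) * (K * m e) :=
          mul_le_mul_of_nonneg_left h1 (by positivity)
      _ ≤ 2 * Gd (u e) * (K * m e) := mul_le_mul_of_nonneg_right (by linarith) hKm
      _ = 2 * K * (m e * Gd (u e)) * 1 := by ring
      _ ≤ 6 * K * (m e * Gd (u e)) * (1 + Real.logb 2 (vol / μ (u e))) := by
          refine mul_le_mul ?_ (by linarith [hlognn _ (hu e he)]) zero_le_one (by positivity)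
          nlinarith [mul_nonneg hK hmG]
      _ = _ := by ring
  set HC := (S.filter (fun e => α e ≤ r ∧ r < β e)).filter (fun e => ¬ μ (u e) ≤ U (b k))
  have hsplitcut : ∀ F : E → ℝ, ∑ e ∈ S.filter (fun e => α e ≤ r ∧ r < β e), F e =
      ∑ e ∈ LC, F e + ∑ e ∈ HC, F e := fun F => by
    rw [← Finset.sum_filter_add_sum_filter_not (S.filter (fun e => α e ≤ r ∧ r < β e))
        (fun e => μ (u e) ≤ U (b k))]
    congr 2
    rw [hLC, hL, Finset.filter_filter, Finset.filter_filter]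
    exact Finset.filter_congr fun e _ => and_comm
  rw [hsplitcut, hsplitcut, mul_add]
  have hHC : (hi - lo) * ∑ e ∈ HC, c e ≤ 6 * K * ∑ e ∈ HC,
      m e * Gd (u e) * (1 + Real.logb 2 (vol / μ (u e))) := by
    rw [Finset.mul_sum, Finset.mul_sum]
    refine Finset.sum_le_sum fun e he => ?_
    rw [mem_filter, mem_filter] at he
    exact hheavy e he.1.1 he.2 he.1.2.1 he.1.2.2
  linarith

end GrowRegion

section Volume

variable {V E : Type*} [Fintype E]

/-- The demands living inside `Y`. -/
noncomputable def inside (supp : E → Finset V) (Y : Finset V) : Finset E :=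
  univ.filter fun e => supp e ⊆ Y

/-- The volume of a cluster. -/
noncomputable def cvol (supp : E → Finset V) (μ : V → ℝ) (m : E → ℝ) (Y : Finset V) : ℝ :=
  ∑ z ∈ Y, μ z + ∑ e ∈ inside supp Y, m e

/-- The potential bounding the total stretch inside a cluster. -/
noncomputable def pot (supp : E → Finset V) (μ Gd : V → ℝ) (m : E → ℝ) (k : E → V)
    (Y : Finset V) : ℝ :=
  ∑ z ∈ Y, μ z * Gd z * Real.logb 2 (cvol supp μ m Y / μ z) +
    ∑ e ∈ inside supp Y, m e * Gd (k e) * (1 + Real.logb 2 (cvol supp μ m Y / μ (k e)))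

variable {supp : E → Finset V} {μ Gd : V → ℝ} {c m : E → ℝ} {k : E → V}

lemma mem_inside {Y : Finset V} {e : E} : e ∈ inside supp Y ↔ supp e ⊆ Y := by simp [inside]

lemma inside_mono {X Y : Finset V} (h : X ⊆ Y) : inside supp X ⊆ inside supp Y := fun e he => by
  rw [mem_inside] at he ⊢; exact he.trans h

lemma cvol_mono (hμ : ∀ z, 0 < μ z) (hm : ∀ e, 0 ≤ m e) {X Y : Finset V} (h : X ⊆ Y) :
    cvol supp μ m X ≤ cvol supp μ m Y :=
  add_le_add (Finset.sum_le_sum_of_subset_of_nonneg h fun z _ _ => (hμ z).le)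
    (Finset.sum_le_sum_of_subset_of_nonneg (inside_mono h) fun e _ _ => hm e)

lemma le_cvol (hμ : ∀ z, 0 < μ z) (hm : ∀ e, 0 ≤ m e) {Y : Finset V} {z : V} (hz : z ∈ Y) :
    μ z ≤ cvol supp μ m Y := by
  have h1 := Finset.single_le_sum (f := μ) (fun z _ => (hμ z).le) hz
  have h2 : 0 ≤ ∑ e ∈ inside supp Y, m e := Finset.sum_nonneg fun e _ => hm e
  unfold cvol
  linarith

lemma pot_nonneg (hμ : ∀ z, 0 < μ z) (hm : ∀ e, 0 ≤ m e) (hG2 : ∀ z, 2 ≤ Gd z)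
    (hk : ∀ e, k e ∈ supp e) (Y : Finset V) : 0 ≤ pot supp μ Gd m k Y := by
  have hlog : ∀ z ∈ Y, 0 ≤ Real.logb 2 (cvol supp μ m Y / μ z) := fun z hz => by
    refine Real.logb_nonneg (by norm_num) ?_
    rw [le_div_iff₀ (hμ z), one_mul]
    exact le_cvol hμ hm hz
  refine add_nonneg (Finset.sum_nonneg fun z hz => ?_) (Finset.sum_nonneg fun e he => ?_)
  · exact mul_nonneg (mul_nonneg (hμ z).le (by linarith [hG2 z])) (hlog z hz)
  · have := hlog _ (mem_inside.1 he (hk e))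
    exact mul_nonneg (mul_nonneg (hm e) (by linarith [hG2 (k e)])) (by linarith)

/-- One region growing step, paid for by the drop of the potential. -/
lemma exists_cut (hμ : ∀ z, 0 < μ z) (hc : ∀ e, 0 ≤ c e) (hm : ∀ e, 0 ≤ m e)
    (hG2 : ∀ z, 2 ≤ Gd z) (hk : ∀ e, k e ∈ supp e) {tot : ℝ}
    (hG : ∀ z, ∀ j : ℕ, (2 : ℝ) ^ j ≤ Real.logb 2 (tot / μ z) →
      ((j : ℝ) + 2) * ((j : ℝ) + 3) ≤ Gd z)
    {Y : Finset V} (htot : cvol supp μ m Y ≤ tot) (f : V → ℝ)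
    (hf : ∀ e ∈ inside supp Y, ∀ x ∈ supp e, ∀ y ∈ supp e, c e * (f x - f y) ≤ 4 * m e)
    {lo hi : ℝ} (hlohi : lo < hi) (hlo : ∃ z ∈ Y, f z ≤ lo)
    (hhi : cvol supp μ m (Y.filter fun z => f z ≤ hi) ≤ cvol supp μ m Y / 2)
    (N : Set ℝ) (hN : N.Finite) :
    ∃ r, lo ≤ r ∧ r ≤ hi ∧ r ∉ N ∧
      (hi - lo) * ∑ e ∈ (inside supp Y).filter (fun e =>
          ¬ supp e ⊆ Y.filter (fun z => f z ≤ r) ∧ ¬ supp e ⊆ Y.filter (fun z => r < f z)), c e ≤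
        24 * (pot supp μ Gd m k Y - pot supp μ Gd m k (Y.filter fun z => f z ≤ r) -
          pot supp μ Gd m k (Y.filter fun z => r < f z)) := by
  have hne : ∀ e, (supp e).Nonempty := fun e => ⟨_, hk e⟩
  set α : E → ℝ := fun e => (supp e).inf' (hne e) f with hα
  set β : E → ℝ := fun e => (supp e).sup' (hne e) f with hβ
  set vol := cvol supp μ m Y with hvol
  have hX : ∀ r, (inside supp Y).filter (fun e => β e ≤ r) =
      inside supp (Y.filter fun z => f z ≤ r) := fun r => by
    ext e
    rw [mem_filter, mem_inside, mem_inside, hβ]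
    simp only [Finset.sup'_le_iff]
    constructor
    · exact fun h x hx => mem_filter.2 ⟨h.1 hx, h.2 x hx⟩
    · exact fun h => ⟨fun x hx => (mem_filter.1 (h hx)).1, fun x hx => (mem_filter.1 (h hx)).2⟩
  have hZ : ∀ r, (inside supp Y).filter (fun e => r < α e) =
      inside supp (Y.filter fun z => r < f z) := fun r => by
    ext e
    rw [mem_filter, mem_inside, mem_inside, hα]
    simp only [Finset.lt_inf'_iff]
    constructor
    · exact fun h x hx => mem_filter.2 ⟨h.1 hx, h.2 x hx⟩
    · exact fun h => ⟨fun x hx => (mem_filter.1 (h hx)).1, fun x hx => (mem_filter.1 (h hx)).2⟩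
  have hvp : ∀ z ∈ Y, 0 < vol := fun z hz => (hμ z).trans_le (le_cvol hμ hm hz)
  obtain ⟨r, hr1, hr2, hrN, hUr, hUr2, hr⟩ := exists_growth_radius Y (inside supp Y) f μ Gd k
    c m α β (K := 4) (vol := vol) (fun r => cvol supp μ m (Y.filter fun z => f z ≤ r))
    (fun r => by rw [hX]; rfl) rfl (by norm_num)
    (fun z _ => hμ z) (fun e he => mem_inside.1 he (hk e)) (fun e _ => hc e) (fun e _ => hm e)
    (fun e _ => Finset.inf'_le f (hk e)) (fun e _ => Finset.le_sup' f (hk e))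
    (fun e he => by
      obtain ⟨x, hx, hx'⟩ := Finset.exists_mem_eq_sup' (hne e) f
      obtain ⟨y, hy, hy'⟩ := Finset.exists_mem_eq_inf' (hne e) f
      simp only [hα, hβ]
      rw [hx', hy']
      exact hf e he x hx y hy) hlohi hlo hhi (fun z _ => hG2 z)
    (fun z hz j hj => hG z j (hj.trans (Real.logb_le_logb_of_le (by norm_num)
      (div_pos (hvp z hz) (hμ z)) (div_le_div_of_nonneg_right htot (hμ z).le)))) N hN
  refine ⟨r, hr1, hr2, hrN, ?_⟩
  set X := Y.filter fun z => f z ≤ r with hXdef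
  set Z := Y.filter fun z => r < f z with hZdef
  have hXY : X ⊆ Y := filter_subset _ _
  have hZY : Z ⊆ Y := filter_subset _ _
  have hvX : cvol supp μ m X ≤ vol := cvol_mono hμ hm hXY
  have hvZ : cvol supp μ m Z ≤ vol := cvol_mono hμ hm hZY
  have hcut : (inside supp Y).filter (fun e => ¬ supp e ⊆ X ∧ ¬ supp e ⊆ Z) =
      (inside supp Y).filter (fun e => α e ≤ r ∧ r < β e) := by
    refine Finset.filter_congr fun e he => ?_
    have h1 : supp e ⊆ X ↔ β e ≤ r := by
      rw [← mem_inside, ← hX, mem_filter]; exact and_iff_right he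
    have h2 : supp e ⊆ Z ↔ r < α e := by
      rw [← mem_inside, ← hZ, mem_filter]; exact and_iff_right he
    rw [h1, h2, not_le, not_lt, and_comm]
  rw [hcut]
  refine hr.trans ?_
  rw [show (6 : ℝ) * 4 = 24 by norm_num]
  refine mul_le_mul_of_nonneg_left ?_ (by norm_num)
  have hsplitV : ∀ F : V → ℝ, ∑ z ∈ Y, F z = ∑ z ∈ X, F z + ∑ z ∈ Z, F z := fun F => by
    rw [← Finset.sum_filter_add_sum_filter_not Y (fun z => f z ≤ r)]
    congr 2
    exact Finset.filter_congr fun z _ => not_le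
  have hsplitE : ∀ F : E → ℝ, ∑ e ∈ inside supp Y, F e = ∑ e ∈ inside supp X, F e +
      ∑ e ∈ inside supp Z, F e +
      ∑ e ∈ (inside supp Y).filter (fun e => α e ≤ r ∧ r < β e), F e := fun F => by
    rw [← Finset.sum_filter_add_sum_filter_not (inside supp Y) (fun e => β e ≤ r), hX, add_assoc]
    congr 1
    rw [← Finset.sum_filter_add_sum_filter_not _ (fun e => r < α e), Finset.filter_filter,
      Finset.filter_filter, ← hZ]
    congr 2
    · refine Finset.filter_congr fun e _ => ⟨fun h => h.2, fun h => ⟨not_le.2 ?_, h⟩⟩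
      exact lt_of_lt_of_le h ((Finset.inf'_le f (hk e)).trans (Finset.le_sup' f (hk e)))
    · refine Finset.filter_congr fun e _ => ?_
      rw [not_le, not_lt, and_comm]
  have hlogX : ∀ z, Real.logb 2 (vol / μ z) = Real.logb 2 (cvol supp μ m X / μ z) +
      Real.logb 2 (vol / cvol supp μ m X) := fun z => by
    have hv : 0 < vol := hUr.trans_le hvX
    rw [← Real.logb_mul (div_pos hUr (hμ z)).ne' (div_pos hv hUr).ne']
    congr 1
    have := (hμ z).ne'
    have := hUr.ne'
    field_simp
  have hlogZ : ∀ z ∈ Z, Real.logb 2 (cvol supp μ m Z / μ z) ≤ Real.logb 2 (vol / μ z) :=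
    fun z hz => Real.logb_le_logb_of_le (by norm_num)
      (div_pos ((hμ z).trans_le (le_cvol hμ hm hz)) (hμ z))
      (div_le_div_of_nonneg_right hvZ (hμ z).le)
  have hG0 : ∀ z, 0 ≤ Gd z := fun z => by linarith [hG2 z]
  have e1 : ∑ z ∈ Z, μ z * Gd z * Real.logb 2 (cvol supp μ m Z / μ z) ≤
      ∑ z ∈ Z, μ z * Gd z * Real.logb 2 (vol / μ z) := Finset.sum_le_sum fun z hz =>
    mul_le_mul_of_nonneg_left (hlogZ z hz) (mul_nonneg (hμ z).le (hG0 z))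
  have e2 : ∑ e ∈ inside supp Z, m e * Gd (k e) * (1 + Real.logb 2 (cvol supp μ m Z / μ (k e))) ≤
      ∑ e ∈ inside supp Z, m e * Gd (k e) * (1 + Real.logb 2 (vol / μ (k e))) :=
    Finset.sum_le_sum fun e he => mul_le_mul_of_nonneg_left
      (add_le_add le_rfl (hlogZ _ (mem_inside.1 he (hk e)))) (mul_nonneg (hm e) (hG0 _))
  have e3 : ∑ z ∈ X, μ z * Gd z * Real.logb 2 (vol / μ z) =
      ∑ z ∈ X, μ z * Gd z * Real.logb 2 (cvol supp μ m X / μ z) +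
        ∑ z ∈ X, μ z * Gd z * Real.logb 2 (vol / cvol supp μ m X) := by
    rw [← Finset.sum_add_distrib]
    exact Finset.sum_congr rfl fun z _ => by rw [hlogX]; ring
  have e4 : ∑ e ∈ inside supp X, m e * Gd (k e) * (1 + Real.logb 2 (vol / μ (k e))) =
      ∑ e ∈ inside supp X, m e * Gd (k e) * (1 + Real.logb 2 (cvol supp μ m X / μ (k e))) +
        ∑ e ∈ inside supp X, m e * Gd (k e) * Real.logb 2 (vol / cvol supp μ m X) := by
    rw [← Finset.sum_add_distrib]
    exact Finset.sum_congr rfl fun e _ => by rw [hlogX]; ring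
  unfold pot
  rw [hX, ← hvol]
  rw [hsplitV, hsplitE]
  linarith

end Volume

section Demands

variable {V E : Type*} [Fintype V] [Fintype E] {G : SimpleGraph V} {w : Sym2 V → ℝ}

lemma abs_sub_le_of_walk {Y : Finset V} {g : V → ℝ} (hw : ∀ e, 0 ≤ w e)
    (hg : ∀ a b, (restr G Y).Adj a b → g a ≤ g b + 2 * w s(a, b)) {a b : V} (p : G.Walk a b)
    (hp : p.support.toFinset ⊆ Y) : ∀ x ∈ p.support, |g x - g a| ≤ 2 * wlen w p := by
  induction p with
  | nil => simp
  | cons h p ih =>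
    rename_i u v b
    have hsub : p.support.toFinset ⊆ Y := fun z hz => hp (by
      rw [List.mem_toFinset] at hz ⊢; simp [hz])
    have hu : u ∈ Y := hp (by simp)
    have hv : v ∈ Y := hsub (by simp)
    have h1 := hg u v ⟨h, hu, hv⟩
    have h2 := hg v u ⟨h.symm, hv, hu⟩
    rw [Sym2.eq_swap] at h2
    intro x hx
    rw [SimpleGraph.Walk.support_cons, List.mem_cons] at hx
    rw [wlen_cons]
    have hp0 := wlen_nonneg hw p
    have hw0 := hw s(u, v)
    rcases hx with rfl | hx
    · simp; linarith
    · have := abs_le.1 (ih hsub x hx)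
      exact abs_le.2 ⟨by linarith, by linarith⟩

variable {c : E → ℝ} {supp : E → Finset V} {a b : E → V}

lemma sum_cost_le (hc : ∀ e, 0 ≤ c e) (hne : ∀ e, a e ∈ supp e) (hbe : ∀ e, b e ∈ supp e)
    {Y X Z : Finset V} (hX : X ⊆ Y) (hZ : Z ⊆ Y) (hXZ : Disjoint X Z) {d d1 d2 : V → V → ℝ}
    {B : ℝ} (hd : ∀ x ∈ Y, ∀ y ∈ Y, d x y ≤ B) (hd1 : ∀ x ∈ X, ∀ y ∈ X, d x y ≤ d1 x y)
    (hd2 : ∀ x ∈ Z, ∀ y ∈ Z, d x y ≤ d2 x y) :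
    ∑ e ∈ inside supp Y, c e * d (a e) (b e) ≤
      ∑ e ∈ inside supp X, c e * d1 (a e) (b e) + ∑ e ∈ inside supp Z, c e * d2 (a e) (b e) +
        B * ∑ e ∈ (inside supp Y).filter (fun e => ¬ supp e ⊆ X ∧ ¬ supp e ⊆ Z), c e := by
  have h1 : (inside supp Y).filter (fun e => supp e ⊆ X) = inside supp X := by
    ext e
    rw [mem_filter, mem_inside, mem_inside]
    exact ⟨fun h => h.2, fun h => ⟨h.trans hX, h⟩⟩
  have h2 : ((inside supp Y).filter (fun e => ¬ supp e ⊆ X)).filter (fun e => supp e ⊆ Z) =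
      inside supp Z := by
    ext e
    rw [mem_filter, mem_filter, mem_inside, mem_inside]
    exact ⟨fun h => h.2, fun h => ⟨⟨h.trans hZ, fun h' =>
      (Finset.disjoint_left.1 hXZ (h' (hne e)) (h (hne e)))⟩, h⟩⟩
  rw [← Finset.sum_filter_add_sum_filter_not (inside supp Y) (fun e => supp e ⊆ X), h1,
    ← Finset.sum_filter_add_sum_filter_not ((inside supp Y).filter (fun e => ¬ supp e ⊆ X))
      (fun e => supp e ⊆ Z), h2, Finset.filter_filter, Finset.mul_sum, add_assoc]
  refine add_le_add (Finset.sum_le_sum fun e he => ?_)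
    (add_le_add (Finset.sum_le_sum fun e he => ?_) (Finset.sum_le_sum fun e he => ?_))
  · rw [mem_inside] at he
    exact mul_le_mul_of_nonneg_left (hd1 _ (he (hne e)) _ (he (hbe e))) (hc e)
  · rw [mem_inside] at he
    exact mul_le_mul_of_nonneg_left (hd2 _ (he (hne e)) _ (he (hbe e))) (hc e)
  · rw [mem_filter, mem_inside] at he
    rw [mul_comm B]
    exact mul_le_mul_of_nonneg_left (hd _ (he.1 (hne e)) _ (he.1 (hbe e))) (hc e)

variable {μ Gd : V → ℝ} {k : E → V} (p : ∀ e, G.Walk (a e) (b e))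

lemma cvol_add_le (hμ : ∀ z, 0 < μ z) {m : E → ℝ} (hm : ∀ e, 0 ≤ m e) (hne : ∀ e, a e ∈ supp e)
    {Y X Z : Finset V} (hX : X ⊆ Y) (hZ : Z ⊆ Y) (hXZ : Disjoint X Z) :
    cvol supp μ m X + cvol supp μ m Z ≤ cvol supp μ m Y := by
  have h1 : Disjoint (inside supp X) (inside supp Z) := by
    rw [Finset.disjoint_left]
    intro e h1 h2
    rw [mem_inside] at h1 h2
    exact Finset.disjoint_left.1 hXZ (h1 (hne e)) (h2 (hne e))
  have e1 : ∑ z ∈ X, μ z + ∑ z ∈ Z, μ z ≤ ∑ z ∈ Y, μ z := by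
    rw [← Finset.sum_union hXZ]
    exact Finset.sum_le_sum_of_subset_of_nonneg (Finset.union_subset hX hZ) fun z _ _ => (hμ z).le
  have e2 : ∑ z ∈ inside supp X, m z + ∑ z ∈ inside supp Z, m z ≤ ∑ z ∈ inside supp Y, m z := by
    rw [← Finset.sum_union h1]
    exact Finset.sum_le_sum_of_subset_of_nonneg
      (Finset.union_subset (inside_mono hX) (inside_mono hZ)) fun z _ _ => hm z
  unfold cvol
  linarith

/-- A cluster can be cut with the cut cost paid by the drop of the potential. -/
lemma exists_cluster_cut (hw : ∀ e, 0 ≤ w e) (hμ : ∀ z, 0 < μ z) (hc : ∀ e, 0 ≤ c e)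
    (hG2 : ∀ z, 2 ≤ Gd z) (hk : ∀ e, k e ∈ (p e).support.toFinset) {tot : ℝ}
    (hG : ∀ z, ∀ j : ℕ, (2 : ℝ) ^ j ≤ Real.logb 2 (tot / μ z) →
      ((j : ℝ) + 2) * ((j : ℝ) + 3) ≤ Gd z) {Y : Finset V}
    (htot : cvol (fun e => (p e).support.toFinset) μ (fun e => c e * wlen w (p e)) Y ≤ tot)
    {D : ℝ} {g : V → ℝ} {r0 : V} (hr0 : r0 ∈ Y) (hD : 0 < D) (hg0 : g r0 = 0)
    (hgt : ∃ t ∈ Y, D / 2 ≤ g t)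
    (hg : ∀ a b, (restr G Y).Adj a b → g a ≤ g b + 2 * w s(a, b)) :
    ∃ s, D / 4 ≤ s ∧ s ≤ D / 2 ∧
      D / 16 * ∑ e ∈ (inside (fun e => (p e).support.toFinset) Y).filter (fun e =>
          ¬ (p e).support.toFinset ⊆ Y.filter (fun z => g z < s) ∧
          ¬ (p e).support.toFinset ⊆ Y.filter (fun z => s ≤ g z)), c e ≤
        24 * (pot (fun e => (p e).support.toFinset) μ Gd (fun e => c e * wlen w (p e)) k Y -
          pot (fun e => (p e).support.toFinset) μ Gd (fun e => c e * wlen w (p e)) k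
            (Y.filter fun z => g z < s) -
          pot (fun e => (p e).support.toFinset) μ Gd (fun e => c e * wlen w (p e)) k
            (Y.filter fun z => s ≤ g z)) := by
  set supp : E → Finset V := fun e => (p e).support.toFinset with hsupp
  set m : E → ℝ := fun e => c e * wlen w (p e) with hmdef
  have hm : ∀ e, 0 ≤ m e := fun e => mul_nonneg (hc e) (wlen_nonneg hw _)
  have hf : ∀ e ∈ inside supp Y, ∀ x ∈ supp e, ∀ y ∈ supp e, c e * (g x - g y) ≤ 4 * m e := by
    intro e he x hx y hy
    rw [mem_inside] at he
    have h1 := abs_le.1 (abs_sub_le_of_walk hw hg (p e) he x (List.mem_toFinset.1 hx))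
    have h2 := abs_le.1 (abs_sub_le_of_walk hw hg (p e) he y (List.mem_toFinset.1 hy))
    have : g x - g y ≤ 4 * wlen w (p e) := by linarith
    have := mul_le_mul_of_nonneg_left this (hc e)
    simp only [hmdef]; linarith
  by_cases hcase : cvol supp μ m (Y.filter fun z => - g z ≤ -(7 * D / 16)) ≤ cvol supp μ m Y / 2
  · obtain ⟨r, hr1, hr2, -, hr⟩ := exists_cut (supp := supp) (k := k) hμ hc hm hG2 hk hG htot
      (fun z => - g z)
      (fun e he x hx y hy => by have := hf e he y hy x hx; convert this using 2; ring)
      (lo := -(D / 2)) (hi := -(7 * D / 16)) (by linarith)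
      (by obtain ⟨t, ht, h⟩ := hgt; exact ⟨t, ht, by linarith⟩) hcase ∅ Set.finite_empty
    have hW : (Y.filter fun z => - g z ≤ r) = Y.filter fun z => -r ≤ g z :=
      Finset.filter_congr fun z _ => neg_le
    have hR : (Y.filter fun z => r < - g z) = Y.filter fun z => g z < -r :=
      Finset.filter_congr fun z _ => lt_neg
    rw [hW, hR] at hr
    refine ⟨-r, by linarith, by linarith, ?_⟩
    rw [sub_right_comm]
    rw [Finset.filter_congr (fun e _ => and_comm)]
    refine le_trans (le_of_eq ?_) hr
    ring
  · push Not at hcase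
    have hdis : Disjoint (Y.filter fun z => g z ≤ 5 * D / 16)
        (Y.filter fun z => - g z ≤ -(7 * D / 16)) := by
      rw [Finset.disjoint_left]
      intro z h1 h2
      have := (mem_filter.1 h1).2
      have := (mem_filter.1 h2).2
      linarith
    have hvol := cvol_add_le (a := a) (supp := supp) hμ hm (fun e => by simp [hsupp])
      (filter_subset _ _) (filter_subset _ _) hdis
    obtain ⟨r, hr1, hr2, hrN, hr⟩ := exists_cut (supp := supp) (k := k) hμ hc hm hG2 hk hG htot
      g hf (lo := D / 4) (hi := 5 * D / 16) (by linarith)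
      ⟨r0, hr0, by rw [hg0]; linarith⟩ (by linarith) (Set.range g) (Set.finite_range g)
    have hne : ∀ z, g z ≠ r := fun z h => hrN ⟨z, h⟩
    have hR : (Y.filter fun z => g z ≤ r) = Y.filter fun z => g z < r :=
      Finset.filter_congr fun z _ => ⟨fun h => lt_of_le_of_ne h (hne z), fun h => h.le⟩
    have hW : (Y.filter fun z => r < g z) = Y.filter fun z => r ≤ g z :=
      Finset.filter_congr fun z _ => ⟨fun h => h.le, fun h => lt_of_le_of_ne h (hne z).symm⟩
    rw [hW, hR] at hr
    refine ⟨r, hr1, by linarith, ?_⟩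
    refine le_trans (le_of_eq ?_) hr
    ring

theorem exists_good_tree (hw : ∀ e, 0 < w e) (hμ : ∀ z, 0 < μ z) (hc : ∀ e, 0 ≤ c e)
    (hG2 : ∀ z, 2 ≤ Gd z) (hk : ∀ e, k e ∈ (p e).support.toFinset) {tot : ℝ}
    (hG : ∀ z, ∀ j : ℕ, (2 : ℝ) ^ j ≤ Real.logb 2 (tot / μ z) →
      ((j : ℝ) + 2) * ((j : ℝ) + 3) ≤ Gd z) :
    ∀ (n : ℕ) (Y : Finset V), Y.card = n →
      cvol (fun e => (p e).support.toFinset) μ (fun e => c e * wlen w (p e)) Y ≤ tot →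
      ∀ S : PState G w Y, ∃ T, S.Good T ∧
        ∑ e ∈ inside (fun e => (p e).support.toFinset) Y, c e * wdist T w (a e) (b e) ≤
          6144 * pot (fun e => (p e).support.toFinset) μ Gd (fun e => c e * wlen w (p e)) k Y := by
  have hw' : ∀ e, 0 ≤ w e := fun e => (hw e).le
  set supp : E → Finset V := fun e => (p e).support.toFinset with hsupp
  set m : E → ℝ := fun e => c e * wlen w (p e) with hmdef
  have hm : ∀ e, 0 ≤ m e := fun e => mul_nonneg (hc e) (wlen_nonneg hw' _)
  have hae : ∀ e, a e ∈ supp e := fun e => by simp [hsupp]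
  have hbe : ∀ e, b e ∈ supp e := fun e => by simp [hsupp]
  intro n
  induction n using Nat.strong_induction_on with
  | _ n ih =>
    intro Y hYn htot S
    by_cases hY : 2 ≤ Y.card
    · obtain ⟨D, g, hD, hg0, hgt, hg, hh, hsplit⟩ := S.exists_split hY
      obtain ⟨s, hs1, hs2, hs⟩ := exists_cluster_cut (k := k) p hw' hμ hc hG2 hk hG htot
        S.root_mem_Y hD hg0 hgt hg
      obtain ⟨SR, SW, hRW⟩ := hsplit s hs1 hs2
      have hXY : (Y.filter fun z => g z < s) ⊂ Y := by
        refine Finset.filter_ssubset.2 ?_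
        obtain ⟨t, ht, h⟩ := hgt
        exact ⟨t, ht, by linarith⟩
      have hZY : (Y.filter fun z => s ≤ g z) ⊂ Y := by
        refine Finset.filter_ssubset.2 ⟨S.root, S.root_mem_Y, ?_⟩
        rw [hg0]; linarith
      obtain ⟨TR, hTR, hcR⟩ := ih _ (hYn ▸ Finset.card_lt_card hXY) _ rfl
        ((cvol_mono hμ hm hXY.1).trans htot) SR
      obtain ⟨TW, hTW, hcW⟩ := ih _ (hYn ▸ Finset.card_lt_card hZY) _ rfl
        ((cvol_mono hμ hm hZY.1).trans htot) SW
      obtain ⟨T, hT, h1, h2⟩ := hRW TR TW hTR hTW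
      refine ⟨T, hT, ?_⟩
      have hreach : ∀ {X : Finset V} {S' : PState G w X} {T' : SimpleGraph V}, S'.Good T' →
          T' ≤ T → ∀ x ∈ X, ∀ y ∈ X, wdist T w x y ≤ wdist T' w x y := by
        intro X S' T' hT' hle x hx y hy
        obtain ⟨q1, -⟩ := hT'.walk x hx
        obtain ⟨q2, -⟩ := hT'.walk y hy
        exact wdist_anti hw' hle (q1.reachable.symm.trans q2.reachable)
      have := sum_cost_le (d := wdist T w) hc hae hbe hXY.1 hZY.1
        (by rw [Finset.disjoint_left]; intro z h1 h2
            have := (mem_filter.1 h1).2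
            have := (mem_filter.1 h2).2
            linarith)
        (fun x hx y hy => (hT.wdist_le hw' hh hx hy).2) (hreach hTR h1) (hreach hTW h2)
      linarith
    · have hcard : Y.card = 1 := by
        have := Finset.card_pos.2 ⟨_, S.root_mem_Y⟩
        omega
      have hz : ∀ z ∈ Y, z = S.root := fun z hz =>
        Finset.card_le_one.1 hcard.le _ hz _ S.root_mem_Y
      refine ⟨⊥, ⟨bot_le, by simp [hcard], ?_, ?_⟩, ?_⟩
      · intro z hzY
        rw [hz z hzY]
        exact ⟨SimpleGraph.Walk.nil, by simp [S.h_root]⟩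
      · intro z hzP
        rw [hz z (S.chain.sub hzP)]
        exact ⟨SimpleGraph.Walk.nil, by simp [S.h_root]⟩
      · rw [Finset.sum_eq_zero]
        · exact mul_nonneg (by norm_num) (pot_nonneg hμ hm hG2 hk Y)
        · intro e he
          rw [mem_inside] at he
          rw [hz _ (he (hae e)), hz _ (he (hbe e)), wdist_self hw', mul_zero]

/-- Low stretch spanning trees with priorities. -/
theorem exists_priority_tree (hw : ∀ e, 0 < w e) (hGc : G.Connected) (hμ : ∀ z, 0 < μ z)
    (hc : ∀ e, 0 ≤ c e)
    (hG2 : ∀ z, 2 ≤ Gd z) (hk : ∀ e, k e ∈ (p e).support.toFinset) {tot : ℝ}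
    (hG : ∀ z, ∀ j : ℕ, (2 : ℝ) ^ j ≤ Real.logb 2 (tot / μ z) →
      ((j : ℝ) + 2) * ((j : ℝ) + 3) ≤ Gd z)
    (htot : ∑ z, μ z + ∑ e, c e * wlen w (p e) ≤ tot) :
    ∃ T, IsSpanningTree G T ∧ ∑ e, c e * wdist T w (a e) (b e) ≤
      6144 * (∑ z, μ z * Gd z * Real.logb 2 (tot / μ z) +
        ∑ e, c e * wlen w (p e) * Gd (k e) * (1 + Real.logb 2 (tot / μ (k e)))) := by
  obtain ⟨v0⟩ := hGc.nonempty
  have hin : inside (fun e => (p e).support.toFinset) (univ : Finset V) = univ := by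
    ext e; rw [mem_inside]; simp
  have hvol : cvol (fun e => (p e).support.toFinset) μ (fun e => c e * wlen w (p e)) univ =
      ∑ z, μ z + ∑ e, c e * wlen w (p e) := by unfold cvol; rw [hin]
  obtain ⟨T, hT, hcost⟩ := exists_good_tree (k := k) p hw hμ hc hG2 hk hG _ univ rfl
    (hvol.trans_le htot) (PState.whole hw hGc v0)
  refine ⟨T, hT.isSpanningTree, ?_⟩
  rw [hin] at hcost
  refine hcost.trans (mul_le_mul_of_nonneg_left ?_ (by norm_num))
  unfold pot
  rw [hvol, hin]
  have hm : ∀ e, 0 ≤ c e * wlen w (p e) := fun e =>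
    mul_nonneg (hc e) (wlen_nonneg (fun e => (hw e).le) _)
  have hpos : ∀ z, 0 < ∑ z, μ z + ∑ e, c e * wlen w (p e) := fun z => by
    have h1 := Finset.single_le_sum (f := μ) (fun z _ => (hμ z).le) (mem_univ z)
    have h2 := Finset.sum_nonneg fun e (_ : e ∈ (univ : Finset E)) => hm e
    linarith [hμ z]
  have hlog : ∀ z, Real.logb 2 ((∑ z, μ z + ∑ e, c e * wlen w (p e)) / μ z) ≤
      Real.logb 2 (tot / μ z) := fun z =>
    Real.logb_le_logb_of_le (by norm_num) (div_pos (hpos z) (hμ z))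
      (div_le_div_of_nonneg_right htot (hμ z).le)
  refine add_le_add (Finset.sum_le_sum fun z _ => ?_) (Finset.sum_le_sum fun e _ => ?_)
  · exact mul_le_mul_of_nonneg_left (hlog z) (mul_nonneg (hμ z).le (by linarith [hG2 z]))
  · exact mul_le_mul_of_nonneg_left (add_le_add le_rfl (hlog _))
      (mul_nonneg (hm e) (by linarith [hG2 (k e)]))

end Demands

section Priority

/-- The stretch guaranteed to demands of priority level `i`. -/
noncomputable def prio (i : ℕ) : ℝ := ((i : ℝ) + 5) * ((i : ℝ) + 6) * 2 ^ (i + 4)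

lemma prio_mono {i j : ℕ} (h : i ≤ j) : prio i ≤ prio j := by
  unfold prio
  have : (i : ℝ) ≤ j := by exact_mod_cast h
  gcongr
  norm_num

lemma le_prio (i : ℕ) : 480 ≤ prio i := by
  refine le_trans ?_ (prio_mono (Nat.zero_le i))
  norm_num [prio]

lemma prio_pos (i : ℕ) : 0 < prio i := by linarith [le_prio i]

variable {V : Type*} [Fintype V]

/-- The number of vertices of each priority level is at most doubly exponential. -/
def Priorities (ι : V → ℕ) : Prop :=
  ∀ i, ((univ.filter fun v => ι v = i).card : ℝ) ≤ 2 ^ 2 ^ i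

lemma Priorities.sum_le {ι : V → ℕ} (hι : Priorities ι) {F : ℕ → ℝ} {K : ℝ}
    (hF0 : ∀ i, 0 ≤ F i) (hF : ∀ i, 2 ^ 2 ^ i * F i ≤ K * (1 / 2) ^ i) :
    ∑ v, F (ι v) ≤ 2 * K := by
  obtain ⟨N, hN⟩ : ∃ N, ∀ v, ι v < N := ⟨univ.sup ι + 1, fun v =>
    Nat.lt_succ_of_le (Finset.le_sup (mem_univ v))⟩
  have hK : 0 ≤ K := by
    have := (mul_nonneg (by positivity) (hF0 0)).trans (hF 0)
    simpa using this
  rw [← Finset.sum_fiberwise_of_maps_to (g := ι) (t := range N) fun v _ => mem_range.2 (hN v)]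
  calc ∑ i ∈ range N, ∑ v ∈ univ.filter (fun v => ι v = i), F (ι v)
      ≤ ∑ i ∈ range N, K * (1 / 2) ^ i := Finset.sum_le_sum fun i _ => by
        rw [Finset.sum_congr rfl (g := fun _ => F i) fun v hv => by rw [(mem_filter.1 hv).2],
          Finset.sum_const, nsmul_eq_mul]
        exact (mul_le_mul_of_nonneg_right (hι i) (hF0 i)).trans (hF i)
    _ = K * ∑ i ∈ range N, (1 / 2 : ℝ) ^ i := by rw [Finset.mul_sum]
    _ ≤ K * 2 := mul_le_mul_of_nonneg_left (sum_geometric_two_le N) hK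
    _ = 2 * K := mul_comm _ _

variable {E : Type*} [Fintype E] {G : SimpleGraph V} {w : Sym2 V → ℝ} {c : E → ℝ} {a b : E → V}

lemma level_bound (i : ℕ) : 2 ^ i + 3 * i + 4 ≤ 2 ^ (i + 3) := by
  have := Nat.lt_two_pow_self (n := i)
  rw [pow_add]; omega

lemma poly_bound (i : ℕ) : ((i : ℝ) + 5) * ((i : ℝ) + 6) ≤ 30 * 2 ^ i := by
  induction i with
  | zero => norm_num
  | succ i ih =>
    rw [pow_succ]; push_cast
    nlinarith [(Nat.cast_nonneg i : (0 : ℝ) ≤ i)]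

theorem exists_priority_tree_normalized (hw : ∀ e, 0 < w e) (hGc : G.Connected) {ι : V → ℕ}
    (hι : Priorities ι) (hc : ∀ e, 0 ≤ c e) (p : ∀ e, G.Walk (a e) (b e)) {k : E → V}
    (hk : ∀ e, k e ∈ (p e).support) (hM : ∑ e, c e * wlen w (p e) ≤ 1) :
    ∃ T, IsSpanningTree G T ∧ ∑ e, c e * wdist T w (a e) (b e) ≤
      6144 * (60 + ∑ e, c e * wlen w (p e) * prio (ι (k e))) := by
  set F : ℕ → ℝ := fun i => (2 ^ (2 ^ i + 3 * i + 3))⁻¹ with hF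
  have hF0 : ∀ i, 0 < F i := fun i => by simp only [hF]; positivity
  have hlog : ∀ i, Real.logb 2 (2 / F i) ≤ 2 ^ (i + 3) := fun i => by
    have : 2 / F i = (2 : ℝ) ^ (2 ^ i + 3 * i + 4) := by
      simp only [hF]; rw [div_inv_eq_mul, ← pow_succ']
    rw [this, Real.logb_pow, Real.logb_self_eq_one (by norm_num), mul_one]
    exact_mod_cast level_bound i
  have hlog0 : ∀ i, 0 ≤ Real.logb 2 (2 / F i) := fun i => by
    refine Real.logb_nonneg (by norm_num) ?_
    rw [le_div_iff₀ (hF0 i)]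
    have : F i ≤ 1 := inv_le_one_of_one_le₀ (one_le_pow₀ (by norm_num))
    linarith
  have hFsplit : ∀ i, 2 ^ 2 ^ i * F i = 1 / 8 * (1 / 8) ^ i := fun i => by
    simp only [hF]
    rw [pow_add, pow_add, pow_mul, one_div_pow]
    field_simp
    norm_num
  have hsum1 : ∑ v, F (ι v) ≤ 1 := by
    have := hι.sum_le (F := F) (K := 1 / 2) (fun i => (hF0 i).le) fun i => by
      rw [hFsplit]
      gcongr <;> norm_num
    linarith
  have hsum2 : ∑ v, F (ι v) * (((ι v : ℝ) + 5) * ((ι v : ℝ) + 6)) *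
      Real.logb 2 (2 / F (ι v)) ≤ 60 := by
    have := hι.sum_le (F := fun i => F i * (((i : ℝ) + 5) * ((i : ℝ) + 6)) *
      Real.logb 2 (2 / F i)) (K := 30)
      (fun i => mul_nonneg (mul_nonneg (hF0 i).le (by positivity)) (hlog0 i)) fun i => by
      have e0 : (0:ℝ) ≤ 1 / 8 * (1 / 8) ^ i := by positivity
      calc 2 ^ 2 ^ i * (F i * (((i : ℝ) + 5) * ((i : ℝ) + 6)) * Real.logb 2 (2 / F i))
          = (1 / 8 * (1 / 8) ^ i) * (((i : ℝ) + 5) * ((i : ℝ) + 6)) * Real.logb 2 (2 / F i) := by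
            rw [← hFsplit]; ring
        _ ≤ (1 / 8 * (1 / 8) ^ i) * (30 * 2 ^ i) * 2 ^ (i + 3) := by
            have := poly_bound i
            have := hlog i
            have := hlog0 i
            gcongr
        _ = 30 * (1 / 2) ^ i := by
            rw [pow_add, div_pow, div_pow, show (8 : ℝ) ^ i = 2 ^ i * (2 ^ i * 2 ^ i) by
              rw [← mul_pow, ← mul_pow]; norm_num]
            field_simp
            norm_num
    linarith
  obtain ⟨T, hT, hcost⟩ := exists_priority_tree (μ := fun v => F (ι v)) (tot := 2) (k := k)
    (Gd := fun v => ((ι v : ℝ) + 5) * ((ι v : ℝ) + 6)) p hw hGc (fun z => hF0 _) hc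
    (fun z => by nlinarith [(Nat.cast_nonneg (ι z) : (0 : ℝ) ≤ ι z)])
    (fun e => List.mem_toFinset.2 (hk e))
    (fun z j hj => by
      have h1 : (2 : ℝ) ^ j ≤ 2 ^ (ι z + 3) := hj.trans (hlog _)
      have h2 : (j : ℝ) ≤ ι z + 3 := by
        exact_mod_cast (pow_le_pow_iff_right₀ (by norm_num : (1 : ℝ) < 2)).1 h1
      exact mul_le_mul (by linarith) (by linarith) (by positivity) (by positivity))
    (by linarith)
  refine ⟨T, hT, hcost.trans (mul_le_mul_of_nonneg_left (add_le_add hsum2 ?_) (by norm_num))⟩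
  refine Finset.sum_le_sum fun e _ => ?_
  rw [mul_assoc]
  refine mul_le_mul_of_nonneg_left ?_ (mul_nonneg (hc e) (wlen_nonneg (fun e => (hw e).le) _))
  unfold prio
  refine mul_le_mul_of_nonneg_left ?_ (by positivity)
  have h1 := hlog (ι (k e))
  have h2 : (1 : ℝ) ≤ 2 ^ (ι (k e) + 3) := one_le_pow₀ (by norm_num)
  rw [pow_succ _ (ι (k e) + 3)]
  linarith

theorem exists_tree_sum_le (hw : ∀ e, 0 < w e) (hGc : G.Connected) {ι : V → ℕ}
    (hι : Priorities ι) (hc : ∀ e, 0 ≤ c e) (p : ∀ e, G.Walk (a e) (b e)) {k : E → V}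
    (hk : ∀ e, k e ∈ (p e).support) {M : ℝ} (hM0 : 0 < M) (hM : ∑ e, c e * wlen w (p e) ≤ M) :
    ∃ T, IsSpanningTree G T ∧ ∑ e, c e * wdist T w (a e) (b e) ≤
      6144 * (60 * M + ∑ e, c e * wlen w (p e) * prio (ι (k e))) := by
  obtain ⟨T, hT, h⟩ := exists_priority_tree_normalized (c := fun e => c e / M) hw hGc hι
    (fun e => div_nonneg (hc e) hM0.le) p hk (by
      rw [Finset.sum_congr rfl fun e _ => div_mul_eq_mul_div _ _ _, ← Finset.sum_div]
      exact (div_le_one hM0).2 hM)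
  refine ⟨T, hT, ?_⟩
  have h1 : ∑ e, c e / M * wdist T w (a e) (b e) = (∑ e, c e * wdist T w (a e) (b e)) / M := by
    rw [Finset.sum_div]; exact Finset.sum_congr rfl fun e _ => by ring
  have h2 : ∑ e, c e / M * wlen w (p e) * prio (ι (k e)) =
      (∑ e, c e * wlen w (p e) * prio (ι (k e))) / M := by
    rw [Finset.sum_div]; exact Finset.sum_congr rfl fun e _ => by ring
  rw [h1, h2, div_le_iff₀ hM0] at h
  refine h.trans (le_of_eq ?_)
  field_simp

lemma wdist_eq_zero_of_mul_wlen (hw : ∀ e, 0 < w e) {u v : V} (p : G.Walk u v) {x : ℝ}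
    (h : x * wlen w p = 0) (T : SimpleGraph V) : x * wdist T w u v = 0 := by
  rcases mul_eq_zero.1 h with h | h
  · rw [h, zero_mul]
  · have : u = v := by
      by_contra huv
      exact (wlen_pos hw huv p).ne' h
    rw [this, wdist_self (fun e => (hw e).le), mul_zero]

theorem exists_tree_stretch_le (hw : ∀ e, 0 < w e) (hGc : G.Connected) {ι : V → ℕ}
    (hι : Priorities ι) (hc : ∀ e, 0 ≤ c e) (p : ∀ e, G.Walk (a e) (b e)) {k : E → V}
    (hk : ∀ e, k e ∈ (p e).support) :
    ∃ T, IsSpanningTree G T ∧ ∑ e, c e * wdist T w (a e) (b e) ≤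
      12288 * ∑ e, c e * wlen w (p e) * prio (ι (k e)) := by
  have hm : ∀ e, 0 ≤ c e * wlen w (p e) := fun e =>
    mul_nonneg (hc e) (wlen_nonneg (fun e => (hw e).le) _)
  by_cases hM0 : 0 < ∑ e, c e * wlen w (p e)
  · obtain ⟨T, hT, h⟩ := exists_tree_sum_le hw hGc hι hc p hk hM0 le_rfl
    refine ⟨T, hT, h.trans ?_⟩
    have : 60 * ∑ e, c e * wlen w (p e) ≤ ∑ e, c e * wlen w (p e) * prio (ι (k e)) := by
      rw [Finset.mul_sum]
      refine Finset.sum_le_sum fun e _ => ?_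
      rw [mul_comm]
      exact mul_le_mul_of_nonneg_left (by linarith [le_prio (ι (k e))]) (hm e)
    linarith
  · have h0 : ∑ e, c e * wlen w (p e) = 0 :=
      le_antisymm (not_lt.1 hM0) (Finset.sum_nonneg fun e _ => hm e)
    rw [Finset.sum_eq_zero_iff_of_nonneg fun e _ => hm e] at h0
    obtain ⟨T, hT⟩ := hGc.exists_isTree_le
    refine ⟨T, hT, ?_⟩
    rw [Finset.sum_eq_zero fun e he => wdist_eq_zero_of_mul_wlen hw (p e) (h0 e he) T]
    exact mul_nonneg (by norm_num) (Finset.sum_nonneg fun e _ =>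
      mul_nonneg (hm e) (prio_pos _).le)

/-- A tree serving two families of demands of bounded priority level simultaneously. -/
theorem exists_tree_two {E' : Type*} [Fintype E'] {a' b' : E' → V}
    (hw : ∀ e, 0 < w e) (hGc : G.Connected) {ι : V → ℕ}
    (hι : Priorities ι) (hc : ∀ e, 0 ≤ c e) (p : ∀ e, G.Walk (a e) (b e))
    (q : ∀ e, G.Walk (a' e) (b' e)) {i : ℕ} (ha : ∀ e, ι (a e) ≤ i) (ha' : ∀ e, ι (a' e) ≤ i)
    {M M' : ℝ} (hM : ∑ e, c e * wlen w (p e) ≤ M) (hM0' : 0 < M')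
    (hM' : ∑ e, wlen w (q e) ≤ M') :
    ∃ T, IsSpanningTree G T ∧ ∑ e, c e * wdist T w (a e) (b e) ≤ 18432 * prio i * M ∧
      ∑ e, wdist T w (a' e) (b' e) ≤ 18432 * prio i * M' := by
  have hw0 : ∀ e, 0 ≤ w e := fun e => (hw e).le
  have hm : ∀ e, 0 ≤ c e * wlen w (p e) := fun e => mul_nonneg (hc e) (wlen_nonneg hw0 _)
  obtain ⟨x, hx, hx1, hx2⟩ : ∃ x : ℝ, 0 ≤ x ∧ x * M ≤ 1 ∧ ∀ T, 
      x * ∑ e, c e * wdist T w (a e) (b e) ≤ 18432 * prio i →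
      ∑ e, c e * wdist T w (a e) (b e) ≤ 18432 * prio i * M := by
    rcases (Finset.sum_nonneg fun e _ => hm e).trans hM |>.eq_or_lt with h0 | h0
    · refine ⟨0, le_rfl, by simp, fun T _ => ?_⟩
      have h1 : ∑ e, c e * wlen w (p e) = 0 :=
        le_antisymm (hM.trans h0.symm.le) (Finset.sum_nonneg fun e _ => hm e)
      rw [Finset.sum_eq_zero_iff_of_nonneg fun e _ => hm e] at h1
      rw [← h0, Finset.sum_eq_zero fun e he => wdist_eq_zero_of_mul_wlen hw (p e) (h1 e he) T]
      simp
    · refine ⟨M⁻¹, by positivity, by rw [inv_mul_cancel₀ h0.ne'], fun T h => ?_⟩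
      rwa [inv_mul_eq_div, div_le_iff₀ h0] at h
  have e1 : ∑ e, x * c e * wlen w (p e) ≤ 1 := by
    rw [Finset.sum_congr rfl fun e _ => mul_assoc _ _ _, ← Finset.mul_sum]
    exact (mul_le_mul_of_nonneg_left hM hx).trans hx1
  have e2 : ∑ e, M'⁻¹ * wlen w (q e) ≤ 1 := by
    rw [← Finset.mul_sum, inv_mul_eq_div]
    exact (div_le_one hM0').2 hM'
  obtain ⟨T, hT, h⟩ := exists_tree_sum_le (E := E ⊕ E') (a := Sum.elim a a') (b := Sum.elim b b')
    (c := Sum.elim (fun e => x * c e) (fun _ => M'⁻¹)) (M := 2) (k := Sum.elim a a') hw hGc hι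
    (fun e => by
      rcases e with e | e
      · exact mul_nonneg hx (hc e)
      · exact inv_nonneg.2 hM0'.le)
    (fun e => match e with
      | Sum.inl e => p e
      | Sum.inr e => q e)
    (fun e => by rcases e with e | e <;> simp) (by norm_num)
    (by
      rw [Fintype.sum_sum_type]
      simp only [Sum.elim_inl, Sum.elim_inr]
      linarith)
  rw [Fintype.sum_sum_type, Fintype.sum_sum_type] at h
  simp only [Sum.elim_inl, Sum.elim_inr] at h
  have f1 : ∑ e, x * c e * wlen w (p e) * prio (ι (a e)) ≤ prio i := by
    calc ∑ e, x * c e * wlen w (p e) * prio (ι (a e)) ≤ ∑ e, x * c e * wlen w (p e) * prio i :=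
          Finset.sum_le_sum fun e _ => mul_le_mul_of_nonneg_left (prio_mono (ha e))
            (by rw [mul_assoc]; exact mul_nonneg hx (hm e))
      _ = (∑ e, x * c e * wlen w (p e)) * prio i := by rw [Finset.sum_mul]
      _ ≤ 1 * prio i := mul_le_mul_of_nonneg_right e1 (prio_pos i).le
      _ = prio i := one_mul _
  have f2 : ∑ e, M'⁻¹ * wlen w (q e) * prio (ι (a' e)) ≤ prio i := by
    calc ∑ e, M'⁻¹ * wlen w (q e) * prio (ι (a' e)) ≤ ∑ e, M'⁻¹ * wlen w (q e) * prio i :=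
          Finset.sum_le_sum fun e _ => mul_le_mul_of_nonneg_left (prio_mono (ha' e))
            (mul_nonneg (inv_nonneg.2 hM0'.le) (wlen_nonneg hw0 _))
      _ = (∑ e, M'⁻¹ * wlen w (q e)) * prio i := by rw [Finset.sum_mul]
      _ ≤ 1 * prio i := mul_le_mul_of_nonneg_right e2 (prio_pos i).le
      _ = prio i := one_mul _
  have g1 : 0 ≤ ∑ e, x * c e * wdist T w (a e) (b e) := Finset.sum_nonneg fun e _ =>
    mul_nonneg (mul_nonneg hx (hc e)) (wdist_nonneg hw0 _ _)
  have g2 : 0 ≤ ∑ e, M'⁻¹ * wdist T w (a' e) (b' e) := Finset.sum_nonneg fun e _ =>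
    mul_nonneg (inv_nonneg.2 hM0'.le) (wdist_nonneg hw0 _ _)
  have := le_prio i
  refine ⟨T, hT, hx2 T ?_, ?_⟩
  · rw [Finset.mul_sum, Finset.sum_congr rfl fun e _ => (mul_assoc _ _ _).symm]
    linarith
  · have : M'⁻¹ * ∑ e, wdist T w (a' e) (b' e) ≤ 18432 * prio i := by
      rw [Finset.mul_sum]
      linarith
    rwa [inv_mul_eq_div, div_le_iff₀ hM0'] at this

end Priority

section Nets

lemma exists_greedy {V : Type*} (S : Finset V) (r : V → ℝ) (Rel : V → V → Prop)
    (hsymm : ∀ u v, Rel u v → Rel v u) :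
    ∃ K ⊆ S, (∀ u ∈ K, ∀ v ∈ K, u ≠ v → ¬ Rel u v) ∧
      ∀ v ∈ S, ∃ u ∈ K, (u = v ∨ Rel u v) ∧ r u ≤ r v := by
  induction S using Finset.strongInduction with
  | H S ih =>
    rcases S.eq_empty_or_nonempty with rfl | hS
    · exact ⟨∅, subset_rfl, by simp, by simp⟩
    obtain ⟨z, hz, hmax⟩ := Finset.exists_max_image S r hS
    obtain ⟨K, hKS, hK, hcov⟩ := ih _ (Finset.erase_ssubset hz)
    by_cases h : ∃ u ∈ K, Rel u z
    · obtain ⟨u, hu, huz⟩ := h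
      refine ⟨K, hKS.trans (Finset.erase_subset _ _), hK, fun v hv => ?_⟩
      by_cases hvz : v = z
      · rw [hvz]
        exact ⟨u, hu, Or.inr huz, hmax u (Finset.mem_of_mem_erase (hKS hu))⟩
      · exact hcov v (Finset.mem_erase.2 ⟨hvz, hv⟩)
    · push Not at h
      refine ⟨insert z K, Finset.insert_subset hz (hKS.trans (Finset.erase_subset _ _)), ?_,
        fun v hv => ?_⟩
      · intro u hu v hv huv
        rcases Finset.mem_insert.1 hu with hu1 | hu1 <;> rcases Finset.mem_insert.1 hv with hv1 | hv1
        · exact absurd (hu1.trans hv1.symm) huv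
        · rw [hu1]; exact fun h' => h v hv1 (hsymm _ _ h')
        · rw [hv1]; exact h u hu1
        · exact hK u hu1 v hv1 huv
      · by_cases hvz : v = z
        · exact ⟨z, Finset.mem_insert_self _ _, Or.inl hvz.symm, by rw [hvz]⟩
        · obtain ⟨u, hu, h'⟩ := hcov v (Finset.mem_erase.2 ⟨hvz, hv⟩)
          exact ⟨u, Finset.mem_insert_of_mem hu, h'⟩

variable {V : Type*} [Fintype V]

lemma exists_radius (d : V → ℝ) {x : ℝ} (hx0 : 0 < x) (hx : x ≤ Fintype.card V) :
    ∃ r, x ≤ ((univ.filter fun v => d v ≤ r).card : ℝ) ∧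
      ((univ.filter fun v => d v < r).card : ℝ) < x := by
  set S : Finset V := univ.filter fun u => x ≤ ((univ.filter fun v => d v ≤ d u).card : ℝ)
  have hS : S.Nonempty := by
    have : (univ : Finset V).Nonempty := by
      rw [← Finset.card_pos, Finset.card_univ]
      exact_mod_cast hx0.trans_le hx
    obtain ⟨u, -, hu⟩ := Finset.exists_max_image univ d this
    refine ⟨u, mem_filter.2 ⟨mem_univ _, ?_⟩⟩
    rw [Finset.filter_true_of_mem hu]
    exact_mod_cast hx
  obtain ⟨u, hu, hmin⟩ := Finset.exists_min_image S d hS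
  refine ⟨d u, (mem_filter.1 hu).2, ?_⟩
  by_contra! h
  have hne : (univ.filter fun v => d v < d u).Nonempty := by
    rw [← Finset.card_pos]; exact_mod_cast hx0.trans_le h
  obtain ⟨z, hz, hmax⟩ := Finset.exists_max_image _ d hne
  have hzu := (mem_filter.1 hz).2
  have : z ∈ S := mem_filter.2 ⟨mem_univ _, h.trans (by
    exact_mod_cast Finset.card_le_card fun v hv => mem_filter.2 ⟨mem_univ _, hmax v hv⟩)⟩
  exact absurd (hmin z this) (not_le.2 hzu)

variable {G : SimpleGraph V} {w : Sym2 V → ℝ}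

/-- The ordered pairs whose distance is small compared to the distance of an endpoint `v` to its
representative `y v`. -/
noncomputable def badPairs (G : SimpleGraph V) (w : Sym2 V → ℝ) (y : V → V) : Finset (V × V) :=
  univ.offDiag.filter fun p => ¬ (wdist G w p.1 (y p.1) ≤ 2 * wdist G w p.1 p.2 ∧
    wdist G w p.2 (y p.2) ≤ 2 * wdist G w p.1 p.2)

lemma exists_net (hw : ∀ e, 0 ≤ w e) (hG : G.Connected) {ε : ℝ} (hε : 0 < ε) (hε1 : ε ≤ 1) :
    ∃ (K : Finset V) (y : V → V), (∀ v, y v ∈ K) ∧ (∀ v ∈ K, y v = v) ∧ (K.card : ℝ) ≤ ε⁻¹ ∧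
      ((badPairs G w y).card : ℝ) ≤
        2 * ε * ((Fintype.card V : ℝ) * ((Fintype.card V : ℝ) - 1)) := by
  have : Nonempty V := hG.nonempty
  have hn : (0 : ℝ) < Fintype.card V := by exact_mod_cast Fintype.card_pos
  have hn1 : (1 : ℝ) ≤ Fintype.card V := by exact_mod_cast Fintype.card_pos (α := V)
  set n : ℝ := ((Fintype.card V : ℕ) : ℝ) with hndef
  have hex := fun u => exists_radius (wdist G w u) (mul_pos hε hn) (by nlinarith : ε * n ≤ n)
  choose r hr1 hr2 using hex
  set B : V → Finset V := fun u => univ.filter fun v => wdist G w u v ≤ r u with hB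
  obtain ⟨K, -, hK, hcov⟩ := exists_greedy univ r (fun u v => ¬ Disjoint (B u) (B v))
    (fun u v h h' => h h'.symm)
  have hcov' : ∀ v, ∃ u ∈ K, (v ∈ K → u = v) ∧ wdist G w v u ≤ 2 * r v := fun v => by
    have hr0 : 0 ≤ r v := by
      have h1 : 0 < (B v).card := by exact_mod_cast (mul_pos hε hn).trans_le (hr1 v)
      obtain ⟨z, hz⟩ := Finset.card_pos.1 h1
      exact (wdist_nonneg hw v z).trans (mem_filter.1 hz).2
    by_cases hv : v ∈ K
    · exact ⟨v, hv, fun _ => rfl, by rw [wdist_self hw]; linarith⟩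
    obtain ⟨u, hu, h1, h2⟩ := hcov v (mem_univ _)
    refine ⟨u, hu, fun h => absurd h hv, ?_⟩
    rcases h1 with rfl | h1
    · exact absurd hu hv
    · obtain ⟨z, hzu, hzv⟩ := Finset.not_disjoint_iff.1 h1
      have e1 := (mem_filter.1 hzu).2
      have e2 := (mem_filter.1 hzv).2
      have e3 := wdist_triangle hw (hG.preconnected v z) (hG.preconnected z u)
      rw [wdist_comm z u] at e3
      linarith
  choose y hyK hyy hyr using hcov'
  refine ⟨K, y, hyK, hyy, ?_, ?_⟩
  · have h1 : (K.card : ℝ) * (ε * n) ≤ n := by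
      calc (K.card : ℝ) * (ε * n) = ∑ u ∈ K, ε * n := by rw [Finset.sum_const, nsmul_eq_mul]
        _ ≤ ∑ u ∈ K, ((B u).card : ℝ) := Finset.sum_le_sum fun u _ => hr1 u
        _ = ((K.biUnion B).card : ℝ) := by
          rw [Finset.card_biUnion fun u hu v hv huv => not_not.1 (hK u hu v hv huv)]
          push_cast; rfl
        _ ≤ n := by rw [hndef]; exact_mod_cast Finset.card_le_univ _
    rw [le_inv_comm₀ (by
      obtain ⟨v⟩ := this
      exact_mod_cast Finset.card_pos.2 ⟨_, hyK v⟩) hε]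
    have hKp : (0 : ℝ) < K.card := by
      obtain ⟨v⟩ := this
      exact_mod_cast Finset.card_pos.2 ⟨_, hyK v⟩
    rw [← one_div, le_div_iff₀ hKp]
    nlinarith
  · have hfib : ∀ u, (((univ.erase u).filter fun v => wdist G w u v < r u).card : ℝ) ≤
        ε * (n - 1) := fun u => by
      have he : ((univ.erase u).filter fun v => wdist G w u v < r u) =
          (univ.filter fun v => wdist G w u v < r u).erase u := by
        ext v; simp [and_comm]
      rw [he]
      by_cases hu : u ∈ univ.filter fun v => wdist G w u v < r u
      · rw [Finset.card_erase_of_mem hu, Nat.cast_sub (Finset.card_pos.2 ⟨u, hu⟩)]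
        have := hr2 u
        push_cast
        linarith
      · have : (univ.filter fun v => wdist G w u v < r u) = ∅ := by
          by_contra h
          obtain ⟨z, hz⟩ := Finset.nonempty_iff_ne_empty.2 h
          refine hu (mem_filter.2 ⟨mem_univ _, ?_⟩)
          rw [wdist_self hw]
          exact (wdist_nonneg hw u z).trans_lt (mem_filter.1 hz).2
        rw [this]
        simp only [Finset.erase_empty, Finset.card_empty, Nat.cast_zero]
        exact mul_nonneg hε.le (by linarith)
    set P : Finset (V × V) := univ.sigma (fun u => (univ.erase u).filter fun v =>
      wdist G w u v < r u) |>.map (Equiv.sigmaEquivProd V V).toEmbedding with hP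
    have hPc : (P.card : ℝ) ≤ n * (ε * (n - 1)) := by
      rw [hP, Finset.card_map, Finset.card_sigma]
      push_cast
      refine (Finset.sum_le_sum fun u _ => hfib u).trans ?_
      rw [Finset.sum_const, nsmul_eq_mul, Finset.card_univ]
    have hPm : ∀ u v, u ≠ v → wdist G w u v < r u → (u, v) ∈ P := fun u v huv h => by
      rw [hP, Finset.mem_map]
      exact ⟨⟨u, v⟩, by simp [h, huv.symm], rfl⟩
    have hsub : badPairs G w y ⊆ P ∪ P.image Prod.swap := by
      rintro ⟨u, v⟩ huv
      rw [badPairs, mem_filter, Finset.mem_offDiag, not_and_or, not_le, not_le] at huv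
      obtain ⟨⟨-, -, hne⟩, h | h⟩ := huv
      · exact Finset.mem_union_left _ (hPm u v hne (by have := hyr u; simp only at h; linarith))
      · refine Finset.mem_union_right _ (Finset.mem_image.2 ⟨(v, u), hPm v u hne.symm ?_, rfl⟩)
        have := hyr v
        rw [wdist_comm v u]
        simp only at h
        linarith
    have := (Finset.card_le_card hsub).trans ((Finset.card_union_le _ _).trans
      (Nat.add_le_add_left Finset.card_image_le _))
    have : ((badPairs G w y).card : ℝ) ≤ P.card + P.card := by exact_mod_cast this
    linarith

end Nets

section Tour

variable {V : Type*} {G J T : SimpleGraph V} {w : Sym2 V → ℝ}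

/-- A walk through all points of `K` yields a tree-like order on `K` of the same length. -/
lemma exists_pred_of_walk {d : V → V → ℝ} (hd0 : ∀ x y, 0 ≤ d x y)
    (htri : ∀ x y z, d x z ≤ d x y + d y z)
    (hdw : ∀ x y, T.Adj x y → d x y ≤ w s(x, y)) {v u : V} (p : T.Walk v u) :
    ∀ (z : V) (K : Finset V), z ∉ K → (∀ x ∈ K, x ∈ p.support) →
      ∃ π : V → V, (∀ x ∈ K, (π x = z ∨ π x ∈ K) ∧ π x ≠ x) ∧
        (∀ J : SimpleGraph V, (∀ x ∈ K, J.Reachable (π x) x) → ∀ x ∈ K, J.Reachable z x) ∧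
        ∑ x ∈ K, d (π x) x ≤ d z v + wlen w p := by
  induction p with
  | nil =>
    rename_i v
    intro z K hz hK
    refine ⟨fun _ => z, fun x hx => ⟨Or.inl rfl, fun h => hz (by have h : z = x := h; rw [h]; exact hx)⟩,
      fun J h => h, ?_⟩
    have hKv : K ⊆ {v} := fun x hx => by simpa using hK x hx
    refine (Finset.sum_le_sum_of_subset_of_nonneg hKv fun x _ _ => hd0 _ _).trans ?_
    simp
  | cons h p ih =>
    rename_i v v' u
    intro z K hz hK
    rw [wlen_cons]
    have hvv := hdw _ _ h
    have hsub : ∀ x ∈ K.erase v, x ∈ p.support := fun x hx => by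
      have := hK x (Finset.mem_of_mem_erase hx)
      rw [SimpleGraph.Walk.support_cons, List.mem_cons] at this
      exact this.resolve_left (Finset.ne_of_mem_erase hx)
    by_cases hv : v ∈ K
    · have hzv : z ≠ v := fun h => hz (h ▸ hv)
      obtain ⟨π, h1, h2, h3⟩ := ih v (K.erase v) (Finset.notMem_erase _ _) hsub
      have hπ : ∀ x ∈ K.erase v, Function.update π v z x = π x := fun x hx =>
        Function.update_of_ne (Finset.ne_of_mem_erase hx) _ _
      refine ⟨Function.update π v z, fun x hx => ?_, fun J hJ => ?_, ?_⟩
      · by_cases hxv : x = v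
        · subst hxv; rw [Function.update_self]; exact ⟨Or.inl rfl, hzv⟩
        · have hx' := Finset.mem_erase.2 ⟨hxv, hx⟩
          rw [hπ x hx']
          obtain ⟨h4 | h4, h5⟩ := h1 x hx'
          · exact ⟨Or.inr (h4 ▸ hv), h5⟩
          · exact ⟨Or.inr (Finset.mem_of_mem_erase h4), h5⟩
      · have hzv' : J.Reachable z v := by simpa using hJ v hv
        intro x hx
        by_cases hxv : x = v
        · rw [hxv]; exact hzv'
        · refine hzv'.trans (h2 J (fun y hy => ?_) x (Finset.mem_erase.2 ⟨hxv, hx⟩))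
          rw [← hπ y hy]
          exact hJ y (Finset.mem_of_mem_erase hy)
      · rw [← Finset.add_sum_erase _ _ hv, Function.update_self,
          Finset.sum_congr rfl fun x hx => by rw [hπ x hx]]
        linarith
    · rw [Finset.erase_eq_of_notMem hv] at hsub
      obtain ⟨π, h1, h2, h3⟩ := ih z K hz hsub
      exact ⟨π, h1, h2, by linarith [htri z v v']⟩

variable [Fintype V]

/-- A closed walk around a connected graph, of length at most twice its weight. -/
lemma exists_tour (hw : ∀ e, 0 ≤ w e) (hT : T.Connected) (v : V) :
    ∃ p : T.Walk v v, (∀ x, x ∈ p.support) ∧ wlen w p ≤ 2 * wWeight T w := by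
  set F : Finset V → ℝ := fun A =>
    ∑ e ∈ T.edgeSet.toFinite.toFinset.filter (fun e => ∀ x ∈ e, x ∈ A), w e with hF
  set S : Finset (Finset V) := univ.filter fun A =>
    ∃ p : T.Walk v v, p.support.toFinset = A ∧ wlen w p ≤ 2 * F A with hS
  have hne : S.Nonempty := ⟨{v}, mem_filter.2 ⟨mem_univ _, SimpleGraph.Walk.nil, by simp, by
    rw [wlen_nil]
    exact mul_nonneg (by norm_num) (Finset.sum_nonneg fun e _ => hw e)⟩⟩
  obtain ⟨A, hA, hmax⟩ := Finset.exists_max_image S Finset.card hne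
  obtain ⟨p, hpA, hp⟩ := (mem_filter.1 hA).2
  have hmem : ∀ x, x ∈ p.support ↔ x ∈ A := fun x => by rw [← hpA, List.mem_toFinset]
  refine ⟨p, ?_, hp.trans (mul_le_mul_of_nonneg_left ?_ (by norm_num))⟩
  · by_contra! h
    obtain ⟨x, hx⟩ := h
    obtain ⟨q⟩ := hT.preconnected v x
    obtain ⟨e, -, he1, he2⟩ := q.exists_boundary_dart (A : Set V)
      (by rw [Finset.mem_coe, ← hmem]; exact p.start_mem_support)
      (by rw [Finset.mem_coe, ← hmem]; exact hx)
    obtain ⟨⟨b, y⟩, hby⟩ := e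
    simp only [Finset.mem_coe] at he1 he2
    have hbp : b ∈ p.support := (hmem b).2 he1
    have hspec : ∀ z, z ∈ p.support ↔
        z ∈ (p.takeUntil b hbp).support ∨ z ∈ (p.dropUntil b hbp).support := fun z => by
      rw [← SimpleGraph.Walk.mem_support_append_iff, p.take_spec hbp]
    have hlspec : wlen w p = wlen w (p.takeUntil b hbp) + wlen w (p.dropUntil b hbp) := by
      rw [← wlen_append, p.take_spec hbp]
    set p' : T.Walk v v := (p.takeUntil b hbp).append
      (SimpleGraph.Walk.cons hby (SimpleGraph.Walk.cons hby.symm (p.dropUntil b hbp))) with hp'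
    have hsupp : p'.support.toFinset = insert y A := by
      ext z
      rw [List.mem_toFinset, hp', SimpleGraph.Walk.mem_support_append_iff,
        SimpleGraph.Walk.support_cons, SimpleGraph.Walk.support_cons, Finset.mem_insert, ← hmem,
        hspec]
      simp only [List.mem_cons]
      have := (p.dropUntil b hbp).start_mem_support
      constructor
      · rintro (h | rfl | rfl | h)
        · exact Or.inr (Or.inl h)
        · exact Or.inr (Or.inr this)
        · exact Or.inl rfl
        · exact Or.inr (Or.inr h)
      · rintro (h | h | h)
        · exact Or.inr (Or.inr (Or.inl h))
        · exact Or.inl h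
        · exact Or.inr (Or.inr (Or.inr h))
    have hlen : wlen w p' = wlen w p + 2 * w s(b, y) := by
      rw [hp', wlen_append, wlen_cons, wlen_cons, Sym2.eq_swap (a := y)]
      rw [hlspec]
      ring
    have hFle : F A + w s(b, y) ≤ F (insert y A) := by
      have hnot : s(b, y) ∉ T.edgeSet.toFinite.toFinset.filter (fun e => ∀ x ∈ e, x ∈ A) :=
        fun h => he2 ((mem_filter.1 h).2 y (Sym2.mem_mk_right _ _))
      simp only [hF]
      rw [add_comm, ← Finset.sum_insert hnot]
      refine Finset.sum_le_sum_of_subset_of_nonneg ?_ fun e _ _ => hw e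
      refine Finset.insert_subset (mem_filter.2 ⟨?_, ?_⟩) fun e he => ?_
      · rw [Set.Finite.mem_toFinset]; exact hby
      · intro x hx
        rcases Sym2.mem_iff.1 hx with rfl | rfl
        · exact Finset.mem_insert_of_mem he1
        · exact Finset.mem_insert_self _ _
      · rw [mem_filter] at he ⊢
        exact ⟨he.1, fun x hx => Finset.mem_insert_of_mem (he.2 x hx)⟩
    have := hmax (insert y A) (mem_filter.2 ⟨mem_univ _, p', hsupp, by linarith⟩)
    rw [Finset.card_insert_of_notMem he2] at this
    omega
  · exact Finset.sum_le_sum_of_subset_of_nonneg (filter_subset _ _) fun e _ _ => hw e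

lemma exists_pred_structure (hw : ∀ e, 0 ≤ w e) (hT : T.Connected) {z : V} {K : Finset V}
    (hz : z ∉ K) :
    ∃ π : V → V, (∀ x ∈ K, (π x = z ∨ π x ∈ K) ∧ π x ≠ x) ∧
      (∀ J : SimpleGraph V, (∀ x ∈ K, J.Reachable (π x) x) → ∀ x ∈ K, J.Reachable z x) ∧
      ∑ x ∈ K, wdist T w (π x) x ≤ 2 * wWeight T w := by
  obtain ⟨p, hp, hlen⟩ := exists_tour hw hT z
  obtain ⟨π, h1, h2, h3⟩ := exists_pred_of_walk (d := wdist T w) (wdist_nonneg hw)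
    (fun x y z => wdist_triangle hw (hT.preconnected x y) (hT.preconnected y z))
    (fun x y h => wdist_le_of_adj hw h) p z K hz fun x _ => hp x
  rw [wdist_self hw] at h3
  exact ⟨π, h1, h2, by linarith⟩

lemma wdist_le_of_isAcyclic (hw : ∀ e, 0 ≤ w e) (hT : T.IsAcyclic) (hJ : J ≤ T) {a b : V}
    (h : J.Reachable a b) : wdist J w a b ≤ wdist T w a b := by
  obtain ⟨p, hp, hlen⟩ := exists_path_eq_wdist hw (h.mono hJ)
  obtain ⟨q⟩ := h
  have hq := q.toPath.2
  have : p = (q.toPath : J.Walk a b).mapLe hJ := congrArg Subtype.val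
    ((hT.subsingleton_path a b).elim ⟨p, hp⟩ ⟨(q.toPath : J.Walk a b).mapLe hJ, hq.mapLe hJ⟩)
  rw [← hlen, this, wlen_mapLe]
  exact wdist_le hw _

end Tour

section Level

variable {V : Type*} {G H T T₀ : SimpleGraph V} {w : Sym2 V → ℝ}

lemma sum_edges_toFinset {u v : V} {p : G.Walk u v} (hp : p.IsPath) :
    ∑ e ∈ p.edges.toFinset, w e = wlen w p :=
  List.sum_toFinset _ hp.isTrail.edges_nodup

lemma sum_biUnion_edges_le (hw : ∀ e, 0 ≤ w e) {ι : Type*} (X : Finset ι) {a b : ι → V}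
    (p : ∀ x, G.Walk (a x) (b x)) (hp : ∀ x, (p x).IsPath) :
    ∑ e ∈ X.biUnion fun x => (p x).edges.toFinset, w e ≤ ∑ x ∈ X, wlen w (p x) := by
  induction X using Finset.induction_on with
  | empty => simp
  | insert x X hx ih =>
    rw [Finset.biUnion_insert, Finset.sum_insert hx, ← sum_edges_toFinset (hp x)]
    refine le_trans ?_ (add_le_add_right ih _)
    rw [← Finset.sum_union_inter]
    exact le_add_of_nonneg_right (Finset.sum_nonneg fun e _ => hw e)

lemma exists_walk_fromEdgeSet {F : Finset (Sym2 V)} {u v : V} (p : G.Walk u v)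
    (hp : p.edges.toFinset ⊆ F) :
    ∃ q : (SimpleGraph.fromEdgeSet (F : Set (Sym2 V))).Walk u v, q.edges = p.edges := by
  refine ⟨p.transfer _ fun e he => ?_, p.edges_transfer _⟩
  rw [SimpleGraph.edgeSet_fromEdgeSet]
  exact ⟨hp (List.mem_toFinset.2 he), G.not_isDiag_of_mem_edgeSet (p.edges_subset_edgeSet he)⟩

/-- The weight in which edges outside of `T₀` are made longer by a factor `δ⁻¹`. -/
noncomputable def stretchWeight (T₀ : SimpleGraph V) (w : Sym2 V → ℝ) (δ : ℝ) (e : Sym2 V) : ℝ :=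
  if e ∈ T₀.edgeSet then w e else w e / δ

lemma stretchWeight_pos (hw : ∀ e, 0 < w e) {δ : ℝ} (hδ : 0 < δ) (e : Sym2 V) :
    0 < stretchWeight T₀ w δ e := by
  unfold stretchWeight
  split_ifs
  · exact hw e
  · exact div_pos (hw e) hδ

lemma le_stretchWeight (hw : ∀ e, 0 < w e) {δ : ℝ} (hδ : 0 < δ) (hδ1 : δ ≤ 1) (e : Sym2 V) :
    w e ≤ stretchWeight T₀ w δ e := by
  unfold stretchWeight
  split_ifs
  · exact le_rfl
  · exact le_div_self (hw e).le hδ hδ1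

lemma stretchWeight_le (hw : ∀ e, 0 < w e) {δ : ℝ} (hδ : 0 < δ) (hδ1 : δ ≤ 1) (e : Sym2 V) :
    stretchWeight T₀ w δ e ≤ δ⁻¹ * w e := by
  unfold stretchWeight
  rw [inv_mul_eq_div]
  split_ifs
  · exact le_div_self (hw e).le hδ hδ1
  · exact le_rfl

lemma wlen_stretchWeight {δ : ℝ} {u v : V} (p : T₀.Walk u v) :
    wlen (stretchWeight T₀ w δ) p = wlen w p := by
  unfold wlen
  congr 1
  refine List.map_congr_left fun e he => ?_
  rw [stretchWeight, if_pos (p.edges_subset_edgeSet he)]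

variable [Fintype V]

/-- Connecting all vertices to representatives by a light set of edges. -/
lemma exists_net_edges (hw : ∀ e, 0 < w e) (hG : G.Connected) (hT₀ : IsSpanningTree G T₀)
    {δ : ℝ} (hδ : 0 < δ) (hδ1 : δ ≤ 1) {y : V → V} (hy : ∀ v, y (y v) = y v) :
    ∃ F : Finset (Sym2 V), (∀ e ∈ F, e ∈ G.edgeSet) ∧ ∑ e ∈ F, w e ≤ 2 * δ * wWeight T₀ w ∧
      ∀ v, ∃ x, ∃ p : (T₀ ⊔ SimpleGraph.fromEdgeSet (F : Set (Sym2 V))).Walk v (y x),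
        wlen (stretchWeight T₀ w δ) p ≤ 2 * wdist G w v (y v) / δ := by
  have hw0 : ∀ e, 0 ≤ w e := fun e => (hw e).le
  set D : V → ℝ := fun v => wdist G w v (y v) with hD
  have hDy : ∀ v, D (y v) = 0 := fun v => by simp only [hD]; rw [hy, wdist_self hw0]
  have hD0 : ∀ v, 0 ≤ D v := fun v => wdist_nonneg hw0 _ _
  obtain ⟨X, -, hX, hcov⟩ := exists_greedy univ D
    (fun u v => δ * wdist T₀ w u v ≤ max (D u) (D v))
    (fun u v h => by rwa [wdist_comm, max_comm])
  obtain ⟨v0⟩ := hG.nonempty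
  obtain ⟨x0, hx0, -, hDx0⟩ := hcov (y v0) (mem_univ _)
  rw [hDy] at hDx0
  obtain ⟨π, hπ, -, hsum⟩ := exists_pred_structure hw0 hT₀.2.connected
    (z := x0) (K := X.erase x0) (Finset.notMem_erase _ _)
  choose q hq hqlen using fun x => exists_path_eq_wdist hw0 (hG.preconnected x (y x))
  refine ⟨X.biUnion fun x => (q x).edges.toFinset, fun e he => ?_, ?_, fun v => ?_⟩
  · obtain ⟨x, -, he⟩ := Finset.mem_biUnion.1 he
    exact (q x).edges_subset_edgeSet (List.mem_toFinset.1 he)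
  · refine (sum_biUnion_edges_le hw0 X q hq).trans ?_
    rw [Finset.sum_congr rfl fun x _ => hqlen x, ← Finset.add_sum_erase _ _ hx0]
    have : ∑ x ∈ X.erase x0, wdist G w x (y x) ≤
        ∑ x ∈ X.erase x0, δ * wdist T₀ w (π x) x := Finset.sum_le_sum fun x hx => by
      have hπX : π x ∈ X := by
        rcases (hπ x hx).1 with h | h
        · rw [h]; exact hx0
        · exact Finset.mem_of_mem_erase h
      have := hX (π x) hπX x (Finset.mem_of_mem_erase hx) (hπ x hx).2
      rw [not_le] at this
      exact ((le_max_right _ _).trans_lt this).le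
    rw [← Finset.mul_sum] at this
    have h2 := mul_le_mul_of_nonneg_left hsum hδ.le
    simp only [hD] at hDx0
    linarith
  · obtain ⟨x, hx, hor, hDx⟩ := hcov v (mem_univ _)
    refine ⟨x, ?_⟩
    obtain ⟨p1, -, hp1⟩ := exists_path_eq_wdist hw0 (hT₀.2.connected.preconnected v x)
    obtain ⟨p2, hp2⟩ := exists_walk_fromEdgeSet (F := X.biUnion fun x => (q x).edges.toFinset)
      (q x) (fun e he => Finset.mem_biUnion.2 ⟨x, hx, he⟩)
    refine ⟨(p1.mapLe le_sup_left).append (p2.mapLe le_sup_right), ?_⟩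
    rw [wlen_append, wlen_mapLe, wlen_mapLe, wlen_stretchWeight, hp1]
    have h1 : δ * wdist T₀ w v x ≤ D v := by
      rcases hor with rfl | h
      · rw [wdist_self hw0, mul_zero]; exact hD0 _
      · rw [wdist_comm]; exact h.trans (max_le hDx le_rfl)
    have h2 : wlen (stretchWeight T₀ w δ) p2 ≤ δ⁻¹ * D v := by
      refine (wlen_le_mul p2 fun e _ => stretchWeight_le hw hδ hδ1 e).trans ?_
      rw [wlen_eq_of_edges hp2, hqlen]
      exact mul_le_mul_of_nonneg_left hDx (inv_nonneg.2 hδ.le)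
    rw [inv_mul_eq_div] at h2
    have h3 : wdist T₀ w v x ≤ D v / δ := by rw [le_div_iff₀ hδ]; linarith
    have : 2 * D v / δ = D v / δ + D v / δ := by ring
    simp only [hD] at *
    linarith

variable {E : Type*} [Fintype E] {c : E → ℝ} {a b : E → V}

/-- A light set of edges in which the points of a net are well connected. -/
lemma exists_net_tree_edges (hw : ∀ e, 0 < w e) (hG : G.Connected) (hT₀ : IsSpanningTree G T₀)
    (hW : 0 < wWeight T₀ w) {δ : ℝ} (hδ : 0 < δ) {ι : V → ℕ}
    (hι : Priorities ι) {i : ℕ} {K : Finset V} (hK : K.Nonempty) (hKι : ∀ x ∈ K, ι x ≤ i)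
    (hc : ∀ e, 0 ≤ c e) (ha : ∀ e, a e ∈ K) (hb : ∀ e, b e ∈ K) :
    ∃ F : Finset (Sym2 V), (∀ e ∈ F, e ∈ G.edgeSet) ∧
      ∑ e ∈ F.filter (fun e => e ∉ T₀.edgeSet), w e ≤ 36864 * prio i * δ * wWeight T₀ w ∧
      ∃ q : ∀ e, (SimpleGraph.fromEdgeSet (F : Set (Sym2 V))).Walk (a e) (b e),
        ∑ e, c e * wlen (stretchWeight T₀ w δ) (q e) ≤
          18432 * prio i * ∑ e, c e * wdist G (stretchWeight T₀ w δ) (a e) (b e) := by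
  have hw0 : ∀ e, 0 ≤ w e := fun e => (hw e).le
  set w' := stretchWeight T₀ w δ with hw'def
  have hw' : ∀ e, 0 < w' e := stretchWeight_pos hw hδ
  have hw'0 : ∀ e, 0 ≤ w' e := fun e => (hw' e).le
  obtain ⟨z, hz⟩ := hK
  obtain ⟨π, hπ, hreach, hsum⟩ := exists_pred_structure hw0 hT₀.2.connected
    (z := z) (K := K.erase z) (Finset.notMem_erase _ _)
  have hπK : ∀ x ∈ K.erase z, π x ∈ K := fun x hx => by
    rcases (hπ x hx).1 with h | h
    · rw [h]; exact hz
    · exact Finset.mem_of_mem_erase h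
  choose p hp hplen using fun e => exists_path_eq_wdist hw'0 (hG.preconnected (a e) (b e))
  choose r hr hrlen using fun x => exists_path_eq_wdist hw0 (hT₀.2.connected.preconnected (π x) x)
  obtain ⟨T₁, hT₁, hc1, hc2⟩ := exists_tree_two (w := w') (i := i) (E' := ↥(K.erase z))
    (a' := fun x => π x) (b' := fun x => x) (M' := 2 * wWeight T₀ w) hw' hG hι hc p
    (fun x => (r x).mapLe hT₀.1) (fun e => hKι _ (ha e)) (fun x => hKι _ (hπK _ x.2))
    (Finset.sum_congr rfl fun e _ => by rw [hplen]).le (by linarith)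
    (by
      rw [Finset.sum_coe_sort (K.erase z) (fun x => wlen w' ((r x).mapLe hT₀.1))]
      refine le_trans (le_of_eq (Finset.sum_congr rfl fun x _ => ?_)) hsum
      rw [wlen_mapLe, hw'def, wlen_stretchWeight, hrlen])
  rw [Finset.sum_coe_sort (K.erase z) (fun x => wdist T₁ w' (π x) x)] at hc2
  choose s hs hslen using fun x =>
    exists_path_eq_wdist hw'0 (hT₁.2.connected.preconnected (π x) x)
  set F : Finset (Sym2 V) := (K.erase z).biUnion fun x => (s x).edges.toFinset with hF
  have hFT₁ : ∀ e ∈ F, e ∈ T₁.edgeSet := fun e he => by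
    obtain ⟨x, -, he⟩ := Finset.mem_biUnion.1 he
    exact (s x).edges_subset_edgeSet (List.mem_toFinset.1 he)
  have hle : SimpleGraph.fromEdgeSet (F : Set (Sym2 V)) ≤ T₁ := by
    intro u v huv
    rw [SimpleGraph.fromEdgeSet_adj] at huv
    exact hFT₁ _ huv.1
  have hreach' : ∀ x ∈ K, (SimpleGraph.fromEdgeSet (F : Set (Sym2 V))).Reachable z x :=
    fun x hx => by
      by_cases hxz : x = z
      · rw [hxz]
      · refine hreach _ (fun x hx => ?_) x (Finset.mem_erase.2 ⟨hxz, hx⟩)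
        obtain ⟨q, -⟩ := exists_walk_fromEdgeSet (F := F) (s x)
          (fun e he => Finset.mem_biUnion.2 ⟨x, hx, he⟩)
        exact q.reachable
  have hr' : ∀ e, (SimpleGraph.fromEdgeSet (F : Set (Sym2 V))).Reachable (a e) (b e) :=
    fun e => (hreach' _ (ha e)).symm.trans (hreach' _ (hb e))
  choose q hq hqlen using fun e => exists_path_eq_wdist hw'0 (hr' e)
  refine ⟨F, fun e he => SimpleGraph.edgeSet_mono hT₁.1 (hFT₁ e he), ?_, q, ?_⟩
  · calc ∑ e ∈ F.filter (fun e => e ∉ T₀.edgeSet), w e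
        = ∑ e ∈ F.filter (fun e => e ∉ T₀.edgeSet), δ * w' e := Finset.sum_congr rfl fun e he => by
          rw [hw'def, stretchWeight, if_neg (mem_filter.1 he).2, mul_div_cancel₀ _ hδ.ne']
      _ = δ * ∑ e ∈ F.filter (fun e => e ∉ T₀.edgeSet), w' e := by rw [Finset.mul_sum]
      _ ≤ δ * ∑ e ∈ F, w' e := mul_le_mul_of_nonneg_left
          (Finset.sum_le_sum_of_subset_of_nonneg (filter_subset _ _) fun e _ _ => hw'0 e) hδ.le
      _ ≤ δ * ∑ x ∈ K.erase z, wlen w' (s x) :=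
          mul_le_mul_of_nonneg_left (sum_biUnion_edges_le hw'0 _ s hs) hδ.le
      _ ≤ δ * (18432 * prio i * (2 * wWeight T₀ w)) := by
          refine mul_le_mul_of_nonneg_left ?_ hδ.le
          rw [Finset.sum_congr rfl fun x _ => hslen x]
          exact hc2
      _ = 36864 * prio i * δ * wWeight T₀ w := by ring
  · refine le_trans (Finset.sum_le_sum fun e _ => ?_) hc1
    rw [hqlen]
    exact mul_le_mul_of_nonneg_left (wdist_le_of_isAcyclic hw'0 hT₁.2.isAcyclic hle (hr' e)) (hc e)

/-- A light set of edges serving the demands of one level. -/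
theorem exists_level_edges (hw : ∀ e, 0 < w e) (hG : G.Connected) (hT₀ : IsSpanningTree G T₀)
    (hW : 0 < wWeight T₀ w) {δ : ℝ} (hδ : 0 < δ) (hδ1 : δ ≤ 1) {ι : V → ℕ}
    (hι : Priorities ι) {i : ℕ} {y : V → V} (hy : ∀ v, y (y v) = y v) (hyι : ∀ v, ι (y v) ≤ i)
    (hc : ∀ e, 0 ≤ c e) :
    ∃ F : Finset (Sym2 V), (∀ e ∈ F, e ∈ G.edgeSet) ∧
      ∑ e ∈ F.filter (fun e => e ∉ T₀.edgeSet), w e ≤ 40000 * prio i * δ * wWeight T₀ w ∧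
      ∃ q : ∀ e, (T₀ ⊔ SimpleGraph.fromEdgeSet (F : Set (Sym2 V))).Walk (a e) (b e),
        (∀ e, ∃ k ∈ (q e).support, ι k ≤ i) ∧
        ∑ e, c e * wlen w (q e) ≤ 40000 * prio i / δ * ∑ e, c e * (wdist G w (a e) (b e) +
          wdist G w (a e) (y (a e)) + wdist G w (b e) (y (b e))) := by
  have hw0 : ∀ e, 0 ≤ w e := fun e => (hw e).le
  set w' := stretchWeight T₀ w δ with hw'def
  have hw' : ∀ e, 0 < w' e := stretchWeight_pos hw hδ
  have hw'0 : ∀ e, 0 ≤ w' e := fun e => (hw' e).le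
  obtain ⟨F₁, hF₁G, hF₁, hx⟩ := exists_net_edges hw hG hT₀ hδ hδ1 hy
  choose x p hp using hx
  obtain ⟨v0⟩ := hG.nonempty
  obtain ⟨F₂, hF₂G, hF₂, q, hq⟩ := exists_net_tree_edges (a := fun e => y (x (a e)))
    (b := fun e => y (x (b e))) (K := univ.image y) hw hG hT₀ hW hδ hι
    ⟨y v0, Finset.mem_image_of_mem _ (mem_univ _)⟩
    (fun z hz => by
      obtain ⟨v, -, rfl⟩ := Finset.mem_image.1 hz
      exact hyι v) hc (fun e => Finset.mem_image_of_mem _ (mem_univ _))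
      (fun e => Finset.mem_image_of_mem _ (mem_univ _))
  set D : V → ℝ := fun v => wdist G w v (y v) with hD
  have hD0 : ∀ v, 0 ≤ D v := fun v => wdist_nonneg hw0 _ _
  have hmono : ∀ F ⊆ F₁ ∪ F₂, SimpleGraph.fromEdgeSet (F : Set (Sym2 V)) ≤
      SimpleGraph.fromEdgeSet ((F₁ ∪ F₂ : Finset (Sym2 V)) : Set (Sym2 V)) := fun F hF =>
    SimpleGraph.fromEdgeSet_mono (by exact_mod_cast hF)
  have hle1 : T₀ ⊔ SimpleGraph.fromEdgeSet (F₁ : Set (Sym2 V)) ≤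
      T₀ ⊔ SimpleGraph.fromEdgeSet ((F₁ ∪ F₂ : Finset (Sym2 V)) : Set (Sym2 V)) :=
    sup_le_sup le_rfl (hmono _ Finset.subset_union_left)
  have hle2 : SimpleGraph.fromEdgeSet (F₂ : Set (Sym2 V)) ≤
      T₀ ⊔ SimpleGraph.fromEdgeSet ((F₁ ∪ F₂ : Finset (Sym2 V)) : Set (Sym2 V)) :=
    le_sup_of_le_right (hmono _ Finset.subset_union_right)
  have hGle : T₀ ⊔ SimpleGraph.fromEdgeSet (F₁ : Set (Sym2 V)) ≤ G := by
    refine sup_le hT₀.1 fun u v huv => ?_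
    rw [SimpleGraph.fromEdgeSet_adj] at huv
    exact hF₁G _ huv.1
  have hprio := le_prio i
  refine ⟨F₁ ∪ F₂, fun e he => ?_, ?_, fun e => ((p (a e)).mapLe hle1).append
    (((q e).mapLe hle2).append ((p (b e)).mapLe hle1).reverse), fun e => ?_, ?_⟩
  · rcases Finset.mem_union.1 he with h | h
    · exact hF₁G e h
    · exact hF₂G e h
  · rw [Finset.filter_union]
    have h1 : ∑ e ∈ F₁.filter (fun e => e ∉ T₀.edgeSet) ∪ F₂.filter (fun e => e ∉ T₀.edgeSet), w e ≤
        ∑ e ∈ F₁.filter (fun e => e ∉ T₀.edgeSet), w e +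
          ∑ e ∈ F₂.filter (fun e => e ∉ T₀.edgeSet), w e := by
      rw [← Finset.sum_union_inter]
      exact le_add_of_nonneg_right (Finset.sum_nonneg fun e _ => hw0 e)
    have h2 : ∑ e ∈ F₁.filter (fun e => e ∉ T₀.edgeSet), w e ≤ ∑ e ∈ F₁, w e :=
      Finset.sum_le_sum_of_subset_of_nonneg (filter_subset _ _) fun e _ _ => hw0 e
    have h3 : 0 ≤ δ * wWeight T₀ w := (mul_pos hδ hW).le
    nlinarith
  · refine ⟨y (x (a e)), ?_, hyι _⟩
    rw [SimpleGraph.Walk.mem_support_append_iff]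
    exact Or.inl (SimpleGraph.Walk.end_mem_support _)
  · have hdist : ∀ e, wdist G w' (y (x (a e))) (y (x (b e))) ≤
        (2 * D (a e) + wdist G w (a e) (b e) + 2 * D (b e)) / δ := fun e => by
      obtain ⟨g, -, hg⟩ := exists_path_eq_wdist hw0 (hG.preconnected (a e) (b e))
      refine (wdist_le hw'0 (((p (a e)).mapLe hGle).reverse.append
        (g.append ((p (b e)).mapLe hGle)))).trans ?_
      rw [wlen_append, wlen_append, wlen_reverse, wlen_mapLe, wlen_mapLe]
      have h1 := wlen_le_mul (w' := w') g fun e _ => stretchWeight_le (T₀ := T₀) hw hδ hδ1 e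
      rw [hg, inv_mul_eq_div] at h1
      have h2 := hp (a e)
      have h3 := hp (b e)
      rw [add_div, add_div]
      linarith
    have hlen : ∀ e, wlen w (((p (a e)).mapLe hle1).append
        (((q e).mapLe hle2).append ((p (b e)).mapLe hle1).reverse)) ≤
        2 * D (a e) / δ + wlen w' (q e) + 2 * D (b e) / δ := fun e => by
      refine (wlen_le_mul (w := w') (c := 1) _ fun e _ => by
        rw [one_mul]; exact le_stretchWeight hw hδ hδ1 e).trans ?_
      rw [one_mul, wlen_append, wlen_append, wlen_reverse, wlen_mapLe, wlen_mapLe, wlen_mapLe]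
      have h2 := hp (a e)
      have h3 := hp (b e)
      linarith
    set S : ℝ := ∑ e, c e * (wdist G w (a e) (b e) + D (a e) + D (b e)) with hS
    have hS0 : 0 ≤ S := Finset.sum_nonneg fun e _ => mul_nonneg (hc e)
      (add_nonneg (add_nonneg (wdist_nonneg hw0 _ _) (hD0 _)) (hD0 _))
    have e1 : ∑ e, c e * wdist G w' (y (x (a e))) (y (x (b e))) ≤ 2 / δ * S := by
      rw [hS, Finset.mul_sum]
      refine Finset.sum_le_sum fun e _ => ?_
      have hd := wdist_nonneg hw0 (G := G) (a e) (b e)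
      calc _ ≤ c e * ((2 * D (a e) + wdist G w (a e) (b e) + 2 * D (b e)) / δ) :=
            mul_le_mul_of_nonneg_left (hdist e) (hc e)
        _ ≤ c e * ((2 * (wdist G w (a e) (b e) + D (a e) + D (b e))) / δ) := by
            refine mul_le_mul_of_nonneg_left (div_le_div_of_nonneg_right ?_ hδ.le) (hc e)
            linarith
        _ = _ := by ring
    have e2 : ∑ e, c e * (2 * D (a e) / δ + 2 * D (b e) / δ) ≤ 2 / δ * S := by
      rw [hS, Finset.mul_sum]
      refine Finset.sum_le_sum fun e _ => ?_
      have hd := wdist_nonneg hw0 (G := G) (a e) (b e)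
      calc _ = c e * ((2 * (D (a e) + D (b e))) / δ) := by ring
        _ ≤ c e * ((2 * (wdist G w (a e) (b e) + D (a e) + D (b e))) / δ) := by
            refine mul_le_mul_of_nonneg_left (div_le_div_of_nonneg_right ?_ hδ.le) (hc e)
            linarith
        _ = _ := by ring
    have hSδ : 0 ≤ S / δ := div_nonneg hS0 hδ.le
    calc _ ≤ ∑ e, c e * (2 * D (a e) / δ + wlen w' (q e) + 2 * D (b e) / δ) :=
          Finset.sum_le_sum fun e _ => mul_le_mul_of_nonneg_left (hlen e) (hc e)
      _ = ∑ e, c e * (2 * D (a e) / δ + 2 * D (b e) / δ) + ∑ e, c e * wlen w' (q e) := by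
          rw [← Finset.sum_add_distrib]; exact Finset.sum_congr rfl fun e _ => by ring
      _ ≤ 2 / δ * S + 18432 * prio i * (2 / δ * S) := add_le_add e2 (hq.trans
          (mul_le_mul_of_nonneg_left e1 (by linarith)))
      _ = (2 + 36864 * prio i) * (S / δ) := by ring
      _ ≤ (40000 * prio i) * (S / δ) := mul_le_mul_of_nonneg_right (by linarith) hSδ
      _ = 40000 * prio i / δ * S := by ring

end Level

section NetFamily

variable {V : Type*} [Fintype V] {G : SimpleGraph V} {w : Sym2 V → ℝ}

/-- Nets of doubly exponentially increasing size. -/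
lemma exists_nets (hw : ∀ e, 0 ≤ w e) (hG : G.Connected) :
    ∃ (y : ℕ → V → V) (ι : V → ℕ), Priorities ι ∧ (∀ i v, ι (y i v) ≤ i) ∧
      (∀ i v, y i (y i v) = y i v) ∧
      ∀ i, ((badPairs G w (y i)).card : ℝ) ≤
        2 * ((2 : ℝ) ^ 2 ^ i)⁻¹ * ((Fintype.card V : ℝ) * ((Fintype.card V : ℝ) - 1)) := by
  have hnet := fun i : ℕ => exists_net hw hG (ε := ((2 : ℝ) ^ 2 ^ i)⁻¹) (by positivity)
    (inv_le_one_of_one_le₀ (one_le_pow₀ one_le_two))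
  choose K y hyK hKy hK hbad using hnet
  simp only [inv_inv] at hK
  have hex : ∀ v, ∃ i, v ∈ K i ∨ (Fintype.card V : ℝ) ≤ (2 : ℝ) ^ 2 ^ i := by
    intro v
    refine ⟨Fintype.card V, Or.inr ?_⟩
    have h1 : Fintype.card V < 2 ^ Fintype.card V := Nat.lt_two_pow_self
    have h2 : 2 ^ Fintype.card V < 2 ^ 2 ^ Fintype.card V := Nat.lt_two_pow_self
    exact_mod_cast (h1.trans h2).le
  refine ⟨y, fun v => Nat.find (hex v), fun i => ?_, fun i v =>
    Nat.find_min' _ (Or.inl (hyK i v)), fun i v => hKy i _ (hyK i v), hbad⟩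
  by_cases hi : (Fintype.card V : ℝ) ≤ (2 : ℝ) ^ 2 ^ i
  · refine le_trans ?_ hi
    exact_mod_cast Finset.card_le_univ _
  · refine le_trans ?_ (hK i)
    have : (univ.filter fun v => Nat.find (hex v) = i) ⊆ K i := by
      intro v hv
      have h := Nat.find_spec (hex v)
      rw [(mem_filter.1 hv).2] at h
      exact h.resolve_right hi
    exact_mod_cast Finset.card_le_card this

/-- A scale at which each pair of distinct vertices is well represented by the nets, and which is
at most `i` for all but a small fraction of the pairs. -/
lemma exists_level {y : ℕ → V → V}
    (hy : ∀ i, ((badPairs G w (y i)).card : ℝ) ≤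
        2 * ((2 : ℝ) ^ 2 ^ i)⁻¹ * ((Fintype.card V : ℝ) * ((Fintype.card V : ℝ) - 1))) :
    ∃ lev : V × V → ℕ, (∀ p, p ∉ badPairs G w (y (lev p))) ∧
      ∀ p i, p ∉ badPairs G w (y i) → lev p ≤ i := by
  have hex : ∀ p : V × V, ∃ i, p ∉ badPairs G w (y i) := by
    intro p
    set n := Fintype.card V with hn
    have h1 : 2 * (n * n) < 2 ^ 2 ^ (2 * (n * n)) :=
      Nat.lt_two_pow_self.trans_le (Nat.pow_le_pow_right two_pos Nat.lt_two_pow_self.le)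
    have h1' : 2 * ((n : ℝ) * n) < (2 : ℝ) ^ 2 ^ (2 * (n * n)) := by exact_mod_cast h1
    refine ⟨2 * (n * n), fun hp => ?_⟩
    have h2 : (1 : ℝ) ≤ (badPairs G w (y (2 * (n * n)))).card := by
      exact_mod_cast Finset.card_pos.2 ⟨p, hp⟩
    have hn0 : (0 : ℝ) ≤ n := Nat.cast_nonneg _
    have hpos : (0 : ℝ) < (2 : ℝ) ^ 2 ^ (2 * (n * n)) := by positivity
    have h3 : 1 ≤ 2 * ((n : ℝ) * (n - 1)) / (2 : ℝ) ^ 2 ^ (2 * (n * n)) :=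
      (h2.trans (hy _)).trans_eq (by rw [div_eq_mul_inv]; ring)
    rw [le_div_iff₀ hpos] at h3
    nlinarith
  exact ⟨fun p => Nat.find (hex p), fun p => Nat.find_spec (hex p), fun p i h =>
    Nat.find_min' _ h⟩

end NetFamily

section FinalTree

variable {V : Type*} [Fintype V] {G T₀ : SimpleGraph V} {w : Sym2 V → ℝ}
variable {E : Type*} [Fintype E] {a b : E → V} {c : E → ℝ}

lemma wWeight_mono (hw : ∀ e, 0 ≤ w e) {H K : SimpleGraph V} (h : H ≤ K) :
    wWeight H w ≤ wWeight K w := by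
  unfold wWeight
  refine Finset.sum_le_sum_of_subset_of_nonneg ?_ fun e _ _ => hw e
  simpa using h

lemma wWeight_sup_le (hw : ∀ e, 0 ≤ w e) {ι' : Type*} (I : Finset ι') (F : ι' → Finset (Sym2 V)) :
    wWeight (T₀ ⊔ SimpleGraph.fromEdgeSet (⋃ i ∈ I, (F i : Set (Sym2 V)))) w ≤
      wWeight T₀ w + ∑ i ∈ I, ∑ e ∈ (F i).filter (fun e => e ∉ T₀.edgeSet), w e := by
  unfold wWeight
  calc _ ≤ ∑ e ∈ T₀.edgeSet.toFinite.toFinset ∪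
          I.biUnion fun i => (F i).filter (fun e => e ∉ T₀.edgeSet), w e := by
        refine Finset.sum_le_sum_of_subset_of_nonneg ?_ fun e _ _ => hw e
        intro e he
        simp only [Set.Finite.mem_toFinset, SimpleGraph.edgeSet_sup, SimpleGraph.edgeSet_fromEdgeSet,
          Set.mem_union, Set.mem_sdiff, Set.mem_iUnion, Finset.mem_coe] at he
        simp only [Finset.mem_union, Set.Finite.mem_toFinset, Finset.mem_biUnion, mem_filter]
        by_cases h0 : e ∈ T₀.edgeSet
        · exact Or.inl h0
        · obtain ⟨⟨i, hi, hei⟩, -⟩ := he.resolve_left h0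
          exact Or.inr ⟨i, hi, hei, h0⟩
    _ ≤ ∑ e ∈ T₀.edgeSet.toFinite.toFinset, w e +
          ∑ e ∈ I.biUnion fun i => (F i).filter (fun e => e ∉ T₀.edgeSet), w e := by
        rw [← Finset.sum_union_inter]
        exact le_add_of_nonneg_right (Finset.sum_nonneg fun e _ => hw e)
    _ ≤ _ := by
        gcongr
        induction I using Finset.induction_on with
        | empty => simp
        | insert i I hi ih =>
          rw [Finset.biUnion_insert, Finset.sum_insert hi]
          refine le_trans ?_ (add_le_add_right ih _)
          rw [← Finset.sum_union_inter]
          exact le_add_of_nonneg_right (Finset.sum_nonneg fun e _ => hw e)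

/-- The stretch of a pair which is well represented at scale `i`. -/
noncomputable def levelStretch (i : ℕ) : ℝ := prio i ^ 3 * ((i + 1) * (i + 2))

lemma sum_inv_mul_succ_le (N : ℕ) :
    ∑ i ∈ range N, 1 / (((i : ℝ) + 1) * (i + 2)) ≤ 1 := by
  have : ∀ N : ℕ, ∑ i ∈ range N, 1 / (((i : ℝ) + 1) * (i + 2)) = 1 - 1 / ((N : ℝ) + 1) := by
    intro N
    induction N with
    | zero => simp
    | succ k ih =>
      rw [Finset.sum_range_succ, ih]
      push_cast
      field_simp
      ring
  rw [this]
  have : (0 : ℝ) < 1 / ((N : ℝ) + 1) := by positivity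
  linarith

theorem exists_light_tree (hw : ∀ e, 0 < w e) (hG : G.Connected) (hT₀ : IsSpanningTree G T₀)
    (hW : 0 < wWeight T₀ w) {ρ : ℝ} (hρ : 0 < ρ) (hρ1 : ρ < 1) {ι : V → ℕ} (hι : Priorities ι)
    {y : ℕ → V → V} (hyι : ∀ i v, ι (y i v) ≤ i) (hy : ∀ i v, y i (y i v) = y i v) (lev : E → ℕ)
    (ha : ∀ e, wdist G w (a e) (y (lev e) (a e)) ≤ 2 * wdist G w (a e) (b e))
    (hb : ∀ e, wdist G w (b e) (y (lev e) (b e)) ≤ 2 * wdist G w (a e) (b e))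
    (hc : ∀ e, 0 ≤ c e) :
    ∃ T, IsSpanningTree G T ∧ wWeight T w ≤ (1 + ρ) * wWeight T₀ w ∧
      ∑ e, c e * wdist T w (a e) (b e) ≤
        ∑ e, c e * (10 ^ 14 / ρ * levelStretch (lev e) * wdist G w (a e) (b e)) := by
  have hw0 : ∀ e, 0 ≤ w e := fun e => (hw e).le
  set δ : ℕ → ℝ := fun i => ρ / (40000 * prio i * ((i + 1) * (i + 2))) with hδdef
  have hpp : ∀ i, 0 < prio i := prio_pos
  have hδ : ∀ i, 0 < δ i := fun i => div_pos hρ (by have := hpp i; positivity)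
  have hδ1 : ∀ i, δ i ≤ 1 := by
    intro i
    have h1 := le_prio i
    have h0 := hpp i
    rw [hδdef]
    simp only
    rw [div_le_one (by positivity)]
    have h2 : (1 : ℝ) ≤ ((i : ℝ) + 1) * (i + 2) := by
      have : (0 : ℝ) ≤ i := Nat.cast_nonneg _
      nlinarith
    nlinarith
  set ci : ℕ → E → ℝ := fun i e => if lev e = i then c e else 0 with hci
  have hci0 : ∀ i e, 0 ≤ ci i e := fun i e => by
    simp only [hci]; split_ifs
    exacts [hc e, le_rfl]
  have hlevel := fun i => exists_level_edges (a := a) (b := b) hw hG hT₀ hW (hδ i) (hδ1 i) hι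
    (hy i) (hyι i) (hci0 i)
  choose F hFG hFw q hqk hq using hlevel
  set N : ℕ := univ.sup lev + 1 with hN
  have hlevN : ∀ e, lev e ∈ range N := fun e =>
    Finset.mem_range.2 (Nat.lt_succ_of_le (Finset.le_sup (mem_univ e)))
  set H := T₀ ⊔ SimpleGraph.fromEdgeSet (⋃ i ∈ range N, (F i : Set (Sym2 V))) with hH
  have hHG : H ≤ G := by
    refine sup_le hT₀.1 ?_
    rw [← SimpleGraph.edgeSet_subset_edgeSet, SimpleGraph.edgeSet_fromEdgeSet]
    rintro e ⟨he, -⟩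
    simp only [Set.mem_iUnion] at he
    obtain ⟨i, -, hei⟩ := he
    exact hFG i e hei
  have hHc : H.Connected := hT₀.2.connected.mono le_sup_left
  have hHw : wWeight H w ≤ (1 + ρ) * wWeight T₀ w := by
    refine (wWeight_sup_le hw0 _ _).trans ?_
    have h1 : ∑ i ∈ range N, ∑ e ∈ (F i).filter (fun e => e ∉ T₀.edgeSet), w e ≤
        ∑ i ∈ range N, 1 / (((i : ℝ) + 1) * (i + 2)) * (ρ * wWeight T₀ w) := by
      refine Finset.sum_le_sum fun i _ => (hFw i).trans (le_of_eq ?_)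
      have := (hpp i).ne'
      simp only [hδdef]
      field_simp
    rw [← Finset.sum_mul] at h1
    have h2 := mul_le_mul_of_nonneg_right (sum_inv_mul_succ_le N) (mul_pos hρ hW).le
    linarith
  have hle : ∀ e, T₀ ⊔ SimpleGraph.fromEdgeSet (F (lev e) : Set (Sym2 V)) ≤ H := fun e =>
    sup_le_sup_left (SimpleGraph.fromEdgeSet_mono
      (Set.subset_biUnion_of_mem (u := fun i => (F i : Set (Sym2 V))) (hlevN e))) _
  have hk : ∀ e, ∃ k ∈ ((q (lev e) e).mapLe (hle e)).support, ι k ≤ lev e := by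
    intro e
    obtain ⟨k, hk, hk'⟩ := hqk (lev e) e
    exact ⟨k, by simpa using hk, hk'⟩
  choose k hk hkι using hk
  obtain ⟨T, hT, hTs⟩ := exists_tree_stretch_le hw hHc hι hc
    (fun e => (q (lev e) e).mapLe (hle e)) hk
  refine ⟨T, ⟨hT.1.trans hHG, hT.2⟩, (wWeight_mono hw0 hT.1).trans hHw, hTs.trans ?_⟩
  simp only [wlen_mapLe]
  have hd0 : ∀ e, 0 ≤ wdist G w (a e) (b e) := fun e => wdist_nonneg hw0 _ _
  calc _ ≤ 12288 * ∑ e, ∑ i ∈ range N, prio i * (ci i e * wlen w (q i e)) := by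
        refine mul_le_mul_of_nonneg_left (Finset.sum_le_sum fun e _ => ?_) (by norm_num)
        have h1 : ∑ i ∈ range N, prio i * (ci i e * wlen w (q i e)) =
            prio (lev e) * (c e * wlen w (q (lev e) e)) := by
          rw [Finset.sum_eq_single_of_mem _ (hlevN e)]
          · simp [hci]
          · intro i _ hi
            simp [hci, hi.symm]
        rw [h1, mul_comm]
        exact mul_le_mul_of_nonneg_right (prio_mono (hkι e))
          (mul_nonneg (hc e) (wlen_nonneg hw0 _))
    _ = 12288 * ∑ i ∈ range N, prio i * ∑ e, ci i e * wlen w (q i e) := by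
        rw [Finset.sum_comm]
        simp only [Finset.mul_sum]
    _ ≤ 12288 * ∑ i ∈ range N, prio i * (40000 * prio i / δ i * ∑ e, ci i e *
          (5 * wdist G w (a e) (b e))) := by
        refine mul_le_mul_of_nonneg_left (Finset.sum_le_sum fun i _ =>
          mul_le_mul_of_nonneg_left ((hq i).trans ?_) (hpp i).le) (by norm_num)
        refine mul_le_mul_of_nonneg_left (Finset.sum_le_sum fun e _ => ?_)
          (by have := hpp i; have := hδ i; positivity)
        simp only [hci]
        split_ifs with h
        · subst h
          exact mul_le_mul_of_nonneg_left (by linarith [ha e, hb e]) (hc e)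
        · simp
    _ = ∑ e, ∑ i ∈ range N, 12288 * prio i * (40000 * prio i / δ i) * (ci i e *
          (5 * wdist G w (a e) (b e))) := by
        rw [Finset.sum_comm]
        simp only [Finset.mul_sum]
        refine Finset.sum_congr rfl fun i _ => Finset.sum_congr rfl fun e _ => by ring
    _ ≤ _ := by
        refine Finset.sum_le_sum fun e _ => ?_
        rw [Finset.sum_eq_single_of_mem _ (hlevN e)
          (fun i _ hi => by simp [hci, hi.symm])]
        simp only [hci, if_true, hδdef, levelStretch]
        have h0 := hpp (lev e)
        have h3 : 12288 * prio (lev e) * (40000 * prio (lev e) /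
            (ρ / (40000 * prio (lev e) * (((lev e : ℕ) + 1) * ((lev e : ℕ) + 2))))) *
            (c e * (5 * wdist G w (a e) (b e))) =
            c e * (98304000000000 / ρ * (prio (lev e) ^ 3 *
              (((lev e : ℕ) + 1) * ((lev e : ℕ) + 2))) * wdist G w (a e) (b e)) := by
          field_simp
          ring
        rw [h3]
        have h4 := hc e
        have h5 := hd0 e
        gcongr
        norm_num

lemma exists_levelStretch_le : ∃ C : ℝ, 0 < C ∧ ∀ i, levelStretch i ≤ C * (2 : ℝ) ^ (4 * i) := by
  have ht := tendsto_pow_const_div_const_pow_of_one_lt 8 (one_lt_two (α := ℝ))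
  obtain ⟨B, hB⟩ := ht.bddAbove_range
  have hB' : ∀ n : ℕ, (n : ℝ) ^ 8 ≤ B * 2 ^ n := fun n => by
    have := hB ⟨n, rfl⟩
    rwa [div_le_iff₀ (by positivity)] at this
  have hB1 : 0 < B := by
    have := hB' 1
    norm_num at this
    linarith
  refine ⟨4096 * (B * 64), by positivity, fun i => ?_⟩
  have h1 := hB' (i + 6)
  push_cast at h1
  have hi : (0 : ℝ) ≤ i := Nat.cast_nonneg _
  unfold levelStretch prio
  calc (((i : ℝ) + 5) * (i + 6) * 2 ^ (i + 4)) ^ 3 * ((i + 1) * (i + 2))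
      ≤ (((i : ℝ) + 6) * (i + 6) * 2 ^ (i + 4)) ^ 3 * ((i + 6) * (i + 6)) := by
        gcongr <;> norm_num
    _ = ((i : ℝ) + 6) ^ 8 * (4096 * 2 ^ (3 * i)) := by ring
    _ ≤ B * 2 ^ (i + 6) * (4096 * 2 ^ (3 * i)) := by gcongr
    _ = _ := by ring

end FinalTree

section Minimax


/-- The minimax principle for a finite family of cost vectors. -/
theorem exists_prob_sum_le {ι κ : Type*} [Fintype ι] [Fintype κ] (D : ι → κ → ℝ) (b : κ → ℝ)
    (h : ∀ c : κ → ℝ, (∀ k, 0 ≤ c k) → ∃ i, ∑ k, c k * D i k ≤ ∑ k, c k * b k) :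
    ∃ (m : ℕ) (prob : Fin m → ℝ) (f : Fin m → ι), (∀ j, 0 < prob j) ∧ ∑ j, prob j = 1 ∧
      ∀ k, ∑ j, prob j * D (f j) k ≤ b k := by
  obtain ⟨x, hx, hxb⟩ : ∃ x ∈ convexHull ℝ (Set.range D), x ∈ Set.Iic b := by
    by_contra! hne
    obtain ⟨f, u, v, hu, huv, hv⟩ := geometric_hahn_banach_compact_closed
      (convex_convexHull ℝ (Set.range D))
      ((Set.finite_range D).isCompact_convexHull ℝ)
      (convex_Iic b : Convex ℝ (Set.Iic b)) isClosed_Iic (Set.disjoint_left.2 hne)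
    have hf : ∀ x, f x = ∑ k, x k * f (Pi.single k 1) := by
      intro x
      conv_lhs => rw [← Finset.univ_sum_single x]
      rw [map_sum]
      refine Finset.sum_congr rfl fun k _ => ?_
      rw [← smul_eq_mul, ← map_smul, ← Pi.single_smul, smul_eq_mul, mul_one]
    have hneg : ∀ k, f (Pi.single k 1) ≤ 0 := by
      intro k
      by_contra! hk
      set g := f (Pi.single k 1) with hg
      have hvb := hv b Set.self_mem_Iic
      have hs : 0 ≤ (f b - v) / g := div_nonneg (by linarith) hk.le
      have := hv (b - ((f b - v) / g) • Pi.single k 1) (by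
        simp only [Set.mem_Iic, sub_le_self_iff]
        exact smul_nonneg hs (Pi.single_nonneg.2 zero_le_one))
      rw [map_sub, map_smul, ← hg, smul_eq_mul, div_mul_cancel₀ _ hk.ne'] at this
      linarith
    obtain ⟨i, hi⟩ := h (fun k => -f (Pi.single k 1)) fun k => neg_nonneg.2 (hneg k)
    have h1 := hu (D i) (subset_convexHull _ _ ⟨i, rfl⟩)
    have h2 := hv b Set.self_mem_Iic
    rw [hf] at h1 h2
    simp only [neg_mul, Finset.sum_neg_distrib, mul_comm (f _)] at hi
    linarith
  obtain ⟨J, _, p, z, hp0, hp1, hz, rfl⟩ := mem_convexHull_iff_exists_fintype.1 hx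
  choose g hg using hz
  set e := (Fintype.equivFin {j // p j ≠ 0}).symm with he
  have hsum : ∀ F : J → ℝ, ∑ j, p (e j) * F (e j) = ∑ j, p j * F j := by
    intro F
    rw [Equiv.sum_comp e (fun j => p j.1 * F j.1)]
    exact (Finset.sum_subtype (univ.filter fun j => p j ≠ 0) (by simp) _).symm.trans
      (Finset.sum_filter_of_ne fun j _ hj => left_ne_zero_of_mul hj)
  refine ⟨_, fun j => p (e j), fun j => g (e j), fun j => (hp0 _).lt_of_ne' (e j).2, ?_, ?_⟩
  · simpa using (hsum fun _ => 1).trans (by simpa using hp1)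
  · intro k
    refine (hsum fun j => D (g j) k).trans_le ?_
    have := hxb k
    simpa [hg] using this

end Minimax

section Main
variable {V : Type*} [Fintype V] {G : SimpleGraph V} {w : Sym2 V → ℝ}

lemma exists_isSpanningTree_wWeight_eq (hG : G.Connected) (w : Sym2 V → ℝ) :
    ∃ T, IsSpanningTree G T ∧ wWeight T w = mstWeight G w := by
  obtain ⟨T, hT, hmin⟩ := Set.exists_min_image {T | IsSpanningTree G T} (fun T => wWeight T w)
    (Set.toFinite _) hG.exists_isTree_le
  have h : IsLeast {x : ℝ | ∃ T, IsSpanningTree G T ∧ x = wWeight T w} (wWeight T w) := by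
    refine ⟨⟨T, hT, rfl⟩, ?_⟩
    rintro _ ⟨T', hT', rfl⟩
    exact hmin T' hT'
  exact ⟨T, hT, h.csInf_eq.symm⟩

lemma wWeight_pos [Nontrivial V] (hw : ∀ e, 0 < w e) {T : SimpleGraph V} (hT : T.Connected) :
    0 < wWeight T w := by
  obtain ⟨v⟩ := hT.nonempty
  obtain ⟨u, hu⟩ := hT.preconnected.exists_adj_of_nontrivial v
  exact Finset.sum_pos (fun e _ => hw e) ⟨s(v, u), by simpa using hu⟩

lemma wdist_congr {w' : Sym2 V → ℝ} (h : ∀ e ∈ G.edgeSet, w e = w' e) (u v : V) :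
    wdist G w u v = wdist G w' u v := by
  unfold wdist
  congr 1
  ext x
  refine exists_congr fun p => ?_
  rw [List.map_congr_left fun e he => h e (p.edges_subset_edgeSet he)]

lemma wWeight_congr {w' : Sym2 V → ℝ} (h : ∀ e ∈ G.edgeSet, w e = w' e) :
    wWeight G w = wWeight G w' :=
  Finset.sum_congr rfl fun e he => h e (by simpa using he)

lemma mstWeight_congr {w' : Sym2 V → ℝ} (h : ∀ e ∈ G.edgeSet, w e = w' e) :
    mstWeight G w = mstWeight G w' := by
  unfold mstWeight
  congr 1
  ext x
  refine exists_congr fun T => and_congr_right fun hT => ?_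
  rw [wWeight_congr fun e he => h e (SimpleGraph.edgeSet_mono hT.1 he)]

lemma exists_scale {ε : ℝ} (hε : 0 < ε) (hε1 : ε < 1) :
    ∃ i : ℕ, 2 * ((2 : ℝ) ^ 2 ^ i)⁻¹ ≤ ε ∧ (2 : ℝ) ^ i ≤ 2 * Real.logb 2 (2 / ε) := by
  have h2 : 2 ≤ 2 / ε := by
    rw [le_div_iff₀ hε]
    linarith
  have hx : 1 ≤ Real.logb 2 (2 / ε) := by
    rw [Real.le_logb_iff_rpow_le one_lt_two (by positivity)]
    simpa using h2
  obtain ⟨n, hn, hn'⟩ := exists_nat_pow_near hx one_lt_two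
  refine ⟨n + 1, ?_, by rw [pow_succ]; linarith⟩
  have h3 : 2 / ε ≤ (2 : ℝ) ^ 2 ^ (n + 1) := by
    rw [Real.logb_lt_iff_lt_rpow one_lt_two (by positivity)] at hn'
    refine hn'.le.trans_eq ?_
    rw [← Real.rpow_natCast 2 (2 ^ (n + 1)), Nat.cast_pow, Nat.cast_ofNat]
  rw [← div_eq_mul_inv, div_le_iff₀ (by positivity)]
  rwa [div_le_iff₀' hε] at h3

/-- The expected stretch of the random tree, scale by scale. -/
theorem exists_distribution (hw : ∀ e, 0 < w e) (hG : G.Connected) [Nontrivial V] {ρ : ℝ}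
    (hρ : 0 < ρ) (hρ1 : ρ < 1) :
    ∃ (m : ℕ) (prob : Fin m → ℝ) (T : Fin m → SimpleGraph V) (lev : V × V → ℕ),
      (∀ i, 0 < prob i) ∧ ∑ i, prob i = 1 ∧
      (∀ i, IsSpanningTree G (T i) ∧ wWeight (T i) w / mstWeight G w ≤ 1 + ρ) ∧
      (∀ i, ((univ.offDiag.filter fun p => i < lev p).card : ℝ) ≤
        2 * ((2 : ℝ) ^ 2 ^ i)⁻¹ * ((Fintype.card V : ℝ) * ((Fintype.card V : ℝ) - 1))) ∧
      ∀ p ∈ (univ : Finset V).offDiag, ∑ i, prob i * wdist (T i) w p.1 p.2 ≤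
        10 ^ 14 / ρ * levelStretch (lev p) * wdist G w p.1 p.2 := by
  obtain ⟨T₀, hT₀, hmst⟩ := exists_isSpanningTree_wWeight_eq hG w
  have hW := wWeight_pos hw hT₀.2.connected
  obtain ⟨y, ι, hι, hyι, hy, hbad⟩ := exists_nets (fun e => (hw e).le) hG
  obtain ⟨lev, hlev, hmin⟩ := exists_level hbad
  have hgood : ∀ p : {p : V × V // p.1 ≠ p.2},
      wdist G w p.1.1 (y (lev p) p.1.1) ≤ 2 * wdist G w p.1.1 p.1.2 ∧
      wdist G w p.1.2 (y (lev p) p.1.2) ≤ 2 * wdist G w p.1.1 p.1.2 := by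
    intro p
    by_contra h
    exact hlev p (mem_filter.2 ⟨by simpa using p.2, h⟩)
  let L := {T : SimpleGraph V // IsSpanningTree G T ∧ wWeight T w ≤ (1 + ρ) * wWeight T₀ w}
  have : Fintype L := Fintype.ofFinite L
  obtain ⟨m, prob, f, hp0, hp1, hf⟩ := exists_prob_sum_le
    (fun (T : L) (p : {p : V × V // p.1 ≠ p.2}) => wdist T.1 w p.1.1 p.1.2)
    (fun p => 10 ^ 14 / ρ * levelStretch (lev p) * wdist G w p.1.1 p.1.2) fun c hc => by
      obtain ⟨T, hT, hTw, hs⟩ := exists_light_tree (a := fun p : {p : V × V // p.1 ≠ p.2} => p.1.1)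
        (b := fun p => p.1.2) hw hG hT₀ hW hρ hρ1 hι hyι hy (fun p => lev p)
        (fun p => (hgood p).1) (fun p => (hgood p).2) hc
      exact ⟨⟨T, hT, hTw⟩, hs⟩
  refine ⟨m, prob, fun j => (f j).1, lev, hp0, hp1, fun j => ⟨(f j).2.1, ?_⟩, fun i => ?_, ?_⟩
  · rw [← hmst, div_le_iff₀ hW]
    exact (f j).2.2
  · refine le_trans ?_ (hbad i)
    refine Nat.cast_le.2 (Finset.card_le_card fun p hp => ?_)
    by_contra h
    exact (hmin p i h).not_gt (mem_filter.1 hp).2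
  · intro p hp
    exact hf ⟨p, by simpa using hp⟩

end Main

end LightTree

/-- There is a universal constant `C > 0` such that every weighted graph
`G` and every `0 < ρ < 1` admit a finitely supported probability distribution over
spanning trees of `G` (given by trees `T i` with probabilities `prob i`), each of
lightness at most `1 + ρ`, such that for every `ε ∈ (0,1)` at least a `(1-ε)` fraction of
the pairs of distinct vertices `u,v` (counted over ordered pairs, `n·(n-1) = 2·(n choose 2)`)
satisfy `E_T[d_T(u,v)] ≤ (C/ρ)·(1 + log₂(2/ε))⁴ · d_G(u,v)`. -/
theorem stmt13 :
    ∃ C : ℝ, 0 < C ∧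
      ∀ (V : Type) [Fintype V] (G : SimpleGraph V) (w : Sym2 V → ℝ),
        IsWeightedGraph G w →
        ∀ ρ : ℝ, 0 < ρ → ρ < 1 →
          ∃ (m : ℕ) (prob : Fin m → ℝ) (T : Fin m → SimpleGraph V),
            (∀ i : Fin m, 0 < prob i) ∧ (∑ i : Fin m, prob i) = 1 ∧
            (∀ i : Fin m, IsSpanningTree G (T i) ∧
              wWeight (T i) w / mstWeight G w ≤ 1 + ρ) ∧
            ∀ ε : ℝ, 0 < ε → ε < 1 →
              (1 - ε) * ((Fintype.card V : ℝ) * ((Fintype.card V : ℝ) - 1)) ≤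
                ((Finset.univ.offDiag.filter (fun p : V × V =>
                  ∑ i : Fin m, prob i * wdist (T i) w p.1 p.2 ≤
                    (C / ρ) * (1 + Real.logb 2 (2 / ε)) ^ 4 * wdist G w p.1 p.2)).card : ℝ) := by
  obtain ⟨C, hC0, hC⟩ := LightTree.exists_levelStretch_le
  refine ⟨16 * 10 ^ 14 * C, by positivity, fun V _ G w hGw ρ hρ hρ1 => ?_⟩
  obtain ⟨hG, hwG, -⟩ := hGw
  have : Nonempty V := hG.nonempty
  rcases subsingleton_or_nontrivial V with hV | hV
  · obtain ⟨T₀, hT₀, hmst⟩ := LightTree.exists_isSpanningTree_wWeight_eq hG w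
    refine ⟨1, fun _ => 1, fun _ => T₀, fun _ => one_pos, by simp, fun _ => ⟨hT₀, ?_⟩,
      fun ε _ _ => ?_⟩
    · rw [← hmst]
      linarith [div_self_le_one (wWeight T₀ w)]
    · have : Fintype.card V = 1 := le_antisymm (Fintype.card_le_one_iff_subsingleton.2 hV)
        Fintype.card_pos
      simp [this]
  set w' : Sym2 V → ℝ := fun e => if e ∈ G.edgeSet then w e else 1 with hw'
  have hww' : ∀ e ∈ G.edgeSet, w e = w' e := fun e he => (if_pos he).symm
  have hw'0 : ∀ e, 0 < w' e := by
    intro e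
    simp only [hw']
    split_ifs with h
    exacts [hwG e h, one_pos]
  obtain ⟨m, prob, T, lev, hp0, hp1, hT, hlev, hs⟩ :=
    LightTree.exists_distribution hw'0 hG hρ hρ1
  have hwT : ∀ i, ∀ e ∈ (T i).edgeSet, w e = w' e := fun i e he =>
    hww' e (SimpleGraph.edgeSet_mono (hT i).1.1 he)
  refine ⟨m, prob, T, hp0, hp1, fun i => ⟨(hT i).1, ?_⟩, fun ε hε hε1 => ?_⟩
  · rw [LightTree.wWeight_congr (hwT i), LightTree.mstWeight_congr hww']
    exact (hT i).2
  obtain ⟨i, hi, hi'⟩ := LightTree.exists_scale hε hε1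
  set n : ℝ := ((Fintype.card V : ℕ) : ℝ) with hn
  have hn1 : 1 ≤ n := by
    rw [hn]
    exact_mod_cast Fintype.card_pos
  have hcard : ((univ : Finset V).offDiag.card : ℝ) = n * (n - 1) := by
    rw [Finset.offDiag_card, Finset.card_univ, Nat.cast_sub (Nat.le_mul_self _), hn]
    push_cast
    ring
  have hsplit : ((univ : Finset V).offDiag.card : ℝ) =
      (univ.offDiag.filter fun p => i < lev p).card +
        (univ.offDiag.filter fun p => ¬ i < lev p).card := by
    exact_mod_cast (Finset.card_filter_add_card_filter_not _).symm
  have hbad : ((univ.offDiag.filter fun p => i < lev p).card : ℝ) ≤ ε * (n * (n - 1)) :=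
    (hlev i).trans (mul_le_mul_of_nonneg_right hi
      (mul_nonneg (by linarith) (by linarith)))
  have hsub : ((univ.offDiag.filter fun p => ¬ i < lev p).card : ℝ) ≤
      ((Finset.univ.offDiag.filter (fun p : V × V =>
        ∑ i : Fin m, prob i * wdist (T i) w p.1 p.2 ≤
          (16 * 10 ^ 14 * C / ρ) * (1 + Real.logb 2 (2 / ε)) ^ 4 *
            wdist G w p.1 p.2)).card : ℝ) := by
    refine Nat.cast_le.2 (Finset.card_le_card fun p hp => ?_)
    obtain ⟨hp, hpi⟩ := mem_filter.1 hp
    refine mem_filter.2 ⟨hp, ?_⟩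
    rw [LightTree.wdist_congr hww']
    simp only [LightTree.wdist_congr (hwT _)]
    refine (hs p hp).trans (mul_le_mul_of_nonneg_right ?_
      (LightTree.wdist_nonneg (fun e => (hw'0 e).le) _ _))
    have hlog : (0 : ℝ) ≤ Real.logb 2 (2 / ε) := by
      have : (0 : ℝ) < 2 ^ i := by positivity
      linarith
    have h4 : (2 : ℝ) ^ (4 * lev p) ≤ 16 * (1 + Real.logb 2 (2 / ε)) ^ 4 :=
      calc (2 : ℝ) ^ (4 * lev p) ≤ 2 ^ (4 * i) :=
            pow_le_pow_right₀ one_le_two (by omega)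
        _ = (2 ^ i) ^ 4 := by rw [mul_comm, pow_mul]
        _ ≤ (2 * (1 + Real.logb 2 (2 / ε))) ^ 4 :=
            pow_le_pow_left₀ (by positivity) (by linarith) 4
        _ = _ := by ring
    calc 10 ^ 14 / ρ * LightTree.levelStretch (lev p)
        ≤ 10 ^ 14 / ρ * (C * (16 * (1 + Real.logb 2 (2 / ε)) ^ 4)) := by
          gcongr
          exact (hC _).trans (by gcongr)
      _ = _ := by ring
  rw [hcard] at hsplit
  linarith
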